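/- Let H ⊂ ℂ^N be a Levi-flat local real-hypervariety and suppose p ∈ closure(H*) ∩ U (the relative closure of H* in the open set U where H is closed). Then there exists a neighborhood U' of p and an irreducible complex subvariety W ⊂ U' of complex dimension N−1 such that W ⊂ closure(H*) ∩ U and p ∈ W. -/

import Mathlib

/- Common definitions: real-analytic and complex-analytic subvarieties of ℂ^N,
Levi-flat hypervarieties, CR submanifolds, Segre varieties, etc. -/

open Complex Set Topology Filter
open scoped ENNReal

noncomputable section

abbrev CN (N : ℕ) := Fin N → ℂ

/-- `X` is a (relatively closed) real-analytic subvariety of the open set `U ⊆ ℂ^N`. -/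
def IsRealSubvariety (N : ℕ) (U X : Set (CN N)) : Prop :=
  X ⊆ U ∧ closure X ∩ U ⊆ X ∧
    ∀ p ∈ U, ∃ V : Set (CN N), IsOpen V ∧ p ∈ V ∧ V ⊆ U ∧
      ∃ (k : ℕ) (f : Fin k → CN N → ℝ),
        (∀ i, AnalyticOn ℝ (f i) V) ∧ X ∩ V = {z ∈ V | ∀ i, f i z = 0}

/-- `X` is a (relatively closed) complex-analytic subvariety of the open set `U ⊆ ℂ^N`. -/
def IsComplexSubvariety (N : ℕ) (U X : Set (CN N)) : Prop :=
  X ⊆ U ∧ closure X ∩ U ⊆ X ∧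
    ∀ p ∈ U, ∃ V : Set (CN N), IsOpen V ∧ p ∈ V ∧ V ⊆ U ∧
      ∃ (k : ℕ) (f : Fin k → CN N → ℂ),
        (∀ i, AnalyticOn ℂ (f i) V) ∧ X ∩ V = {z ∈ V | ∀ i, f i z = 0}

/-- `X` is a real-analytic subvariety of the (not necessarily open) set `V`. -/
def IsRealSubvarietyIn (N : ℕ) (V X : Set (CN N)) : Prop :=
  X ⊆ V ∧ closure X ∩ V ⊆ X ∧
    ∀ p ∈ V, ∃ W : Set (CN N), IsOpen W ∧ p ∈ W ∧
      ∃ (k : ℕ) (f : Fin k → CN N → ℝ),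
        (∀ i, AnalyticOn ℝ (f i) W) ∧ X ∩ W = {z ∈ V ∩ W | ∀ i, f i z = 0}

/-- `X` is a complex-analytic subvariety of the (not necessarily open) set `V`. -/
def IsComplexSubvarietyIn (N : ℕ) (V X : Set (CN N)) : Prop :=
  X ⊆ V ∧ closure X ∩ V ⊆ X ∧
    ∀ p ∈ V, ∃ W : Set (CN N), IsOpen W ∧ p ∈ W ∧
      ∃ (k : ℕ) (f : Fin k → CN N → ℂ),
        (∀ i, AnalyticOn ℂ (f i) W) ∧ X ∩ W = {z ∈ V ∩ W | ∀ i, f i z = 0}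

/-- Near `p`, `X` is a real-analytic submanifold of ℂ^N of real dimension `d`,
cut out by `2N - d` real-analytic functions with linearly independent differentials. -/
def IsSubmanifoldAtDim (N d : ℕ) (X : Set (CN N)) (p : CN N) : Prop :=
  ∃ (V : Set (CN N)) (f : Fin (2 * N - d) → CN N → ℝ),
    IsOpen V ∧ p ∈ V ∧ (∀ i, AnalyticOn ℝ (f i) V) ∧
    (∀ z ∈ V, LinearIndependent ℝ fun i => fderiv ℝ (f i) z) ∧
    X ∩ V = {z ∈ V | ∀ i, f i z = 0}

/-- Near `p`, `X` is a complex submanifold of ℂ^N of complex dimension `d`. -/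
def IsCxSubmanifoldAtDim (N d : ℕ) (X : Set (CN N)) (p : CN N) : Prop :=
  ∃ (V : Set (CN N)) (f : Fin (N - d) → CN N → ℂ),
    IsOpen V ∧ p ∈ V ∧ (∀ i, AnalyticOn ℂ (f i) V) ∧
    (∀ z ∈ V, LinearIndependent ℂ fun i => fderiv ℂ (f i) z) ∧
    X ∩ V = {z ∈ V | ∀ i, f i z = 0}

/-- Points near which `X` is a real-analytic submanifold of some dimension. -/
def regPts (N : ℕ) (X : Set (CN N)) : Set (CN N) :=
  {p ∈ X | ∃ d, IsSubmanifoldAtDim N d X p}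

/-- The singular set `X_s` of a real-analytic subvariety. -/
def singSet (N : ℕ) (X : Set (CN N)) : Set (CN N) := X \ regPts N X

/-- `H*`: the points near which `H` is a nonsingular real-analytic hypersurface. -/
def hypStar (N : ℕ) (H : Set (CN N)) : Set (CN N) :=
  {p ∈ H | IsSubmanifoldAtDim N (2 * N - 1) H p}

/-- Near `p` the hypersurface `H` is given by `Im f = 0` for a holomorphic `f` with
nonvanishing differential (the local model of a nonsingular Levi-flat hypersurface). -/
def IsLeviFlatHypAt (N : ℕ) (H : Set (CN N)) (p : CN N) : Prop :=
  ∃ (V : Set (CN N)) (f : CN N → ℂ),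
    IsOpen V ∧ p ∈ V ∧ AnalyticOn ℂ f V ∧ (∀ z ∈ V, fderiv ℂ f z ≠ 0) ∧
    H ∩ V = {z ∈ V | (f z).im = 0}

/-- A Levi-flat real-hypervariety `H` of the open set `U`: a relatively closed
real-analytic subvariety of real dimension `2N - 1` whose regular hypersurface
part `H*` is Levi-flat. -/
def IsLeviFlatHypervariety (N : ℕ) (U H : Set (CN N)) : Prop :=
  IsOpen U ∧ IsRealSubvariety N U H ∧ dimH H = ((2 * N - 1 : ℕ) : ℝ≥0∞) ∧
    ∀ p ∈ hypStar N H, IsLeviFlatHypAt N H p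

/-- Near `p`, in suitable local holomorphic coordinates `Φ`, the set `M` is given by
`Im z₁ = ⋯ = Im z_j = 0`, `z_{j+1} = ⋯ = z_k = 0`: `M` is a Levi-flat CR
submanifold at `p`. -/
def IsLeviFlatCRAt (N : ℕ) (M : Set (CN N)) (p : CN N) : Prop :=
  ∃ (V : Set (CN N)) (Φ : CN N → CN N) (j k : ℕ),
    j ≤ k ∧ k ≤ N ∧ IsOpen V ∧ p ∈ V ∧
    AnalyticOn ℂ Φ V ∧ InjOn Φ V ∧
    (∀ z ∈ V, Function.Bijective ⇑(fderiv ℂ Φ z)) ∧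
    M ∩ V = {z ∈ V | (∀ i : Fin N, (i : ℕ) < j → (Φ z i).im = 0) ∧
      ∀ i : Fin N, j ≤ (i : ℕ) → (i : ℕ) < k → Φ z i = 0}

/-- The holomorphic part `∂r` of the differential of a real function `r` at `z`,
as a complex-valued form: `∂r(v) = dr(v) - i · dr(i·v)` (up to a factor `2`). -/
def delForm (N : ℕ) (r : CN N → ℝ) (z : CN N) : CN N → ℂ := fun v =>
  Complex.ofReal (fderiv ℝ r z v) -
    Complex.I * Complex.ofReal (fderiv ℝ r z (Complex.I • v))

/-- `M` is a generic submanifold near `p`: locally cut out by real-analytic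
`r₁, …, r_k` with `∂r₁, …, ∂r_k` linearly independent. -/
def IsGenericSubmanifoldAt (N : ℕ) (M : Set (CN N)) (p : CN N) : Prop :=
  ∃ (V : Set (CN N)) (k : ℕ) (r : Fin k → CN N → ℝ),
    IsOpen V ∧ p ∈ V ∧ (∀ i, AnalyticOn ℝ (r i) V) ∧
    (∀ z ∈ V, LinearIndependent ℝ fun i => fderiv ℝ (r i) z) ∧
    (∀ z ∈ V, LinearIndependent ℂ fun i => delForm N (r i) z) ∧
    M ∩ V = {z ∈ V | ∀ i, r i z = 0}

/-- Near `p`, in suitable local holomorphic coordinates, `M` is `{Im z₁ = Im z₂ = 0}`: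
the local model of a generic Levi-flat submanifold of real dimension `2N - 2`. -/
def IsGenericLeviFlat2At (N : ℕ) (M : Set (CN N)) (p : CN N) : Prop :=
  ∃ (V : Set (CN N)) (Φ : CN N → CN N),
    IsOpen V ∧ p ∈ V ∧ AnalyticOn ℂ Φ V ∧ InjOn Φ V ∧
    (∀ z ∈ V, Function.Bijective ⇑(fderiv ℂ Φ z)) ∧
    M ∩ V = {z ∈ V | ∀ i : Fin N, (i : ℕ) < 2 → (Φ z i).im = 0}

/-- The complex-tangent (CR) vectors to `M` at `p`. -/
def crTangent (N : ℕ) (M : Set (CN N)) (p : CN N) : Set (CN N) :=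
  {v | v ∈ tangentConeAt ℝ M p ∧ Complex.I • v ∈ tangentConeAt ℝ M p}

/-- The CR dimension of `M` at `p`. -/
def crDim (N : ℕ) (M : Set (CN N)) (p : CN N) : ℕ :=
  Module.finrank ℂ (Submodule.span ℂ (crTangent N M p))

/-- `M` is a real-analytic CR submanifold: a real-analytic submanifold with
constant CR dimension. -/
def IsCRSubmanifold (N : ℕ) (M : Set (CN N)) : Prop :=
  (∃ d, ∀ p ∈ M, IsSubmanifoldAtDim N d M p) ∧ ∃ m, ∀ p ∈ M, crDim N M p = m

/-- Coordinatewise complex conjugation. -/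
def conjPt (N : ℕ) (z : CN N) : CN N := fun i => starRingEnd ℂ (z i)

/-- `R` is the complexification `r(z, w̄)` of the real-analytic function `r` on `U`:
it is holomorphic on `U × *U` (where `*U` is the conjugate of `U`) and `R(z, z̄) = r(z)`. -/
def IsComplexification (N : ℕ) (U : Set (CN N)) (r : CN N → ℝ)
    (R : CN N → CN N → ℂ) : Prop :=
  AnalyticOn ℂ (fun zw : CN N × CN N => R zw.1 zw.2) (U ×ˢ (conjPt N '' U)) ∧
    ∀ z ∈ U, R z (conjPt N z) = Complex.ofReal (r z)

/-- The Segre variety `Σ_p(U, r) = {z ∈ U : r(z, p̄) = 0}`, for `R` the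
complexification of `r`. -/
def segreSet (N : ℕ) (U : Set (CN N)) (R : CN N → CN N → ℂ) (p : CN N) : Set (CN N) :=
  {z ∈ U | R z (conjPt N p) = 0}

/-- `p` is a Segre-degenerate singularity of `H`: for every local defining function `r` of
`H` at `p`, the function `z ↦ r(z, p̄)` vanishes identically near `p`. -/
def IsSegreDegenerateAt (N : ℕ) (H : Set (CN N)) (p : CN N) : Prop :=
  ∀ (V : Set (CN N)) (r : CN N → ℝ) (R : CN N → CN N → ℂ),
    IsOpen V → p ∈ V → AnalyticOn ℝ r V → IsComplexification N V r R →
    H ∩ V = {z ∈ V | r z = 0} → ∀ᶠ z in nhds p, R z (conjPt N p) = 0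

/-- `Σ'`: the union of all complex subvarieties of `V` of complex dimension `N - 1`
contained in `H`. -/
def sigmaPrime (N : ℕ) (H V : Set (CN N)) : Set (CN N) :=
  ⋃₀ {W | IsComplexSubvariety N V W ∧ W ⊆ H ∧ dimH W = ((2 * N - 2 : ℕ) : ℝ≥0∞)}

/-- `p` is a leaf-degenerate point of `H`: the germ `Σ'_p(H)` is not a complex variety of
dimension `N - 1`, i.e. there is no single complex subvariety `W ∋ p` of dimension `N - 1`
inside `H` containing all complex hypervarieties of `H` near `p`. -/
def IsLeafDegenerateAt (N : ℕ) (H : Set (CN N)) (p : CN N) : Prop :=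
  ¬∃ (V W : Set (CN N)), IsOpen V ∧ p ∈ V ∧ p ∈ W ∧ W ⊆ H ∧
    IsComplexSubvariety N V W ∧ dimH W = ((2 * N - 2 : ℕ) : ℝ≥0∞) ∧
    ∀ V' : Set (CN N), IsOpen V' → V' ⊆ V → sigmaPrime N H V' ⊆ W

/-- An irreducible complex subvariety of `U`. -/
def IsIrreducibleCxSubvariety (N : ℕ) (U W : Set (CN N)) : Prop :=
  IsComplexSubvariety N U W ∧ W.Nonempty ∧
    ∀ W₁ W₂ : Set (CN N), IsComplexSubvariety N U W₁ → IsComplexSubvariety N U W₂ →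
      W = W₁ ∪ W₂ → W = W₁ ∨ W = W₂

/-- The germ of the real-analytic variety `H` at `p` is irreducible: in any decomposition
of `H` near `p` into two real-analytic subvarieties, one of them contains `H` near `p`. -/
def IsIrreducibleGermAt (N : ℕ) (H : Set (CN N)) (p : CN N) : Prop :=
  ∀ V H₁ H₂ : Set (CN N), IsOpen V → p ∈ V →
    IsRealSubvariety N V H₁ → IsRealSubvariety N V H₂ → H ∩ V = H₁ ∪ H₂ →
    ∃ V' : Set (CN N), IsOpen V' ∧ p ∈ V' ∧ (H ∩ V' ⊆ H₁ ∨ H ∩ V' ⊆ H₂)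

/-- `M` is minimal at `p`: every (real-analytic) CR submanifold of `M` through `p` with
the same CR dimension contains a neighborhood of `p` in `M`. -/
def IsMinimalAt (N : ℕ) (M : Set (CN N)) (p : CN N) : Prop :=
  ∀ M' : Set (CN N), p ∈ M' → M' ⊆ M →
    (∃ d, ∀ q ∈ M', IsSubmanifoldAtDim N d M' q) →
    (∀ q ∈ M', crDim N M' q = crDim N M p) →
    ∃ V : Set (CN N), IsOpen V ∧ p ∈ V ∧ M ∩ V ⊆ M'

/-- `O` is (a representative of) the local CR orbit of `M` at `p`, of dimension `d`:
the smallest CR submanifold of `M` through `p` of the same CR dimension as `M` at `p`. -/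
def IsCROrbitAt (N d : ℕ) (M O : Set (CN N)) (p : CN N) : Prop :=
  p ∈ O ∧ O ⊆ M ∧ (∀ q ∈ O, IsSubmanifoldAtDim N d O q) ∧
    (∀ q ∈ O, crDim N O q = crDim N M p) ∧
    ∀ O' : Set (CN N), p ∈ O' → O' ⊆ M →
      (∃ d', ∀ q ∈ O', IsSubmanifoldAtDim N d' O' q) →
      (∀ q ∈ O', crDim N O' q = crDim N M p) →
      ∃ V : Set (CN N), IsOpen V ∧ p ∈ V ∧ O ∩ V ⊆ O'

/-- `r` generates the ideal of germs at `p` of real-analytic functions vanishing on `H`. -/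
def GeneratesVanishingIdealAt (N : ℕ) (H V : Set (CN N)) (r : CN N → ℝ) (p : CN N) :
    Prop :=
  (∀ z ∈ H ∩ V, r z = 0) ∧
    ∀ (V' : Set (CN N)) (g : CN N → ℝ), IsOpen V' → p ∈ V' → AnalyticOn ℝ g V' →
      (∀ z ∈ H ∩ V', g z = 0) →
      ∃ (V'' : Set (CN N)) (q : CN N → ℝ), IsOpen V'' ∧ p ∈ V'' ∧ V'' ⊆ V ∩ V' ∧
        AnalyticOn ℝ q V'' ∧ ∀ z ∈ V'', g z = q z * r z

/-- The exterior derivative of a one-form `ω`, evaluated at `z` on `(u, v)`. -/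
def oneFormD (N : ℕ) (ω : CN N → (CN N →L[ℂ] ℂ)) (z u v : CN N) : ℂ :=
  fderiv ℂ ω z u v - fderiv ℂ ω z v u

/-- `(ω ∧ dω)(u, v, w)` at `z`; its vanishing is complete integrability of `ω`. -/
def integrabilityWedge (N : ℕ) (ω : CN N → (CN N →L[ℂ] ℂ)) (z u v w : CN N) : ℂ :=
  ω z u * oneFormD N ω z v w - ω z v * oneFormD N ω z u w + ω z w * oneFormD N ω z u v

namespace LeviFlat

set_option linter.unusedSectionVars false

open Metric Polynomial

section Holomorphic

variable {V E : Type*} [NormedAddCommGroup V] [NormedSpace ℂ V]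
  [NormedAddCommGroup E] [NormedSpace ℂ E]

theorem differentiableOn_line {f : V → E} {a w : V} {r ρ : ℝ}
    (hf : DifferentiableOn ℂ f (ball a r)) (h : ρ * ‖w‖ ≤ r) :
    DifferentiableOn ℂ (fun ζ : ℂ => f (a + ζ • w)) (ball 0 ρ) ∧
      MapsTo (fun ζ : ℂ => a + ζ • w) (ball 0 ρ) (ball a r ∪ {a}) := by
  by_cases hw : w = 0
  · subst hw; simp [MapsTo]
  have hm : MapsTo (fun ζ : ℂ => a + ζ • w) (ball 0 ρ) (ball a r) := by
    intro ζ hζ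
    have : ‖ζ‖ < ρ := by simpa using hζ
    have hw' : 0 < ‖w‖ := norm_pos_iff.2 hw
    simp only [mem_ball, dist_eq_norm, add_sub_cancel_left, norm_smul]
    calc ‖ζ‖ * ‖w‖ < ρ * ‖w‖ := by gcongr
      _ ≤ r := h
  exact ⟨hf.comp (by fun_prop) hm, fun ζ hζ => Or.inl (hm hζ)⟩

theorem exists_ball_bounded {Ω : Set V} (hΩ : IsOpen Ω) {f : V → E}
    (hf : DifferentiableOn ℂ f Ω) {a : V} (ha : a ∈ Ω) :
    ∃ r M : ℝ, 0 < r ∧ ball a r ⊆ Ω ∧ ∀ z ∈ ball a r, ‖f z‖ ≤ M := by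
  have hc := ((hf.differentiableAt (hΩ.mem_nhds ha)).continuousAt).norm
  have := (hc.eventually (gt_mem_nhds (lt_add_one ‖f a‖))).and (hΩ.mem_nhds ha)
  obtain ⟨r, hr, h⟩ := Metric.eventually_nhds_iff_ball.1 this
  exact ⟨r, ‖f a‖ + 1, hr, fun z hz => (h z hz).2, fun z hz => (h z hz).1.le⟩

theorem norm_sub_le_of_bounded {f : V → E} {a w : V} {r M : ℝ}
    (hf : DifferentiableOn ℂ f (ball a r)) (hM : ∀ z ∈ ball a r, ‖f z‖ ≤ M) (hw : ‖w‖ < r) :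
    ‖f (a + w) - f a‖ ≤ 2 * M / r * ‖w‖ := by
  by_cases h0 : w = 0
  · simp [h0]
  have hw' : 0 < ‖w‖ := norm_pos_iff.2 h0
  have hr : 0 < r := hw'.trans hw
  obtain ⟨h1, h2⟩ := differentiableOn_line (w := w) (ρ := r / ‖w‖) hf (by field_simp; rfl)
  have ha : a ∈ ball a r := by simpa using hr
  have h2' : MapsTo (fun ζ : ℂ => a + ζ • w) (ball 0 (r / ‖w‖)) (ball a r) := by
    intro ζ hζ
    rcases h2 hζ with h | h
    · exact h
    · rw [h]; exact ha
  have := Complex.dist_le_div_mul_dist_of_mapsTo_ball (R₂ := 2 * M) (z := 1) h1 ?_ ?_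
  · simpa [dist_eq_norm, div_div_eq_mul_div, mul_div_right_comm] using this
  · intro ζ hζ
    simp only [mem_closedBall, dist_eq_norm]
    refine (norm_sub_le _ _).trans ?_
    have := hM _ (h2' hζ)
    have := hM a ha
    simp only [zero_smul, add_zero]; linarith
  · simp only [mem_ball, dist_zero_right, norm_one]
    rwa [one_lt_div hw']

theorem norm_fderiv_le_of_bounded {f : V → E} {a : V} {r M : ℝ} (hr : 0 < r)
    (hf : DifferentiableOn ℂ f (ball a r)) (hM : ∀ z ∈ ball a r, ‖f z‖ ≤ M) :
    ‖fderiv ℂ f a‖ ≤ 2 * M / r := by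
  have hd := (hf.differentiableAt (ball_mem_nhds a hr)).hasFDerivAt
  have hM0 : 0 ≤ M := (norm_nonneg _).trans (hM a (mem_ball_self hr))
  refine hd.le_of_lip' (by positivity) ?_
  filter_upwards [ball_mem_nhds a hr] with x hx
  have := norm_sub_le_of_bounded (w := x - a) hf hM (by simpa [dist_eq_norm] using hx)
  simpa using this

theorem taylor_two {f : V → E} {a w : V} {r M : ℝ}
    (hf : DifferentiableOn ℂ f (ball a r)) (hM : ∀ z ∈ ball a r, ‖f z‖ ≤ M) (hw : ‖w‖ < r) :
    ‖f (a + w) - f a - fderiv ℂ f a w‖ ≤ 4 * M / r ^ 2 * ‖w‖ ^ 2 := by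
  by_cases h0 : w = 0
  · simp [h0]
  have hw' : 0 < ‖w‖ := norm_pos_iff.2 h0
  have hr : 0 < r := hw'.trans hw
  obtain ⟨h1, h2⟩ := differentiableOn_line (w := w) (ρ := r / ‖w‖) hf (by field_simp; rfl)
  have ha : a ∈ ball a r := by simpa using hr
  have h2' : MapsTo (fun ζ : ℂ => a + ζ • w) (ball 0 (r / ‖w‖)) (ball a r) := by
    intro ζ hζ
    rcases h2 hζ with h | h
    · exact h
    · rw [h]; exact ha
  have hd : HasFDerivAt f (fderiv ℂ f a) (a + (0 : ℂ) • w) := by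
    simpa using (hf.differentiableAt (ball_mem_nhds a hr)).hasFDerivAt
  have hL := norm_fderiv_le_of_bounded hr hf hM
  set L := fderiv ℂ f a
  have hder : HasDerivAt (fun ζ : ℂ => f (a + ζ • w) - ζ • L w) 0 0 := by
    have e1 : HasDerivAt (fun ζ : ℂ => a + ζ • w) w 0 := by
      simpa using ((hasDerivAt_id (0 : ℂ)).smul_const w).const_add a
    have := (hd.comp_hasDerivAt (0 : ℂ) e1).sub ((hasDerivAt_id (0 : ℂ)).smul_const (L w))
    rw [one_smul, sub_self] at this
    exact this
  have := Complex.dist_le_mul_div_pow_of_mapsTo_ball_of_isLittleO (R₂ := 4 * M) (z := 1) (n := 1)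
    (f := fun ζ : ℂ => f (a + ζ • w) - ζ • L w) (c := 0) (R₁ := r / ‖w‖)
    (h1.sub (by fun_prop)) ?_ ?_ ?_
  · simp only [dist_eq_norm, one_smul, zero_smul, add_zero, sub_zero, norm_one] at this
    rw [sub_right_comm] at this
    refine this.trans (le_of_eq ?_)
    rw [one_div_div, div_pow]
    ring
  · intro ζ hζ
    simp only [mem_closedBall, dist_eq_norm]
    have b1 := hM _ (h2' hζ)
    have b2 := hM a ha
    have b3 : ‖ζ • L w‖ ≤ 2 * M := by
      have hM0 : 0 ≤ M := (norm_nonneg _).trans b2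
      have hζ' : ‖ζ‖ ≤ r / ‖w‖ := by simpa using (mem_ball.1 hζ).le
      rw [norm_smul]
      calc ‖ζ‖ * ‖L w‖ ≤ (r / ‖w‖) * (2 * M / r * ‖w‖) := by
            gcongr
            exact (L.le_opNorm w).trans (by gcongr)
        _ = 2 * M := by field_simp
    calc _ ≤ ‖f (a + ζ • w)‖ + ‖ζ • L w‖ + ‖f a‖ := by
          simp only [zero_smul, add_zero, sub_zero]
          exact (norm_sub_le _ _).trans (add_le_add_left (norm_sub_le _ _) _)
      _ ≤ 4 * M := by linarith
  · simpa using hder.isLittleO.norm_right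
  · simp only [mem_ball, dist_zero_right, norm_one]
    rwa [one_lt_div hw']

end Holomorphic

section FiniteDimensional

variable {V E : Type*} [NormedAddCommGroup V] [NormedSpace ℂ V] [FiniteDimensional ℂ V]
  [NormedAddCommGroup E] [NormedSpace ℂ E] [FiniteDimensional ℂ E]

/-- A pointwise limit of uniformly bounded holomorphic maps is holomorphic. -/
theorem differentiableOn_of_tendsto {ι : Type*} {l : Filter ι} [l.NeBot] {Ω : Set V} (hΩ : IsOpen Ω)
    {F : ι → V → E} {f : V → E} {M : ℝ} (hF : ∀ᶠ i in l, DifferentiableOn ℂ (F i) Ω)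
    (hM : ∀ᶠ i in l, ∀ z ∈ Ω, ‖F i z‖ ≤ M)
    (hlim : ∀ z ∈ Ω, Tendsto (fun i => F i z) l (𝓝 (f z))) : DifferentiableOn ℂ f Ω := by
  let 𝒰 := Ultrafilter.of l
  have hle : (𝒰 : Filter ι) ≤ l := Ultrafilter.of_le l
  intro a ha
  obtain ⟨r, hr, hball⟩ := Metric.isOpen_iff.1 hΩ a ha
  have : ProperSpace (V →L[ℂ] E) := FiniteDimensional.proper ℂ _
  obtain ⟨L, -, hL⟩ := (isCompact_closedBall (0 : V →L[ℂ] E) (2 * M / r)).ultrafilter_le_nhds'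
    (𝒰.map (fun i => fderiv ℂ (F i) a)) (by
      rw [Ultrafilter.mem_map]
      have : ∀ᶠ i in (𝒰 : Filter ι), fderiv ℂ (F i) a ∈ closedBall (0 : V →L[ℂ] E) (2 * M / r) := by
        filter_upwards [hF.filter_mono hle, hM.filter_mono hle] with i h1 h2
        simpa using norm_fderiv_le_of_bounded hr (h1.mono hball) (fun z hz => h2 z (hball hz))
      exact this)
  have hL' : Tendsto (fun i => fderiv ℂ (F i) a) 𝒰 (𝓝 L) := hL
  have key : ∀ w : V, ‖w‖ < r → ‖f (a + w) - f a - L w‖ ≤ 4 * M / r ^ 2 * ‖w‖ ^ 2 := by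
    intro w hw
    have hmem : a + w ∈ Ω := hball (by simpa [dist_eq_norm] using hw)
    have t : Tendsto (fun i => ‖F i (a + w) - F i a - fderiv ℂ (F i) a w‖) 𝒰
        (𝓝 ‖f (a + w) - f a - L w‖) :=
      ((((hlim _ hmem).mono_left hle).sub ((hlim _ ha).mono_left hle)).sub
        (((ContinuousLinearMap.apply ℂ E w).continuous.tendsto L).comp hL')).norm
    refine le_of_tendsto t ?_
    filter_upwards [hF.filter_mono hle, hM.filter_mono hle] with i h1 h2
    exact taylor_two (h1.mono hball) (fun z hz => h2 z (hball hz)) hw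
  have hder : HasFDerivAt f L a := by
    rw [hasFDerivAt_iff_isLittleO_nhds_zero]
    have hO : (fun h => f (a + h) - f a - L h) =O[𝓝 0] fun h : V => ‖h‖ ^ 2 := by
      refine Asymptotics.IsBigO.of_bound (4 * M / r ^ 2) ?_
      filter_upwards [ball_mem_nhds (0 : V) hr] with w hw
      simpa using key w (by simpa using hw)
    refine hO.trans_isLittleO ?_
    have := Asymptotics.isLittleO_pow_id (𝕜 := ℝ) (n := 2) (by norm_num)
    exact (this.comp_tendsto (tendsto_norm_zero (E := V))).norm_right.congr_right (by simp)|>.of_norm_right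
  exact hder.differentiableAt.differentiableWithinAt

theorem differentiableOn_fderiv_apply {Ω : Set V} (hΩ : IsOpen Ω) {f : V → E}
    (hf : DifferentiableOn ℂ f Ω) (w : V) : DifferentiableOn ℂ (fun z => fderiv ℂ f z w) Ω := by
  intro a ha
  obtain ⟨δ, M, hδ, hsub, hM⟩ : ∃ δ M : ℝ, 0 < δ ∧ ball a (2 * δ) ⊆ Ω ∧
      ∀ z ∈ ball a (2 * δ), ‖f z‖ ≤ M := by
    obtain ⟨r, M, hr, h1, h2⟩ := exists_ball_bounded hΩ hf ha
    exact ⟨r / 2, M, by positivity, by simpa [mul_div_cancel₀] using h1,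
      by simpa [mul_div_cancel₀] using h2⟩
  have h1 : Tendsto (fun n : ℕ => (1 : ℝ) / (n + 1) * ‖w‖) atTop (𝓝 0) := by
    simpa using tendsto_one_div_add_atTop_nhds_zero_nat.mul_const ‖w‖
  have hinc : ∀ n : ℕ, ((n : ℂ) + 1)⁻¹ ≠ 0 := fun n => inv_ne_zero (Nat.cast_add_one_ne_zero n)
  have hnorm : ∀ n : ℕ, ‖(((n : ℂ) + 1)⁻¹) • w‖ = (1 : ℝ) / (n + 1) * ‖w‖ := by
    intro n
    rw [norm_smul, norm_inv, one_div]
    congr 2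
    exact_mod_cast Complex.norm_natCast (n + 1)
  have hzball : ∀ z ∈ ball a δ, ball z δ ⊆ ball a (2 * δ) := fun z hz => by
    refine ball_subset_ball' ?_
    have := mem_ball.1 hz
    linarith
  refine ((differentiableOn_of_tendsto (l := atTop) (M := 2 * M / δ * ‖w‖)
    (F := fun (n : ℕ) z => ((n : ℂ) + 1) • (f (z + (((n : ℂ) + 1)⁻¹) • w) - f z))
    (isOpen_ball (x := a) (ε := δ)) ?_ ?_ ?_).differentiableAt
    (ball_mem_nhds a hδ)).differentiableWithinAt
  · filter_upwards [h1.eventually (gt_mem_nhds hδ)] with n hn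
    rw [← hnorm] at hn
    have hm : MapsTo (fun z => z + (((n : ℂ) + 1)⁻¹) • w) (ball a δ) Ω := fun z hz =>
      hsub (hzball z hz (by simpa [dist_eq_norm] using hn))
    exact ((hf.comp (by fun_prop) hm).sub (hf.mono (fun z hz => hsub (hzball z hz
      (mem_ball_self hδ))))).const_smul _
  · filter_upwards [h1.eventually (gt_mem_nhds hδ)] with n hn z hz
    rw [← hnorm] at hn
    have := norm_sub_le_of_bounded (hf.mono ((hzball z hz).trans hsub))
      (fun y hy => hM y (hzball z hz hy)) hn
    rw [norm_smul]
    have e : ‖((n : ℂ) + 1)‖ * ‖(((n : ℂ) + 1)⁻¹) • w‖ = ‖w‖ := by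
      rw [← norm_smul, smul_smul, mul_inv_cancel₀ (Nat.cast_add_one_ne_zero n), one_smul]
    calc _ ≤ ‖((n : ℂ) + 1)‖ * (2 * M / δ * ‖(((n : ℂ) + 1)⁻¹) • w‖) := by gcongr
      _ = 2 * M / δ * ‖w‖ := by rw [mul_left_comm, e]
  · intro z hz
    have hd := (hf.differentiableAt (hΩ.mem_nhds (hsub (hzball z hz
      (mem_ball_self hδ))))).hasFDerivAt
    refine hd.lim (l := atTop) w (c := fun n : ℕ => (n : ℂ) + 1) ?_
    have : ∀ n : ℕ, ‖(n : ℂ) + 1‖ = (n : ℝ) + 1 := fun n => by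
      exact_mod_cast Complex.norm_natCast (n + 1)
    simp only [this]
    exact tendsto_atTop_add_const_right _ _ tendsto_natCast_atTop_atTop

theorem contDiffOn_of_differentiableOn {Ω : Set V} (hΩ : IsOpen Ω) {f : V → E}
    (hf : DifferentiableOn ℂ f Ω) (n : ℕ) : ContDiffOn ℂ n f Ω := by
  induction n generalizing f with
  | zero => exact contDiffOn_zero.2 hf.continuousOn
  | succ n ih =>
    refine (contDiffOn_succ_iff_fderiv_of_isOpen (n := n) hΩ).2 ⟨hf, by simp, ?_⟩
    exact contDiffOn_clm_apply.2 fun w => ih (differentiableOn_fderiv_apply hΩ hf w)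

theorem norm_iteratedFDeriv_le {f : V → E} {a : V} {r M δ : ℝ} (hδ : 0 < δ)
    (hf : DifferentiableOn ℂ f (ball a r)) (hM : ∀ z ∈ ball a r, ‖f z‖ ≤ M) (k : ℕ) :
    ∀ z ∈ ball a (r - k * δ), ‖iteratedFDeriv ℂ k f z‖ ≤ M * (2 / δ) ^ k := by
  induction k with
  | zero => simpa using hM
  | succ k ih =>
    intro z hz
    rw [← norm_fderiv_iteratedFDeriv]
    have hsub : ball z δ ⊆ ball a (r - k * δ) := by
      refine ball_subset_ball' ?_
      have := mem_ball.1 hz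
      push_cast at this
      linarith
    have hsub' : ball a (r - k * δ) ⊆ ball a r := ball_subset_ball (by nlinarith [k.cast_nonneg (α := ℝ)])
    have hd : DifferentiableOn ℂ (iteratedFDeriv ℂ k f) (ball z δ) := by
      intro y hy
      have hyr := hsub' (hsub hy)
      have := (contDiffOn_of_differentiableOn isOpen_ball hf (k + 1)).contDiffAt
        (isOpen_ball.mem_nhds hyr)
      exact (this.differentiableAt_iteratedFDeriv (m := k)
        (by exact_mod_cast Nat.lt_succ_self k)).differentiableWithinAt
    have := norm_fderiv_le_of_bounded hδ hd (fun y hy => ih y (hsub hy))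
    refine this.trans (le_of_eq ?_)
    rw [pow_succ]
    ring

theorem iteratedDeriv_line {f : V → E} {a y : V} {r ρ : ℝ} (hf : DifferentiableOn ℂ f (ball a r))
    (hρ : ρ * ‖y‖ ≤ r) (hr : 0 < r) (n : ℕ) : ∀ ζ ∈ ball (0 : ℂ) ρ,
    iteratedDeriv n (fun ζ : ℂ => f (a + ζ • y)) ζ = iteratedFDeriv ℂ n f (a + ζ • y) fun _ => y := by
  induction n with
  | zero => simp
  | succ n ih =>
    intro ζ hζ
    have hmem : a + ζ • y ∈ ball a r := by
      rcases (differentiableOn_line hf hρ).2 hζ with h | h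
      · exact h
      · simp only at h; rw [h]; exact mem_ball_self hr
    rw [iteratedDeriv_succ]
    have he : iteratedDeriv n (fun ζ : ℂ => f (a + ζ • y)) =ᶠ[𝓝 ζ]
        fun ζ => iteratedFDeriv ℂ n f (a + ζ • y) fun _ => y := by
      filter_upwards [isOpen_ball.mem_nhds hζ] with ξ hξ using ih ξ hξ
    rw [he.deriv_eq, iteratedFDeriv_succ_apply_left]
    have h1 : HasFDerivAt (iteratedFDeriv ℂ n f) (fderiv ℂ (iteratedFDeriv ℂ n f) (a + ζ • y))
        (a + ζ • y) :=
      (((contDiffOn_of_differentiableOn isOpen_ball hf (n + 1)).contDiffAt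
        (isOpen_ball.mem_nhds hmem)).differentiableAt_iteratedFDeriv (m := n)
        (by exact_mod_cast Nat.lt_succ_self n)).hasFDerivAt
    have e1 : HasDerivAt (fun ζ : ℂ => a + ζ • y) y ζ := by
      simpa using ((hasDerivAt_id ζ).smul_const y).const_add a
    have h2 := h1.comp_hasDerivAt ζ e1
    have h3 := (ContinuousMultilinearMap.apply ℂ (fun _ : Fin n => V) E
      (fun _ => y)).hasFDerivAt.comp_hasDerivAt ζ h2
    exact h3.deriv

/-- Holomorphic maps of several variables are analytic. -/
theorem analyticOnNhd_of_differentiableOn {Ω : Set V} (hΩ : IsOpen Ω) {f : V → E}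
    (hf : DifferentiableOn ℂ f Ω) : AnalyticOnNhd ℂ f Ω := by
  intro a ha
  obtain ⟨r, M, hr, hsub, hM⟩ := exists_ball_bounded hΩ hf ha
  have hf' := hf.mono hsub
  have hM0 : 0 ≤ M := (norm_nonneg _).trans (hM a (mem_ball_self hr))
  let p : FormalMultilinearSeries ℂ V E := fun n =>
    ((n.factorial : ℂ)⁻¹) • iteratedFDeriv ℂ n f a
  have hp : ∀ n, ‖p n‖ * (r / (4 * Real.exp 1)) ^ n ≤ M := by
    intro n
    rcases Nat.eq_zero_or_pos n with rfl | hn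
    · simpa [p] using hM a (mem_ball_self hr)
    have hn' : (0 : ℝ) < n := by exact_mod_cast hn
    have h1 := norm_iteratedFDeriv_le (δ := r / (2 * n)) (by positivity) hf' hM n a
      (by
        have : r - n * (r / (2 * n)) = r / 2 := by field_simp; ring
        rw [this]; exact mem_ball_self (by positivity))
    have h2 : (n : ℝ) ^ n / n.factorial ≤ Real.exp 1 ^ n := by
      rw [← Real.exp_nat_mul, mul_one]
      exact Real.pow_div_factorial_le_exp n hn'.le n
    have h3 : ‖p n‖ = (n.factorial : ℝ)⁻¹ * ‖iteratedFDeriv ℂ n f a‖ := by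
      simp [p, norm_smul]
    rw [h3]
    calc _ ≤ (n.factorial : ℝ)⁻¹ * (M * (2 / (r / (2 * n))) ^ n) * (r / (4 * Real.exp 1)) ^ n := by
          gcongr
      _ = M * (((n : ℝ) ^ n / n.factorial) / Real.exp 1 ^ n) := by
          have : (2 / (r / (2 * n)) : ℝ) = 4 * n / r := by field_simp; ring
          rw [this, div_pow, div_pow, mul_pow, mul_pow]
          field_simp
      _ ≤ M * 1 := by
          gcongr
          exact div_le_one_of_le₀ h2 (by positivity)
      _ = M := mul_one M
  have hr' : 0 < r / (4 * Real.exp 1) := by positivity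
  have hrad : ENNReal.ofReal (r / (4 * Real.exp 1)) ≤ p.radius := by
    have := p.le_radius_of_bound (r := (r / (4 * Real.exp 1)).toNNReal) M
      (fun n => by rw [Real.coe_toNNReal _ hr'.le]; exact hp n)
    exact this
  refine ⟨p, ENNReal.ofReal (min r (r / (4 * Real.exp 1))), ?_, ?_, ?_⟩
  · exact (ENNReal.ofReal_le_ofReal (min_le_right _ _)).trans hrad
  · simpa using ⟨hr, hr'⟩
  · intro y hy
    have hy' : ‖y‖ < r := by
      have := mem_ball_zero_iff.1 (by simpa only [eball_ofReal] using hy)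
      exact this.trans_le (min_le_left _ _)
    obtain ⟨ρ, hρ1, hρ⟩ : ∃ ρ : ℝ, 1 < ρ ∧ ρ * ‖y‖ ≤ r := by
      by_cases h0 : y = 0
      · exact ⟨2, by norm_num, by simpa [h0] using hr.le⟩
      · have : 0 < ‖y‖ := norm_pos_iff.2 h0
        exact ⟨r / ‖y‖, by rwa [one_lt_div this], by field_simp; rfl⟩
    have := Complex.hasSum_taylorSeries_on_ball (c := 0) (z := 1) (r := ρ)
      (differentiableOn_line hf' hρ).1 (by simpa using hρ1)
    simp only [one_smul, sub_zero, one_pow] at this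
    convert this using 2 with n
    rw [iteratedDeriv_line hf' hρ hr n 0 (by simp; linarith)]
    simp [p]

end FiniteDimensional

section LocalTheory

variable {V E : Type*} [NormedAddCommGroup V] [NormedSpace ℂ V] [FiniteDimensional ℂ V]
  [NormedAddCommGroup E] [NormedSpace ℂ E] [FiniteDimensional ℂ E]

theorem eqOn_zero_of_eventuallyEq {Ω : Set V} (hΩ : IsOpen Ω) (hc : IsPreconnected Ω) {f : V → E}
    (hf : DifferentiableOn ℂ f Ω) {a : V} (ha : a ∈ Ω) (h : f =ᶠ[𝓝 a] 0) : EqOn f 0 Ω :=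
  (analyticOnNhd_of_differentiableOn hΩ hf).eqOn_zero_of_preconnected_of_eventuallyEq_zero hc ha h

theorem frequently_ne_zero {Ω : Set V} (hΩ : IsOpen Ω) (hc : IsPreconnected Ω) {f : V → E}
    (hf : DifferentiableOn ℂ f Ω) {b : V} (hb : b ∈ Ω) (h : f b ≠ 0) {a : V} (ha : a ∈ Ω) :
    ∃ᶠ z in 𝓝 a, f z ≠ 0 := by
  intro h0
  simp only [not_not] at h0
  exact h (eqOn_zero_of_eventuallyEq hΩ hc hf ha h0 hb)

theorem differentiableOn_fderiv {Ω : Set V} (hΩ : IsOpen Ω) {f : V → E}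
    (hf : DifferentiableOn ℂ f Ω) : DifferentiableOn ℂ (fderiv ℂ f) Ω :=
  ((contDiffOn_succ_iff_fderiv_of_isOpen (n := 1) hΩ).1
    (contDiffOn_of_differentiableOn hΩ hf 2)).2.2.differentiableOn one_ne_zero

/-- Uniformly bounded holomorphic maps converging pointwise converge locally uniformly. -/
theorem tendstoLocallyUniformlyOn_of_bounded {ι : Type*} {l : Filter ι} [l.NeBot] {Ω : Set V}
    (hΩ : IsOpen Ω) {F : ι → V → E} {f : V → E} {M : ℝ}
    (hF : ∀ᶠ i in l, DifferentiableOn ℂ (F i) Ω) (hM : ∀ᶠ i in l, ∀ z ∈ Ω, ‖F i z‖ ≤ M)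
    (hlim : ∀ z ∈ Ω, Tendsto (fun i => F i z) l (𝓝 (f z))) :
    TendstoLocallyUniformlyOn F f l Ω := by
  have hfM : ∀ z ∈ Ω, ‖f z‖ ≤ M := fun z hz =>
    le_of_tendsto (hlim z hz).norm (hM.mono fun i h => h z hz)
  have hf := differentiableOn_of_tendsto hΩ hF hM hlim
  rw [Metric.tendstoLocallyUniformlyOn_iff]
  intro ε hε a ha
  obtain ⟨r, hr, hball⟩ := Metric.isOpen_iff.1 hΩ a ha
  have hM0 : 0 ≤ M := (norm_nonneg _).trans (hfM a ha)
  set δ := min r (ε * r / (8 * M + 8)) with hδdef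
  have hδ : 0 < δ := lt_min hr (by positivity)
  have hsmall : ∀ g : V → E, DifferentiableOn ℂ g Ω → (∀ z ∈ Ω, ‖g z‖ ≤ M) → ∀ z ∈ ball a δ,
      ‖g z - g a‖ ≤ ε / 4 := by
    intro g hg hgM z hz
    have hz' : ‖z - a‖ < δ := by simpa [dist_eq_norm] using hz
    have := norm_sub_le_of_bounded (w := z - a) (hg.mono hball) (fun z hz => hgM z (hball hz))
      (hz'.trans_le (min_le_left _ _))
    rw [add_sub_cancel] at this
    refine this.trans ?_
    calc 2 * M / r * ‖z - a‖ ≤ 2 * M / r * (ε * r / (8 * M + 8)) := by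
          gcongr
          exact hz'.le.trans (min_le_right _ _)
      _ = ε / 4 * (8 * M / (8 * M + 8)) := by field_simp; ring
      _ ≤ ε / 4 * 1 := by
          gcongr
          exact div_le_one_of_le₀ (by linarith) (by positivity)
      _ = ε / 4 := mul_one _
  refine ⟨ball a δ, mem_nhdsWithin_of_mem_nhds (ball_mem_nhds a hδ), ?_⟩
  have hev := (hlim a ha).eventually (ball_mem_nhds (f a) (by positivity : 0 < ε / 4))
  filter_upwards [hF, hM, hev] with i h1 h2 h3 z hz
  have e1 := hsmall _ h1 h2 z hz
  have e2 := hsmall _ hf hfM z hz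
  have e3 : ‖F i a - f a‖ < ε / 4 := by simpa [dist_eq_norm] using h3
  rw [dist_eq_norm]
  have : f z - F i z = (f z - f a) - (F i z - F i a) - (F i a - f a) := by abel
  rw [this]
  calc _ ≤ ‖f z - f a‖ + ‖F i z - F i a‖ + ‖F i a - f a‖ :=
        (norm_sub_le _ _).trans (add_le_add_left (norm_sub_le _ _) _)
    _ < ε := by linarith

theorem exists_implicit {Ω : Set (V × ℂ)} (hΩ : IsOpen Ω) {G : V × ℂ → ℂ}
    (hG : DifferentiableOn ℂ G Ω) {v₀ : V} {x₀ : ℂ} (h0 : (v₀, x₀) ∈ Ω) (hG0 : G (v₀, x₀) = 0)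
    (hd : fderiv ℂ G (v₀, x₀) (0, 1) ≠ 0) :
    ∃ (δ ε : ℝ) (ξ : V → ℂ), 0 < δ ∧ 0 < ε ∧ DifferentiableOn ℂ ξ (ball v₀ δ) ∧
      ball v₀ δ ×ˢ ball x₀ ε ⊆ Ω ∧ (∀ v ∈ ball v₀ δ, ξ v ∈ ball x₀ ε) ∧
      ∀ v ∈ ball v₀ δ, ∀ x ∈ ball x₀ ε, G (v, x) = 0 ↔ x = ξ v := by
  have cdf : ContDiffAt ℂ 1 G (v₀, x₀) :=
    (contDiffOn_of_differentiableOn hΩ hG 1).contDiffAt (hΩ.mem_nhds h0)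
  have hinv : (fderiv ℂ G (v₀, x₀) ∘L .inr ℂ V ℂ).IsInvertible := by
    refine ⟨ContinuousLinearEquiv.unitsEquivAut ℂ (Units.mk0 _ hd), ?_⟩
    ext
    simp
  have pn : (1 : WithTop ℕ∞) ≠ 0 := one_ne_zero
  set ξ := cdf.implicitFunction pn hinv
  have hξ0 : ξ v₀ = x₀ := cdf.implicitFunction_apply_self pn hinv
  have hξc : ContDiffAt ℂ 1 ξ v₀ := cdf.contDiffAt_implicitFunction pn hinv
  have hev := cdf.eventually_apply_eq_iff_implicitFunction pn hinv
  obtain ⟨ε, hε, hball⟩ := Metric.eventually_nhds_iff_ball.1 (hev.and (hΩ.mem_nhds h0))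
  have e1 : ∀ᶠ v in 𝓝 v₀, ξ v ∈ ball x₀ ε :=
    hξc.continuousAt.eventually (by rw [hξ0]; exact ball_mem_nhds _ hε)
  have e2 := (hξc.eventually (by simp)).mono fun v hv => hv.differentiableAt pn
  obtain ⟨δ, hδ, hball'⟩ := Metric.eventually_nhds_iff_ball.1 (e1.and e2)
  have hprod : ball v₀ (min δ ε) ×ˢ ball x₀ ε ⊆ ball (v₀, x₀) ε := by
    rw [← ball_prod_same]
    exact prod_mono (ball_subset_ball (min_le_right _ _)) le_rfl
  have hsub : ball v₀ (min δ ε) ⊆ ball v₀ δ := ball_subset_ball (min_le_left _ _)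
  refine ⟨min δ ε, ε, ξ, lt_min hδ hε, hε,
    fun v hv => (hball' v (hsub hv)).2.differentiableWithinAt,
    fun z hz => (hball z (hprod hz)).2, fun v hv => (hball' v (hsub hv)).1, fun v hv x hx => ?_⟩
  have := (hball (v, x) (hprod ⟨hv, hx⟩)).1
  rw [hG0] at this
  exact this.trans eq_comm

end LocalTheory

section RemovableSingularities

variable {V : Type*} [NormedAddCommGroup V] [NormedSpace ℂ V] [FiniteDimensional ℂ V]

theorem exists_extension_one_variable {U : Set ℂ} (hU : IsOpen U) (hUc : IsPreconnected U)
    {χ φ : ℂ → ℂ} (hχ : DifferentiableOn ℂ χ U) {b : ℂ} (hb : b ∈ U) (hχb : χ b ≠ 0)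
    (hφ : DifferentiableOn ℂ φ (U ∩ {t | χ t ≠ 0})) {M : ℝ}
    (hM : ∀ t ∈ U, χ t ≠ 0 → ‖φ t‖ ≤ M) :
    ∃ ψ : ℂ → ℂ, DifferentiableOn ℂ ψ U ∧ ∀ t ∈ U, χ t ≠ 0 → ψ t = φ t := by
  have hO : IsOpen (U ∩ {t | χ t ≠ 0}) := hχ.continuousOn.isOpen_inter_preimage hU isOpen_ne
  have hval : ∀ t ∈ U, χ t ≠ 0 → limUnder (𝓝[≠] t) φ = φ t := fun t ht hne =>
    ((hφ.differentiableAt (hO.mem_nhds ⟨ht, hne⟩)).continuousAt.tendsto.mono_left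
      nhdsWithin_le_nhds).limUnder_eq
  refine ⟨fun t => limUnder (𝓝[≠] t) φ, fun t₀ ht₀ => ?_, hval⟩
  have han := (analyticOnNhd_of_differentiableOn hU hχ) t₀ ht₀
  have hne : ∀ᶠ z in 𝓝[≠] t₀, χ z ≠ 0 := by
    refine han.eventually_eq_zero_or_eventually_ne_zero.resolve_left fun h => ?_
    exact hχb (eqOn_zero_of_eventuallyEq hU hUc hχ ht₀ h hb)
  rw [eventually_nhdsWithin_iff] at hne
  obtain ⟨r, hr, hball⟩ := Metric.eventually_nhds_iff_ball.1 (hne.and (hU.mem_nhds ht₀))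
  have hsub : ball t₀ r \ {t₀} ⊆ U ∩ {t | χ t ≠ 0} := fun t ht =>
    ⟨(hball t ht.1).2, (hball t ht.1).1 ht.2⟩
  have := Complex.differentiableOn_update_limUnder_of_bddAbove (ball_mem_nhds t₀ hr)
    (hφ.mono hsub) ⟨M, by
      rintro _ ⟨t, ht, rfl⟩
      exact hM t (hsub ht).1 (hsub ht).2⟩
  have h2 := this.differentiableAt (ball_mem_nhds t₀ hr)
  refine (h2.congr_of_eventuallyEq ?_).differentiableWithinAt
  filter_upwards [ball_mem_nhds t₀ hr] with t ht
  by_cases h : t = t₀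
  · subst h; simp
  · rw [Function.update_of_ne h]
    exact hval t (hsub ⟨ht, h⟩).1 (hsub ⟨ht, h⟩).2

theorem differentiableAt_circleAverage {O : Set V} (hO : IsOpen O) {g : V → ℂ}
    (hg : DifferentiableOn ℂ g O) {z₀ e : V} {ρ M δ : ℝ} (hδ : 0 < δ) (hM : ∀ z ∈ O, ‖g z‖ ≤ M)
    (hsub : ∀ t ∈ sphere (0 : ℂ) |ρ|, ball (z₀ + t • e) (2 * δ) ⊆ O) :
    DifferentiableAt ℂ (fun z => Real.circleAverage (fun t : ℂ => g (z + t • e)) 0 ρ) z₀ := by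
  have hcm : ∀ θ : ℝ, circleMap 0 ρ θ ∈ sphere (0 : ℂ) |ρ| := circleMap_mem_sphere' 0 ρ
  have hball : ∀ θ : ℝ, ∀ z ∈ ball z₀ δ, ball (z + circleMap 0 ρ θ • e) δ ⊆ O := by
    intro θ z hz
    refine Subset.trans (ball_subset_ball' ?_) (hsub _ (hcm θ))
    have := mem_ball.1 hz
    rw [dist_add_right]
    linarith
  have hmem : ∀ θ : ℝ, ∀ z ∈ ball z₀ δ, z + circleMap 0 ρ θ • e ∈ O := fun θ z hz =>
    hball θ z hz (mem_ball_self hδ)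
  have hcont : ∀ z : V, Continuous fun θ : ℝ => z + circleMap 0 ρ θ • e := fun z => by fun_prop
  have hz₀ : z₀ ∈ ball z₀ δ := mem_ball_self hδ
  have h_int : ∀ z ∈ ball z₀ δ, Continuous fun θ : ℝ => g (z + circleMap 0 ρ θ • e) := fun z hz =>
    hg.continuousOn.comp_continuous (hcont z) fun θ => hmem θ z hz
  have hD : Continuous fun θ : ℝ => fderiv ℂ g (z₀ + circleMap 0 ρ θ • e) :=
    (differentiableOn_fderiv hO hg).continuousOn.comp_continuous (hcont z₀) fun θ => hmem θ z₀ hz₀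
  have := intervalIntegral.hasFDerivAt_integral_of_dominated_of_fderiv_le (𝕜 := ℂ)
    (μ := MeasureTheory.volume) (a := 0) (b := 2 * Real.pi) (bound := fun _ => 2 * M / δ)
    (F := fun z θ => g (z + circleMap 0 ρ θ • e))
    (F' := fun z θ => fderiv ℂ g (z + circleMap 0 ρ θ • e)) (x₀ := z₀) (ball_mem_nhds z₀ hδ)
    (by filter_upwards [ball_mem_nhds z₀ hδ] with z hz using (h_int z hz).aestronglyMeasurable)
    ((h_int z₀ hz₀).intervalIntegrable _ _) hD.aestronglyMeasurable
    (Eventually.of_forall fun θ _ z hz => norm_fderiv_le_of_bounded hδ (hg.mono (hball θ z hz))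
      fun y hy => hM y (hball θ z hz hy))
    (by simp)
    (Eventually.of_forall fun θ _ z hz =>
      hasFDerivAt_comp_add_right _ |>.2
        (hg.differentiableAt (hO.mem_nhds (hmem θ z hz))).hasFDerivAt)
  simp only [Real.circleAverage_def]
  exact this.differentiableAt.const_smul _

/-- Riemann extension theorem: a locally bounded holomorphic function off a thin zero set
extends. -/
theorem exists_extension {Ω : Set V} (hΩ : IsOpen Ω) {c g : V → ℂ} (hc : DifferentiableOn ℂ c Ω)
    (hdense : ∀ a ∈ Ω, ∃ᶠ z in 𝓝 a, c z ≠ 0) (hg : DifferentiableOn ℂ g (Ω ∩ {z | c z ≠ 0}))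
    (hb : ∀ a ∈ Ω, ∃ M : ℝ, ∀ᶠ z in 𝓝 a, c z ≠ 0 → ‖g z‖ ≤ M) :
    ∃ G : V → ℂ, DifferentiableOn ℂ G Ω ∧ ∀ z ∈ Ω, c z ≠ 0 → G z = g z := by
  have hA : IsOpen (Ω ∩ {z | c z ≠ 0}) := hc.continuousOn.isOpen_inter_preimage hΩ isOpen_ne
  have hloc : ∀ a ∈ Ω, ∃ G : V → ℂ, ∃ δ > 0, ball a δ ⊆ Ω ∧ (DifferentiableOn ℂ G (ball a δ)) ∧
      ∀ z ∈ ball a δ, c z ≠ 0 → G z = g z := by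
    intro a ha
    obtain ⟨M, hM⟩ := hb a ha
    obtain ⟨r, hr, hball⟩ := Metric.eventually_nhds_iff_ball.1 (hM.and (hΩ.mem_nhds ha))
    obtain ⟨v, hv, hcv⟩ := (hdense a ha).and_eventually (ball_mem_nhds a (half_pos hr)) |>.exists
    set e := v - a with he_def
    have he : ‖e‖ < r / 2 := by simpa [dist_eq_norm] using hcv
    have hline : ∀ z ∈ ball a (r / 2), ∀ t ∈ ball (0 : ℂ) 1, z + t • e ∈ ball a r := by
      intro z hz t ht
      have h1 : ‖z - a‖ < r / 2 := by simpa [dist_eq_norm] using hz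
      have h2 : ‖t‖ < 1 := by simpa using ht
      rw [mem_ball, dist_eq_norm, add_sub_right_comm]
      calc _ ≤ ‖z - a‖ + ‖t‖ * ‖e‖ := (norm_add_le _ _).trans (by rw [norm_smul])
        _ ≤ ‖z - a‖ + 1 * ‖e‖ := by gcongr
        _ < r := by linarith
    obtain ⟨ρ, hρ0, hρ1, hρ⟩ : ∃ ρ : ℝ, 0 < ρ ∧ ρ < 1 ∧ ∀ t ∈ sphere (0 : ℂ) ρ, c (a + t • e) ≠ 0 := by
      have hm : MapsTo (fun t : ℂ => a + t • e) (ball 0 2) Ω := by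
        intro t ht
        refine (hball _ ?_).2
        have h2 : ‖t‖ < 2 := by simpa using ht
        rw [mem_ball, dist_eq_norm, add_sub_cancel_left, norm_smul]
        nlinarith [norm_nonneg e, norm_nonneg t]
      have hχ : DifferentiableOn ℂ (fun t : ℂ => c (a + t • e)) (ball 0 2) :=
        hc.comp (by fun_prop) hm
      have han := (analyticOnNhd_of_differentiableOn isOpen_ball hχ) 0 (by simp)
      have hne := han.eventually_eq_zero_or_eventually_ne_zero.resolve_left fun h => by
        have := eqOn_zero_of_eventuallyEq isOpen_ball (convex_ball (0 : ℂ) 2).isPreconnected hχ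
          (by simp) h (show (1 : ℂ) ∈ ball 0 2 by simp)
        exact hv (by simpa [he_def] using this)
      rw [eventually_nhdsWithin_iff] at hne
      obtain ⟨s, hs, hsb⟩ := Metric.eventually_nhds_iff_ball.1 hne
      refine ⟨min s 1 / 2, by positivity, by linarith [min_le_right s 1], fun t ht => ?_⟩
      have ht' : ‖t‖ = min s 1 / 2 := by simpa using ht
      have hpos : 0 < min s 1 := lt_min hs one_pos
      refine hsb t ?_ ?_
      · rw [mem_ball_zero_iff, ht']; linarith [min_le_left s 1]
      · rintro rfl
        simp at ht'
        linarith
    set O := ball a r ∩ {z | c z ≠ 0} with hO_def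
    have hOsub : O ⊆ Ω ∩ {z | c z ≠ 0} := fun z hz => ⟨(hball z hz.1).2, hz.2⟩
    have hO : IsOpen O := by
      have : O = ball a r ∩ (Ω ∩ {z | c z ≠ 0}) := by
        ext z; exact ⟨fun h => ⟨h.1, hOsub h⟩, fun h => ⟨h.1, h.2.2⟩⟩
      rw [this]; exact isOpen_ball.inter hA
    have hK : IsCompact ((fun t : ℂ => a + t • e) '' sphere 0 ρ) :=
      (isCompact_sphere _ _).image (by fun_prop)
    have hKO : (fun t : ℂ => a + t • e) '' sphere 0 ρ ⊆ O := by
      rintro _ ⟨t, ht, rfl⟩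
      refine ⟨hline a (mem_ball_self (half_pos hr)) t ?_, hρ t ht⟩
      rw [mem_ball]; rw [mem_sphere] at ht; linarith
    obtain ⟨η, hη, hthick⟩ := hK.exists_thickening_subset_open hO hKO
    have hη3 : 0 < η / 3 := by positivity
    have hballO : ∀ z ∈ ball a (η / 3), ∀ t ∈ sphere (0 : ℂ) ρ, ball (z + t • e) (2 * (η / 3)) ⊆ O := by
      intro z hz t ht y hy
      refine hthick (mem_thickening_iff.2 ⟨a + t • e, ⟨t, ht, rfl⟩, ?_⟩)
      calc dist y (a + t • e) ≤ dist y (z + t • e) + dist (z + t • e) (a + t • e) :=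
            dist_triangle _ _ _
        _ < 2 * (η / 3) + η / 3 := by
            rw [dist_add_right]; exact add_lt_add (mem_ball.1 hy) (mem_ball.1 hz)
        _ = η := by ring
    refine ⟨fun z => Real.circleAverage (fun t : ℂ => g (z + t • e)) 0 ρ, min (η / 3) (r / 2),
      by positivity, ?_, ?_, ?_⟩
    · exact fun z hz => (hball z (ball_subset_ball ((min_le_right _ _).trans (by linarith)) hz)).2
    · intro z hz
      refine (differentiableAt_circleAverage hO (hg.mono hOsub) hη3
        (fun y hy => (hball y hy.1).1 hy.2) ?_).differentiableWithinAt
      rw [abs_of_pos hρ0]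
      exact hballO z (ball_subset_ball (min_le_left _ _) hz)
    · intro z hz hcz
      have hz1 := ball_subset_ball (min_le_left _ _) hz
      have hz2 := ball_subset_ball (min_le_right _ _) hz
      have hm : MapsTo (fun t : ℂ => z + t • e) (ball 0 1) Ω := fun t ht =>
        (hball _ (hline z hz2 t ht)).2
      obtain ⟨ψ, hψ, hψg⟩ := exists_extension_one_variable (isOpen_ball (x := (0 : ℂ)) (ε := 1))
        (convex_ball _ _).isPreconnected (χ := fun t : ℂ => c (z + t • e))
        (φ := fun t : ℂ => g (z + t • e)) (hc.comp (by fun_prop) hm) (b := 0) (by simp)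
        (by simpa using hcz) (hg.comp (by fun_prop) fun t ht => ⟨hm ht.1, ht.2⟩) (M := M)
        (fun t ht hne => (hball _ (hline z hz2 t ht)).1 hne)
      have hcl : closedBall (0 : ℂ) ρ ⊆ ball 0 1 := closedBall_subset_ball hρ1
      have h1 : Real.circleAverage ψ 0 ρ = ψ 0 := by
        refine DiffContOnCl.circleAverage (DifferentiableOn.diffContOnCl ?_)
        rw [abs_of_pos hρ0, closure_ball _ hρ0.ne']
        exact hψ.mono hcl
      have h2 : Real.circleAverage (fun t : ℂ => g (z + t • e)) 0 ρ = Real.circleAverage ψ 0 ρ := by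
        refine Real.circleAverage_congr_sphere fun t ht => ?_
        rw [abs_of_pos hρ0] at ht
        exact (hψg t (hcl (sphere_subset_closedBall ht))
          (hballO z hz1 t ht (mem_ball_self (by positivity))).2).symm
      simp only []
      rw [h2, h1, hψg 0 (by simp) (by simpa using hcz)]
      simp
  refine ⟨extendFrom {z | c z ≠ 0} g, ?_, ?_⟩
  · intro a ha
    obtain ⟨G, δ, hδ, hsub, hG, hGg⟩ := hloc a ha
    refine ((hG.differentiableAt (ball_mem_nhds a hδ)).congr_of_eventuallyEq
      ?_).differentiableWithinAt
    filter_upwards [ball_mem_nhds a hδ] with z hz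
    refine extendFrom_eq (mem_closure_iff_frequently.2 (hdense z (hsub hz))) ?_
    refine ((hG.differentiableAt (isOpen_ball.mem_nhds hz)).continuousAt.tendsto.mono_left
      nhdsWithin_le_nhds).congr' ?_
    filter_upwards [mem_nhdsWithin_of_mem_nhds (isOpen_ball.mem_nhds hz), self_mem_nhdsWithin]
      with y hy hcy using hGg y hy hcy
  · intro z hz hcz
    refine extendFrom_eq (subset_closure hcz) ?_
    exact (hg.differentiableAt (hA.mem_nhds ⟨hz, hcz⟩)).continuousAt.tendsto.mono_left
      nhdsWithin_le_nhds

end RemovableSingularities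

section RootBounds

theorem norm_lt_of_isRoot {p : ℂ[X]} (hp : p.Monic) {ρ : ℝ} (hρ : 0 < ρ)
    (h : ∑ i ∈ Finset.range p.natDegree, ‖p.coeff i‖ * ρ ^ i < ρ ^ p.natDegree) {x : ℂ}
    (hx : p.eval x = 0) : ‖x‖ < ρ := by
  by_contra! hc
  have h1 : 1 ≤ ‖x‖ / ρ := (one_le_div hρ).2 hc
  rw [eval_eq_sum_range, Finset.sum_range_succ, hp.coeff_natDegree, one_mul] at hx
  have h2 : ‖x‖ ^ p.natDegree ≤ ∑ i ∈ Finset.range p.natDegree, ‖p.coeff i‖ * ‖x‖ ^ i := by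
    rw [← norm_pow, eq_neg_of_add_eq_zero_right hx, norm_neg]
    refine (norm_sum_le _ _).trans (le_of_eq ?_)
    simp
  have h3 : ∀ i ∈ Finset.range p.natDegree, ‖p.coeff i‖ * ‖x‖ ^ i ≤
      (‖x‖ / ρ) ^ p.natDegree * (‖p.coeff i‖ * ρ ^ i) := by
    intro i hi
    have : ‖x‖ ^ i = (‖x‖ / ρ) ^ i * ρ ^ i := by rw [div_pow]; field_simp
    rw [this, mul_left_comm]
    gcongr
    exact (Finset.mem_range.1 hi).le
  have h4 := h2.trans (Finset.sum_le_sum h3)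
  rw [← Finset.mul_sum] at h4
  have h5 : ‖x‖ ^ p.natDegree = (‖x‖ / ρ) ^ p.natDegree * ρ ^ p.natDegree := by
    rw [div_pow]; field_simp
  rw [h5] at h4
  exact absurd (le_of_mul_le_mul_left h4 (by positivity)) (not_le.2 h)

theorem norm_lt_of_isRoot_of_coeff_le {p : ℂ[X]} (hp : p.Monic) {M : ℝ}
    (h : ∀ i < p.natDegree, ‖p.coeff i‖ ≤ M) {x : ℂ} (hx : p.eval x = 0) :
    ‖x‖ < 1 + p.natDegree * |M| := by
  rcases Nat.eq_zero_or_pos p.natDegree with h0 | h0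
  · rw [hp.natDegree_eq_zero.1 h0] at hx
    simp at hx
  have hpos : 0 < 1 + p.natDegree * |M| := by positivity
  have h1 : 1 ≤ 1 + p.natDegree * |M| := by
    have : 0 ≤ p.natDegree * |M| := by positivity
    linarith
  refine norm_lt_of_isRoot hp hpos ?_ hx
  calc ∑ i ∈ Finset.range p.natDegree, ‖p.coeff i‖ * (1 + p.natDegree * |M|) ^ i
      ≤ ∑ i ∈ Finset.range p.natDegree, |M| * (1 + p.natDegree * |M|) ^ (p.natDegree - 1) := by
        refine Finset.sum_le_sum fun i hi => ?_
        have hi := Finset.mem_range.1 hi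
        gcongr
        · exact (h i hi).trans (le_abs_self M)
        · omega
    _ = (p.natDegree * |M|) * (1 + p.natDegree * |M|) ^ (p.natDegree - 1) := by
        rw [Finset.sum_const, Finset.card_range, nsmul_eq_mul, mul_assoc]
    _ < (1 + p.natDegree * |M|) * (1 + p.natDegree * |M|) ^ (p.natDegree - 1) := by
        gcongr
        linarith
    _ = (1 + p.natDegree * |M|) ^ p.natDegree := by
        rw [← pow_succ']; congr 1; omega

end RootBounds

section Algebra

variable {R : Type*} [CommRing R] [IsDomain R]

theorem exists_irreducible_factor {P : R[X]} (hP : P.Monic) (v : R[X] → Prop) (h1 : ¬ v 1)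
    (hmul : ∀ A B : R[X], v (A * B) → v A ∨ v B) (hv : v P) :
    ∃ Q : R[X], Q.Monic ∧ Irreducible Q ∧ Q ∣ P ∧ v Q := by
  induction hn : P.natDegree using Nat.strong_induction_on generalizing P with
  | _ n ih =>
    by_cases hirr : Irreducible P
    · exact ⟨P, hP, hirr, dvd_rfl, hv⟩
    have hne : P ≠ 1 := fun h => h1 (h ▸ hv)
    have := mt (hP.irreducible_iff_natDegree).2 hirr
    push Not at this
    obtain ⟨f, g, hf, hg, hfg, hf0, hg0⟩ := this hne
    have hdeg : f.natDegree + g.natDegree = P.natDegree := by rw [← hfg, hf.natDegree_mul hg]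
    rcases hmul f g (hfg ▸ hv) with h | h
    · obtain ⟨Q, a, b, c, d⟩ := ih f.natDegree (by omega) hf h rfl
      exact ⟨Q, a, b, c.trans ⟨g, hfg.symm⟩, d⟩
    · obtain ⟨Q, a, b, c, d⟩ := ih g.natDegree (by omega) hg h rfl
      exact ⟨Q, a, b, c.trans ⟨f, by rw [mul_comm]; exact hfg.symm⟩, d⟩

theorem exists_bezout [IsIntegrallyClosed R] {q g : R[X]} (hq : q.Monic) (hirr : Irreducible q)
    (hg : ¬ q ∣ g) : ∃ (α β : R[X]) (γ : R), γ ≠ 0 ∧ α * q + β * g = C γ := by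
  let K := FractionRing R
  have hinj : Function.Injective (algebraMap R K) := IsFractionRing.injective R K
  have hK : Irreducible (q.map (algebraMap R K)) :=
    (hq.irreducible_iff_irreducible_map_fraction_map (K := K)).1 hirr
  have hndvd : ¬ q.map (algebraMap R K) ∣ g.map (algebraMap R K) := fun h =>
    hg ((map_dvd_map _ hinj hq).1 h)
  obtain ⟨a, b, hab⟩ := (hK.coprime_iff_not_dvd).2 hndvd
  obtain ⟨s, hs0, hs⟩ := IsLocalization.integerNormalization_spec (nonZeroDivisors R) a
  obtain ⟨t, ht0, ht⟩ := IsLocalization.integerNormalization_spec (nonZeroDivisors R) b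
  set a' := IsLocalization.integerNormalization (nonZeroDivisors R) a
  set b' := IsLocalization.integerNormalization (nonZeroDivisors R) b
  refine ⟨C t * a', C s * b', s * t,
    mul_ne_zero (nonZeroDivisors.ne_zero hs0) (nonZeroDivisors.ne_zero ht0), ?_⟩
  apply map_injective _ hinj
  have e : ∀ (r : R) (f : K[X]), r • f = C (algebraMap R K r) * f := fun r f => by
    rw [← smul_eq_C_mul, algebraMap_smul]
  simp only [Polynomial.map_add, Polynomial.map_mul, hs, ht, map_C, e, map_mul]
  calc _ = C (algebraMap R K s) * C (algebraMap R K t) *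
        (a * q.map (algebraMap R K) + b * g.map (algebraMap R K)) := by ring
    _ = _ := by rw [hab, mul_one]

theorem not_dvd_of_natDegree_lt {q g : R[X]} (hg : g ≠ 0)
    (h : g.natDegree < q.natDegree) : ¬ q ∣ g := fun hd =>
  absurd (Polynomial.natDegree_le_of_dvd hd hg) (not_le.2 h)

theorem not_dvd_derivative [CharZero R] {q : R[X]} (hq : q.Monic) (hirr : Irreducible q) :
    ¬ q ∣ derivative q := by
  have h0 : q.natDegree ≠ 0 := fun h => hirr.not_isUnit (by
    rw [hq.natDegree_eq_zero.1 h]; exact isUnit_one)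
  refine not_dvd_of_natDegree_lt (fun h => h0 (derivative_eq_zero.1 h)) ?_
  exact natDegree_derivative_lt h0

end Algebra

section HolRing

variable {V : Type*} [NormedAddCommGroup V] [NormedSpace ℂ V]

/-- The algebra of holomorphic functions on `Ω`. -/
def holSubalgebra (Ω : Set V) : Subalgebra ℂ (Ω → ℂ) where
  carrier := {f | ∃ F : V → ℂ, DifferentiableOn ℂ F Ω ∧ ∀ z : Ω, f z = F z}
  mul_mem' := by
    rintro f g ⟨F, hF, h⟩ ⟨G, hG, h'⟩
    exact ⟨fun z => F z * G z, hF.mul hG, fun z => by simp [h, h']⟩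
  add_mem' := by
    rintro f g ⟨F, hF, h⟩ ⟨G, hG, h'⟩
    exact ⟨fun z => F z + G z, hF.add hG, fun z => by simp [h, h']⟩
  algebraMap_mem' c := ⟨fun _ => c, differentiableOn_const _, fun z => rfl⟩

/-- The ring of holomorphic functions on `Ω`. -/
def HolRing (Ω : Set V) : Type _ := holSubalgebra Ω

instance (Ω : Set V) : CommRing (HolRing Ω) := inferInstanceAs (CommRing (holSubalgebra Ω))

variable {Ω : Set V}

/-- A holomorphic function on `Ω`, as a function on the whole space. -/
def HolRing.fn (a : HolRing Ω) : V → ℂ := a.2.choose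

theorem HolRing.differentiableOn_fn (a : HolRing Ω) : DifferentiableOn ℂ a.fn Ω :=
  a.2.choose_spec.1

/-- Evaluation at a point. -/
def HolRing.ev (z : Ω) : HolRing Ω →+* ℂ := (Pi.evalRingHom (fun _ : Ω => ℂ) z).comp
  (holSubalgebra Ω).val.toRingHom

theorem HolRing.ev_eq (z : Ω) (a : HolRing Ω) : ev z a = a.fn z := a.2.choose_spec.2 z

/-- The ring element given by a holomorphic function. -/
def HolRing.mk (F : V → ℂ) (hF : DifferentiableOn ℂ F Ω) : HolRing Ω :=
  ⟨fun z => F z, F, hF, fun _ => rfl⟩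

@[simp] theorem HolRing.ev_mk (z : Ω) (F : V → ℂ) (hF : DifferentiableOn ℂ F Ω) :
    ev z (mk F hF) = F z := rfl

theorem HolRing.fn_mk {z : V} (hz : z ∈ Ω) (F : V → ℂ) (hF : DifferentiableOn ℂ F Ω) :
    (mk F hF).fn z = F z := by
  rw [← ev_eq ⟨z, hz⟩, ev_mk]

theorem HolRing.ext_ev {a b : HolRing Ω} (h : ∀ z : Ω, ev z a = ev z b) : a = b :=
  Subtype.ext (funext h)

theorem HolRing.eq_zero_of_fn {a : HolRing Ω} (h : ∀ z ∈ Ω, a.fn z = 0) : a = 0 :=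
  HolRing.ext_ev fun z => by rw [ev_eq, h z z.2, map_zero]

variable [FiniteDimensional ℂ V]

theorem HolRing.eq_zero_of_vanish (hΩ : IsOpen Ω) (hc : IsPreconnected Ω) {a : HolRing Ω}
    {O : Set V} (hO : IsOpen O) (hne : O.Nonempty) (hsub : O ⊆ Ω) (h : ∀ z ∈ O, a.fn z = 0) :
    a = 0 := by
  obtain ⟨z, hz⟩ := hne
  refine HolRing.eq_zero_of_fn fun y hy => ?_
  exact eqOn_zero_of_eventuallyEq hΩ hc a.differentiableOn_fn (hsub hz)
    (by filter_upwards [hO.mem_nhds hz] with w hw using h w hw) hy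

theorem HolRing.frequently_fn_ne_zero (hΩ : IsOpen Ω) (hc : IsPreconnected Ω) {a : HolRing Ω}
    (ha : a ≠ 0) {z : V} (hz : z ∈ Ω) : ∃ᶠ w in 𝓝 z, a.fn w ≠ 0 := by
  have : ∃ b ∈ Ω, a.fn b ≠ 0 := by
    by_contra! h
    exact ha (HolRing.eq_zero_of_fn h)
  obtain ⟨b, hb, hne⟩ := this
  exact frequently_ne_zero hΩ hc a.differentiableOn_fn hb hne hz

theorem HolRing.isDomain (hΩ : IsOpen Ω) (hc : IsConnected Ω) : IsDomain (HolRing Ω) := by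
  have hnt : Nontrivial (HolRing Ω) := by
    obtain ⟨z, hz⟩ := hc.nonempty
    exact ⟨⟨0, 1, fun h => by simpa using congrArg (HolRing.ev ⟨z, hz⟩) h⟩⟩
  have : NoZeroDivisors (HolRing Ω) := ⟨fun {a b} hab => by
    by_contra! hne
    obtain ⟨ha, hb⟩ := hne
    obtain ⟨z, hz⟩ := hc.nonempty
    obtain ⟨w, hw, hwΩ⟩ := ((frequently_fn_ne_zero hΩ hc.isPreconnected ha hz).and_eventually
      (hΩ.mem_nhds hz)).exists
    have hopen : IsOpen (Ω ∩ {z | a.fn z ≠ 0}) :=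
      a.differentiableOn_fn.continuousOn.isOpen_inter_preimage hΩ isOpen_ne
    refine hb (eq_zero_of_vanish hΩ hc.isPreconnected hopen ⟨w, hwΩ, hw⟩ inter_subset_left ?_)
    rintro y ⟨hy, hya⟩
    have := congrArg (HolRing.ev ⟨y, hy⟩) hab
    rw [map_mul, map_zero, ev_eq, ev_eq] at this
    exact (mul_eq_zero.1 this).resolve_left hya⟩
  exact NoZeroDivisors.to_isDomain _

theorem HolRing.charZero (hne : Ω.Nonempty) : CharZero (HolRing Ω) := by
  obtain ⟨z, hz⟩ := hne
  exact ⟨fun m n h => by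
    have := congrArg (HolRing.ev ⟨z, hz⟩) h
    simpa using this⟩

theorem HolRing.isIntegrallyClosed (hΩ : IsOpen Ω) (hc : IsConnected Ω) :
    IsIntegrallyClosed (HolRing Ω) := by
  have hdom := HolRing.isDomain hΩ hc
  rw [isIntegrallyClosed_iff (FractionRing (HolRing Ω))]
  intro x hx
  obtain ⟨p, hp, hpx⟩ := hx
  obtain ⟨a, b, hb, rfl⟩ := IsFractionRing.div_surjective (A := HolRing Ω) x
  have hb0 : b ≠ 0 := nonZeroDivisors.ne_zero hb
  have hinj := IsFractionRing.injective (HolRing Ω) (FractionRing (HolRing Ω))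
  have hroot : (p.scaleRoots b).eval a = 0 := by
    have := scaleRoots_aeval_eq_zero_of_aeval_div_eq_zero hinj (p := p) (r := a) (s := b)
      (by rw [aeval_def]; exact hpx) hb
    rw [aeval_algebraMap_apply] at this
    exact (map_eq_zero_iff _ hinj).1 (by simpa using this)
  have hz : ∀ z : Ω, b.fn z ≠ 0 → (p.map (HolRing.ev z)).eval (a.fn z / b.fn z) = 0 := by
    intro z hbz
    have h1 := congrArg (HolRing.ev z) hroot
    rw [map_zero, eval, hom_eval₂, RingHom.comp_id] at h1
    have h2 := scaleRoots_eval₂_mul (p := p) (HolRing.ev z) (a.fn z / b.fn z) b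
    rw [HolRing.ev_eq, mul_div_cancel₀ _ hbz, ← HolRing.ev_eq z a, h1] at h2
    rw [eval_map]
    have := (mul_eq_zero.1 h2.symm).resolve_left (pow_ne_zero _ hbz)
    rwa [HolRing.ev_eq z a] at this
  obtain ⟨G, hG, hGe⟩ := exists_extension hΩ (c := b.fn) (g := fun z => a.fn z / b.fn z)
    b.differentiableOn_fn (fun z hz => frequently_fn_ne_zero hΩ hc.isPreconnected hb0 hz)
    (by
      simp only [div_eq_mul_inv]
      exact (a.differentiableOn_fn.mono inter_subset_left).mul
        ((b.differentiableOn_fn.mono inter_subset_left).fun_inv fun z hz => hz.2))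
    (by
      intro z hzΩ
      have hcoef : ∀ᶠ w in 𝓝 z, ∀ i ∈ Finset.range p.natDegree, ‖(p.coeff i).fn w‖ ≤
          ∑ i ∈ Finset.range p.natDegree, (‖(p.coeff i).fn z‖ + 1) := by
        rw [Filter.eventually_all_finset]
        intro i hi
        have hcont := ((p.coeff i).differentiableOn_fn.differentiableAt
          (hΩ.mem_nhds hzΩ)).continuousAt.norm
        filter_upwards [hcont.eventually (gt_mem_nhds (lt_add_one _))] with w hw
        exact hw.le.trans (Finset.single_le_sum (f := fun i => ‖(p.coeff i).fn z‖ + 1)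
          (fun i _ => by positivity) hi)
      refine ⟨1 + p.natDegree *
        |∑ i ∈ Finset.range p.natDegree, (‖(p.coeff i).fn z‖ + 1)|, ?_⟩
      filter_upwards [hcoef, hΩ.mem_nhds hzΩ] with w hw hwΩ hbw
      have hm := hp.map (HolRing.ev ⟨w, hwΩ⟩)
      have hd : (p.map (HolRing.ev ⟨w, hwΩ⟩)).natDegree = p.natDegree := hp.natDegree_map _
      have := norm_lt_of_isRoot_of_coeff_le hm (fun i hi => by
        rw [coeff_map, HolRing.ev_eq]
        exact hw i (Finset.mem_range.2 (hd ▸ hi))) (hz ⟨w, hwΩ⟩ hbw)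
      rw [hd] at this
      exact this.le)
  refine ⟨HolRing.mk G hG, ?_⟩
  rw [eq_div_iff ((map_ne_zero_iff _ hinj).2 hb0), ← map_mul]
  congr 1
  apply mul_left_cancel₀ hb0
  refine HolRing.ext_ev fun z => ?_
  rw [map_mul, map_mul, map_mul, HolRing.ev_mk, HolRing.ev_eq, HolRing.ev_eq]
  by_cases hbz : b.fn z = 0
  · simp [hbz]
  · rw [hGe z z.2 hbz]
    field_simp

/-- A polynomial over the ring of holomorphic functions, as a function of all variables. -/
def pe (Q : (HolRing Ω)[X]) : V × ℂ → ℂ := fun p =>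
  ∑ i ∈ Finset.range (Q.natDegree + 1), (Q.coeff i).fn p.1 * p.2 ^ i

theorem pe_eq (Q : (HolRing Ω)[X]) {z : V} (hz : z ∈ Ω) (x : ℂ) :
    pe Q (z, x) = (Q.map (HolRing.ev ⟨z, hz⟩)).eval x := by
  rw [eval_map, eval₂_eq_sum_range]
  simp only [pe, HolRing.ev_eq]

theorem pe_add (P Q : (HolRing Ω)[X]) {z : V} (hz : z ∈ Ω) (x : ℂ) :
    pe (P + Q) (z, x) = pe P (z, x) + pe Q (z, x) := by simp [pe_eq _ hz]

theorem pe_mul (P Q : (HolRing Ω)[X]) {z : V} (hz : z ∈ Ω) (x : ℂ) :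
    pe (P * Q) (z, x) = pe P (z, x) * pe Q (z, x) := by simp [pe_eq _ hz]

theorem pe_C (a : HolRing Ω) {z : V} (hz : z ∈ Ω) (x : ℂ) : pe (C a) (z, x) = a.fn z := by
  simp [pe_eq _ hz, HolRing.ev_eq]

theorem pe_one {z : V} (hz : z ∈ Ω) (x : ℂ) : pe (1 : (HolRing Ω)[X]) (z, x) = 1 := by
  simp [pe_eq _ hz]

theorem differentiableOn_pe (Q : (HolRing Ω)[X]) :
    DifferentiableOn ℂ (pe Q) (Ω ×ˢ (univ : Set ℂ)) := by
  refine DifferentiableOn.fun_sum fun i _ => DifferentiableOn.mul ?_ ?_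
  · exact (Q.coeff i).differentiableOn_fn.comp differentiableOn_fst fun z hz => hz.1
  · exact differentiableOn_snd.pow i

theorem exists_bezout_pe (hΩ : IsOpen Ω) (hc : IsConnected Ω) {q g : (HolRing Ω)[X]}
    (hq : q.Monic) (hirr : Irreducible q) (hg : ¬ q ∣ g) :
    ∃ (α β : (HolRing Ω)[X]) (γ : HolRing Ω), γ ≠ 0 ∧ α * q + β * g = C γ ∧
      ∀ z ∈ Ω, ∀ x, pe q (z, x) = 0 → pe g (z, x) = 0 → γ.fn z = 0 := by
  have := HolRing.isDomain hΩ hc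
  have := HolRing.isIntegrallyClosed hΩ hc
  obtain ⟨α, β, γ, h0, h⟩ := exists_bezout hq hirr hg
  refine ⟨α, β, γ, h0, h, fun z hz x hqx hgx => ?_⟩
  rw [← pe_C γ hz x, ← h, pe_add _ _ hz, pe_mul _ _ hz, pe_mul _ _ hz, hqx, hgx]
  simp

theorem dvd_of_vanish (hΩ : IsOpen Ω) (hc : IsConnected Ω) {q g : (HolRing Ω)[X]}
    (hq : q.Monic) (hirr : Irreducible q) {O : Set V} (hO : IsOpen O) (hne : O.Nonempty)
    (hsub : O ⊆ Ω) {x : V → ℂ} (h1 : ∀ z ∈ O, pe q (z, x z) = 0)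
    (h2 : ∀ z ∈ O, pe g (z, x z) = 0) : q ∣ g := by
  by_contra hg
  obtain ⟨α, β, γ, h0, -, h⟩ := exists_bezout_pe hΩ hc hq hirr hg
  exact h0 (HolRing.eq_zero_of_vanish hΩ hc.isPreconnected hO hne hsub fun z hz =>
    h z (hsub hz) (x z) (h1 z hz) (h2 z hz))

end HolRing

section Division

variable {V : Type*} [NormedAddCommGroup V] [NormedSpace ℂ V] [FiniteDimensional ℂ V]

/-- Functions holomorphic on the product of `Ω` with the unit disc and bounded by `M` there. -/
def HolBdd (Ω : Set V) (M : ℝ) (g : V × ℂ → ℂ) : Prop :=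
  DifferentiableOn ℂ g (Ω ×ˢ ball (0 : ℂ) 1) ∧ ∀ y ∈ Ω, ∀ X ∈ ball (0 : ℂ) 1, ‖g (y, X)‖ ≤ M

theorem HolBdd.slice_right {Ω : Set V} {M : ℝ} {g : V × ℂ → ℂ} (hg : HolBdd Ω M g) {y : V}
    (hy : y ∈ Ω) : DifferentiableOn ℂ (fun X => g (y, X)) (ball 0 1) :=
  hg.1.comp (by fun_prop) fun X hX => ⟨hy, hX⟩

theorem HolBdd.slice_left {Ω : Set V} {M : ℝ} {g : V × ℂ → ℂ} (hg : HolBdd Ω M g) {X : ℂ}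
    (hX : X ∈ ball (0 : ℂ) 1) : DifferentiableOn ℂ (fun y => g (y, X)) Ω :=
  hg.1.comp (by fun_prop) fun y hy => ⟨hy, hX⟩

variable {Ω : Set V}

theorem HolBdd.exists_slope (hΩ : IsOpen Ω) {g : V × ℂ → ℂ} {M : ℝ} (hg : HolBdd Ω M g) :
    ∃ G, HolBdd Ω (2 * M) G ∧ ∀ y ∈ Ω, ∀ X ∈ ball (0 : ℂ) 1,
      g (y, X) = g (y, 0) + X * G (y, X) := by
  have h0 : (0 : ℂ) ∈ ball (0 : ℂ) 1 := by simp
  have hop : IsOpen (Ω ×ˢ ball (0 : ℂ) 1) := hΩ.prod isOpen_ball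
  have hbd : ∀ y ∈ Ω, ∀ X ∈ ball (0 : ℂ) 1, ‖g (y, X) - g (y, 0)‖ ≤ 2 * M * ‖X‖ := by
    intro y hy X hX
    have := norm_sub_le_of_bounded (a := (0 : ℂ)) (w := X) (hg.slice_right hy)
      (fun X hX => hg.2 y hy X hX) (by simpa using hX)
    simpa using this
  have hdense : ∀ b : ℂ, ∃ᶠ X in 𝓝 b, X ≠ 0 := by
    intro b hb
    have h1 : ∀ᶠ X in 𝓝 b, X = 0 := by simpa using hb
    have h2 : ∀ᶠ X in 𝓝[≠] b, X ≠ 0 := by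
      rcases eq_or_ne b 0 with rfl | hb0
      · exact self_mem_nhdsWithin
      · exact mem_nhdsWithin_of_mem_nhds (isOpen_ne.mem_nhds hb0)
    obtain ⟨x, hx, hx'⟩ := ((h1.filter_mono nhdsWithin_le_nhds).and h2).exists
    exact hx' hx
  have hdense' : ∀ p : V × ℂ, ∃ᶠ z in 𝓝 p, z.2 ≠ 0 := by
    intro p hp
    rw [nhds_prod_eq] at hp
    have := (hdense p.2)
    have h3 : Tendsto (fun X => (p.1, X)) (𝓝 p.2) (𝓝 p.1 ×ˢ 𝓝 p.2) :=
      tendsto_const_nhds.prodMk tendsto_id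
    exact this (h3.eventually hp)
  obtain ⟨G, hG, hGe⟩ := exists_extension hop (c := fun p : V × ℂ => p.2)
    (g := fun p => (g p - g (p.1, 0)) * p.2⁻¹)
    differentiableOn_snd (fun a _ => hdense' a)
    (by
      refine DifferentiableOn.mul ?_ (differentiableOn_snd.fun_inv fun z hz => hz.2)
      refine (hg.1.mono inter_subset_left).sub ?_
      exact (hg.slice_left h0).comp differentiableOn_fst fun z hz => hz.1.1)
    (by
      intro a ha
      refine ⟨2 * M, ?_⟩
      filter_upwards [hop.mem_nhds ha] with z hz hz0
      rw [norm_mul, norm_inv, ← div_eq_mul_inv, div_le_iff₀ (norm_pos_iff.2 hz0)]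
      exact hbd z.1 hz.1 z.2 hz.2)
  refine ⟨G, ⟨hG, ?_⟩, ?_⟩
  · intro y hy X hX
    have hcont : ContinuousAt (fun X => ‖G (y, X)‖) X := by
      have := (hG.differentiableAt (x := (y, X)) (hop.mem_nhds ⟨hy, hX⟩)).continuousAt
      exact (this.comp (f := fun X => (y, X)) (by fun_prop)).norm
    by_contra! hlt
    obtain ⟨X', h1, h2, h3⟩ := ((hdense X).and_eventually
      ((hcont.eventually (lt_mem_nhds hlt)).and (isOpen_ball.mem_nhds hX))).exists
    rw [hGe (y, X') ⟨hy, h3⟩ h1, norm_mul, norm_inv, ← div_eq_mul_inv,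
      lt_div_iff₀ (norm_pos_iff.2 h1)] at h2
    exact absurd (hbd y hy X' h3) (not_le.2 h2)
  · intro y hy X hX
    rcases eq_or_ne X 0 with rfl | hne
    · simp
    · rw [hGe (y, X) ⟨hy, hX⟩ hne]
      simp only []
      field_simp
      ring

theorem HolBdd.exists_taylor (hΩ : IsOpen Ω) {g : V × ℂ → ℂ} {M : ℝ} (hg : HolBdd Ω M g)
    (d : ℕ) : ∃ (a : ℕ → V → ℂ) (G : V × ℂ → ℂ), (∀ j, DifferentiableOn ℂ (a j) Ω) ∧
      (∀ j < d, ∀ y ∈ Ω, ‖a j y‖ ≤ 2 ^ j * M) ∧ HolBdd Ω (2 ^ d * M) G ∧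
      ∀ y ∈ Ω, ∀ X ∈ ball (0 : ℂ) 1,
        g (y, X) = X ^ d * G (y, X) + ∑ j ∈ Finset.range d, a j y * X ^ j := by
  induction d with
  | zero => exact ⟨fun _ _ => 0, g, fun j => differentiableOn_const _, by simp, by simpa using hg,
      by simp⟩
  | succ d ih =>
    obtain ⟨a, G, ha, haM, hG, he⟩ := ih
    obtain ⟨G', hG', he'⟩ := hG.exists_slope hΩ
    have h0 : (0 : ℂ) ∈ ball (0 : ℂ) 1 := by simp
    refine ⟨fun j => if j = d then fun y => G (y, 0) else a j, G', fun j => ?_, fun j hj y hy => ?_,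
      by rw [pow_succ']; simpa [mul_assoc] using hG', fun y hy X hX => ?_⟩
    · beta_reduce
      split_ifs
      · exact hG.slice_left h0
      · exact ha j
    · beta_reduce
      split_ifs with h
      · rw [h]; exact hG.2 y hy 0 h0
      · exact haM j (by omega) y hy
    · rw [he y hy X hX, he' y hy X hX, Finset.sum_range_succ]
      beta_reduce
      rw [if_pos rfl, Finset.sum_congr rfl fun j hj => ?_]
      · ring
      · rw [if_neg (Finset.mem_range.1 hj).ne]

/-- Division by a function close to `X ^ d`. -/
theorem HolBdd.exists_division (hΩ : IsOpen Ω) {d : ℕ} {h : V × ℂ → ℂ}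
    (hh : DifferentiableOn ℂ h (Ω ×ˢ ball (0 : ℂ) 1))
    (hd : ∀ y ∈ Ω, ∀ X ∈ ball (0 : ℂ) 1, ‖X ^ d - h (y, X)‖ ≤ (1 / 2) ^ (d + 1))
    {g : V × ℂ → ℂ} {M : ℝ} (hg : HolBdd Ω M g) :
    ∃ (q : V × ℂ → ℂ) (r : ℕ → V → ℂ), HolBdd Ω (2 ^ (d + 1) * M) q ∧
      (∀ j, DifferentiableOn ℂ (r j) Ω) ∧ (∀ j < d, ∀ y ∈ Ω, ‖r j y‖ ≤ 2 ^ (d + 1) * M) ∧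
      ∀ y ∈ Ω, ∀ X ∈ ball (0 : ℂ) 1,
        g (y, X) = h (y, X) * q (y, X) + ∑ j ∈ Finset.range d, r j y * X ^ j := by
  rcases Ω.eq_empty_or_nonempty with rfl | ⟨y₀, hy₀⟩
  · exact ⟨0, 0, ⟨by simp, by simp⟩, by simp, by simp, by simp⟩
  have hM0 : 0 ≤ M := (norm_nonneg _).trans (hg.2 y₀ hy₀ 0 (by simp))
  have hstep : ∀ (k : ℕ) (g : V × ℂ → ℂ), HolBdd Ω (M * (1 / 2) ^ k) g →
      ∃ (a : ℕ → V → ℂ) (G g' : V × ℂ → ℂ), HolBdd Ω (M * (1 / 2) ^ (k + 1)) g' ∧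
        (∀ j, DifferentiableOn ℂ (a j) Ω) ∧
        (∀ j < d, ∀ y ∈ Ω, ‖a j y‖ ≤ 2 ^ d * M * (1 / 2) ^ k) ∧
        HolBdd Ω (2 ^ d * M * (1 / 2) ^ k) G ∧ ∀ y ∈ Ω, ∀ X ∈ ball (0 : ℂ) 1,
          g (y, X) = h (y, X) * G (y, X) + ∑ j ∈ Finset.range d, a j y * X ^ j + g' (y, X) := by
    intro k g hg
    obtain ⟨a, G, ha, haM, hG, he⟩ := hg.exists_taylor hΩ d
    refine ⟨a, G, fun p => (p.2 ^ d - h p) * G p, ⟨?_, ?_⟩, ha, ?_, ?_, ?_⟩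
    · exact ((differentiableOn_snd.pow d).sub hh).mul hG.1
    · intro y hy X hX
      rw [norm_mul]
      calc _ ≤ (1 / 2) ^ (d + 1) * (2 ^ d * (M * (1 / 2) ^ k)) :=
            mul_le_mul (hd y hy X hX) (hG.2 y hy X hX) (norm_nonneg _) (by positivity)
        _ = _ := by
            have : (1 / 2 : ℝ) ^ d * 2 ^ d = 1 := by rw [← mul_pow]; norm_num
            rw [pow_succ, pow_succ]
            linear_combination (M * (1 / 2) ^ k * (1 / 2)) * this
    · intro j hj y hy
      refine (haM j hj y hy).trans ?_
      rw [← mul_assoc]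
      gcongr
      · norm_num
    · rw [mul_assoc]; exact hG
    · intro y hy X hX
      rw [he y hy X hX]
      ring
  choose! A Q N hN hA hAM hQ he using hstep
  let gs : ℕ → V × ℂ → ℂ := fun k => Nat.rec g (fun k g => N k g) k
  have hgs : ∀ k, HolBdd Ω (M * (1 / 2) ^ k) (gs k) := by
    intro k
    induction k with
    | zero => simpa [gs] using hg
    | succ k ih => exact hN k _ ih
  have hsum : ∀ n, ∀ y ∈ Ω, ∀ X ∈ ball (0 : ℂ) 1, g (y, X) =
      h (y, X) * (∑ k ∈ Finset.range n, Q k (gs k) (y, X)) +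
      ∑ j ∈ Finset.range d, (∑ k ∈ Finset.range n, A k (gs k) j y) * X ^ j + gs n (y, X) := by
    intro n y hy X hX
    induction n with
    | zero => simp [gs]
    | succ n ih =>
      rw [ih, he n (gs n) (hgs n) y hy X hX]
      simp only [Finset.sum_range_succ, add_mul, Finset.sum_add_distrib, mul_add]
      have : gs (n + 1) = N n (gs n) := rfl
      rw [this]
      ring
  have hgeom : ∀ (C : ℝ), Summable fun k : ℕ => C * (1 / 2 : ℝ) ^ k := fun C =>
    summable_geometric_two.mul_left C
  have hgeomle : ∀ n, ∑ k ∈ Finset.range n, 2 ^ d * M * (1 / 2 : ℝ) ^ k ≤ 2 ^ (d + 1) * M := by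
    intro n
    refine ((hgeom (2 ^ d * M)).sum_le_tsum _ fun i _ => by positivity).trans (le_of_eq ?_)
    rw [tsum_mul_left, tsum_geometric_two]
    ring
  have hQs : ∀ y ∈ Ω, ∀ X ∈ ball (0 : ℂ) 1, Summable fun k => Q k (gs k) (y, X) := by
    intro y hy X hX
    exact Summable.of_norm_bounded (hgeom (2 ^ d * M)) fun k => (hQ k _ (hgs k)).2 y hy X hX
  have hAs : ∀ y ∈ Ω, ∀ j < d, Summable fun k => A k (gs k) j y := by
    intro y hy j hj
    exact Summable.of_norm_bounded (hgeom (2 ^ d * M)) fun k => hAM k _ (hgs k) j hj y hy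
  have hQb : ∀ n, ∀ y ∈ Ω, ∀ X ∈ ball (0 : ℂ) 1,
      ‖∑ k ∈ Finset.range n, Q k (gs k) (y, X)‖ ≤ 2 ^ (d + 1) * M := by
    intro n y hy X hX
    refine (norm_sum_le _ _).trans ((Finset.sum_le_sum fun k _ => ?_).trans (hgeomle n))
    exact (hQ k _ (hgs k)).2 y hy X hX
  have hAb : ∀ n, ∀ j < d, ∀ y ∈ Ω,
      ‖∑ k ∈ Finset.range n, A k (gs k) j y‖ ≤ 2 ^ (d + 1) * M := by
    intro n j hj y hy
    refine (norm_sum_le _ _).trans ((Finset.sum_le_sum fun k _ => ?_).trans (hgeomle n))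
    exact hAM k _ (hgs k) j hj y hy
  refine ⟨fun p => ∑' k, Q k (gs k) p, fun j => if j < d then fun y => ∑' k, A k (gs k) j y else 0,
    ⟨?_, ?_⟩, ?_, ?_, ?_⟩
  · refine differentiableOn_of_tendsto (l := atTop) (M := 2 ^ (d + 1) * M)
      (F := fun n p => ∑ k ∈ Finset.range n, Q k (gs k) p) (hΩ.prod isOpen_ball)
      (Eventually.of_forall fun n => ?_) (Eventually.of_forall fun n z hz => ?_) fun z hz => ?_
    · exact DifferentiableOn.fun_sum fun k _ => (hQ k _ (hgs k)).1
    · exact hQb n z.1 hz.1 z.2 hz.2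
    · exact (hQs z.1 hz.1 z.2 hz.2).hasSum.tendsto_sum_nat
  · intro y hy X hX
    exact le_of_tendsto (hQs y hy X hX).hasSum.tendsto_sum_nat.norm
      (Eventually.of_forall fun n => hQb n y hy X hX)
  · intro j
    beta_reduce
    split_ifs with hj
    · refine differentiableOn_of_tendsto (l := atTop) (M := 2 ^ (d + 1) * M)
        (F := fun n y => ∑ k ∈ Finset.range n, A k (gs k) j y) hΩ
        (Eventually.of_forall fun n => ?_) (Eventually.of_forall fun n z hz => ?_) fun z hz => ?_
      · exact DifferentiableOn.fun_sum fun k _ => hA k _ (hgs k) j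
      · exact hAb n j hj z hz
      · exact (hAs z hz j hj).hasSum.tendsto_sum_nat
    · exact differentiableOn_const _
  · intro j hj y hy
    beta_reduce
    rw [if_pos hj]
    exact le_of_tendsto (hAs y hy j hj).hasSum.tendsto_sum_nat.norm
      (Eventually.of_forall fun n => hAb n j hj y hy)
  · intro y hy X hX
    have hg0 : Tendsto (fun n => gs n (y, X)) atTop (𝓝 0) := by
      refine squeeze_zero_norm (fun n => (hgs n).2 y hy X hX) ?_
      simpa using (tendsto_pow_atTop_nhds_zero_of_lt_one (r := (1 / 2 : ℝ)) (by norm_num)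
        (by norm_num)).const_mul M
    have hlim := (((hQs y hy X hX).hasSum.tendsto_sum_nat.const_mul (h (y, X))).add
      (tendsto_finsetSum (Finset.range d) fun j hj =>
        ((hAs y hy j (Finset.mem_range.1 hj)).hasSum.tendsto_sum_nat.mul_const (X ^ j)))).add hg0
    rw [tendsto_nhds_unique tendsto_const_nhds
      (hlim.congr fun n => (hsum n y hy X hX).symm), add_zero]
    congr 1
    exact Finset.sum_congr rfl fun j hj => by
      beta_reduce
      rw [if_pos (Finset.mem_range.1 hj)]

/-- The polynomial with coefficients `a j`, `j < d`. -/
def polyOf {R : Type*} [CommRing R] (d : ℕ) (a : ℕ → R) : R[X] :=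
  ∑ j ∈ Finset.range d, monomial j (a j)

theorem coeff_polyOf {R : Type*} [CommRing R] (d : ℕ) (a : ℕ → R) (i : ℕ) :
    (polyOf d a).coeff i = if i < d then a i else 0 := by
  simp [polyOf, finsetSum_coeff, coeff_monomial]

theorem degree_polyOf_lt {R : Type*} [CommRing R] (d : ℕ) (a : ℕ → R) :
    (polyOf d a).degree < d := by
  rw [degree_lt_iff_coeff_zero]
  intro m hm
  rw [coeff_polyOf, if_neg (by exact_mod_cast not_lt.2 hm)]

theorem pe_polyOf (d : ℕ) (a : ℕ → HolRing Ω) {z : V} (hz : z ∈ Ω) (x : ℂ) :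
    pe (polyOf d a) (z, x) = ∑ j ∈ Finset.range d, (a j).fn z * x ^ j := by
  rw [pe_eq _ hz, polyOf, Polynomial.map_sum, eval_finsetSum]
  simp [HolRing.ev_eq]

theorem pe_sub (P Q : (HolRing Ω)[X]) {z : V} (hz : z ∈ Ω) (x : ℂ) :
    pe (P - Q) (z, x) = pe P (z, x) - pe Q (z, x) := by simp [pe_eq _ hz]

theorem pe_X_pow (d : ℕ) {z : V} (hz : z ∈ Ω) (x : ℂ) :
    pe (X ^ d : (HolRing Ω)[X]) (z, x) = x ^ d := by simp [pe_eq _ hz]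

/-- A bound for the roots of a polynomial of degree `d` making division by it possible. -/
def rho (d : ℕ) : ℝ := (1 / 2) ^ (3 * d + 2)

/-- A bound for the distance to `X ^ d` making Weierstrass preparation possible. -/
def eta (d : ℕ) : ℝ := rho d ^ d * (1 / 2) ^ (2 * d + 2)

theorem rho_pos (d : ℕ) : 0 < rho d := by unfold rho; positivity

theorem eta_pos (d : ℕ) : 0 < eta d := by have := rho_pos d; unfold eta; positivity

theorem rho_anti {d e : ℕ} (h : d ≤ e) : rho e ≤ rho d :=
  pow_le_pow_of_le_one (by norm_num) (by norm_num) (by omega)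

theorem rho_le (d : ℕ) : rho d ≤ 1 / 4 :=
  (rho_anti (Nat.zero_le d)).trans (by norm_num [rho])

theorem eta_le (d : ℕ) : eta d ≤ (1 / 2) ^ (d + 1) := by
  have h1 : rho d ^ d ≤ 1 := pow_le_one₀ (rho_pos d).le ((rho_le d).trans (by norm_num))
  calc eta d ≤ 1 * (1 / 2) ^ (2 * d + 2) := by unfold eta; gcongr
    _ ≤ _ := by
      rw [one_mul]
      exact pow_le_pow_of_le_one (by norm_num) (by norm_num) (by omega)

theorem sum_eta_lt (d : ℕ) : (d : ℝ) * (2 ^ (d + 1) * eta d) < rho d ^ d := by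
  have h1 : (d : ℝ) ≤ 2 ^ d := by exact_mod_cast Nat.lt_two_pow_self.le
  have h2 := rho_pos d
  calc (d : ℝ) * (2 ^ (d + 1) * eta d) ≤ 2 ^ d * (2 ^ (d + 1) * eta d) := by
        have := eta_pos d
        gcongr
    _ = rho d ^ d * ((2 * (1 / 2)) ^ (2 * d + 1) * (1 / 2)) := by
        rw [mul_pow, eta]
        ring
    _ < rho d ^ d := by
        have := pow_pos h2 d
        rw [mul_one_div_cancel two_ne_zero, one_pow]
        linarith

/-- Weierstrass preparation. -/
theorem exists_weierstrass (hΩ : IsOpen Ω) [Nontrivial (HolRing Ω)] {d : ℕ} {h : V × ℂ → ℂ}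
    (hh : DifferentiableOn ℂ h (Ω ×ˢ ball (0 : ℂ) 1))
    (hd : ∀ y ∈ Ω, ∀ X ∈ ball (0 : ℂ) 1, ‖X ^ d - h (y, X)‖ ≤ eta d) :
    ∃ P : (HolRing Ω)[X], P.Monic ∧ P.natDegree = d ∧
      (∀ z ∈ Ω, ∀ x ∈ ball (0 : ℂ) 1, h (z, x) = 0 → pe P (z, x) = 0) ∧
      ∀ z ∈ Ω, ∀ x, pe P (z, x) = 0 → ‖x‖ < rho d := by
  obtain ⟨q, r, hq, hr, hrM, he⟩ := HolBdd.exists_division hΩ hh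
    (fun y hy X hX => (hd y hy X hX).trans (eta_le d)) (g := fun p => p.2 ^ d - h p) (M := eta d)
    ⟨(differentiableOn_snd.pow d).sub hh, hd⟩
  set a : ℕ → HolRing Ω := fun j => HolRing.mk (r j) (hr j)
  have hdeg : (X ^ d - polyOf d a : (HolRing Ω)[X]).degree = d := by
    rw [degree_sub_eq_left_of_degree_lt, degree_X_pow]
    rw [degree_X_pow]
    exact degree_polyOf_lt d a
  have hmon : (X ^ d - polyOf d a : (HolRing Ω)[X]).Monic := by
    rw [sub_eq_add_neg]
    exact monic_X_pow_add (by rw [degree_neg]; exact degree_polyOf_lt d a)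
  have hnat := natDegree_eq_of_degree_eq_some hdeg
  refine ⟨X ^ d - polyOf d a, hmon, hnat, fun z hz x hx h0 => ?_, fun z hz x hx => ?_⟩
  · have := he z hz x hx
    rw [h0] at this
    rw [pe_sub _ _ hz, pe_X_pow _ hz, pe_polyOf _ _ hz, sub_eq_zero]
    simpa [a, HolRing.fn_mk hz, h0] using this
  · rw [pe_eq _ hz] at hx
    have hm := hmon.map (HolRing.ev ⟨z, hz⟩)
    have hd' := hmon.natDegree_map (HolRing.ev ⟨z, hz⟩)
    rw [hnat] at hd'
    refine norm_lt_of_isRoot hm (rho_pos d) ?_ hx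
    rw [hd']
    refine lt_of_le_of_lt (Finset.sum_le_sum (g := fun _ => 2 ^ (d + 1) * eta d) fun i hi => ?_) ?_
    · have hi := Finset.mem_range.1 hi
      have h1 : ‖((X ^ d - polyOf d a : (HolRing Ω)[X]).map (HolRing.ev ⟨z, hz⟩)).coeff i‖ ≤
          2 ^ (d + 1) * eta d := by
        rw [coeff_map, coeff_sub, coeff_X_pow, if_neg hi.ne, coeff_polyOf, if_pos hi, zero_sub,
          map_neg, norm_neg, HolRing.ev_mk]
        exact hrM i hi z hz
      have h2 : rho d ^ i ≤ 1 := pow_le_one₀ (rho_pos d).le ((rho_le d).trans (by norm_num))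
      calc _ ≤ 2 ^ (d + 1) * eta d * 1 :=
            mul_le_mul h1 h2 (pow_nonneg (rho_pos d).le _) ((norm_nonneg _).trans h1)
        _ = _ := mul_one _
    · rw [Finset.sum_const, Finset.card_range, nsmul_eq_mul]
      exact sum_eta_lt d

/-- A monic polynomial all of whose roots are small. -/
def SmallRoots (Q : (HolRing Ω)[X]) : Prop :=
  Q.Monic ∧ ∀ z ∈ Ω, ∀ x, pe Q (z, x) = 0 → ‖x‖ < rho Q.natDegree

theorem SmallRoots.of_dvd {P Q : (HolRing Ω)[X]} (hP : SmallRoots P) (hQ : Q.Monic)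
    (hdvd : Q ∣ P) : SmallRoots Q ∧ Q.natDegree ≤ P.natDegree := by
  obtain ⟨A, rfl⟩ := hdvd
  have hA := hQ.of_mul_monic_left hP.1
  have hle : Q.natDegree ≤ (Q * A).natDegree := by
    rw [hQ.natDegree_mul hA]; omega
  refine ⟨⟨hQ, fun z hz x hx => ?_⟩, hle⟩
  refine (hP.2 z hz x ?_).trans_le (rho_anti hle)
  rw [pe_mul _ _ hz, hx, zero_mul]

theorem SmallRoots.norm_coeff_le {Q : (HolRing Ω)[X]} (hQ : SmallRoots Q) {z : V} (hz : z ∈ Ω)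
    {i : ℕ} (hi : i < Q.natDegree) :
    ‖(Q.coeff i).fn z‖ ≤ rho Q.natDegree * 2 ^ Q.natDegree := by
  have hm := hQ.1.map (HolRing.ev ⟨z, hz⟩)
  have hd := hQ.1.natDegree_map (HolRing.ev ⟨z, hz⟩)
  have := coeff_le_of_roots_le (p := Q.map (HolRing.ev ⟨z, hz⟩)) (f := RingHom.id ℂ)
    (B := rho Q.natDegree) i hm (by simpa using IsAlgClosed.splits _) (by
      intro x hx
      rw [Polynomial.map_id, mem_roots hm.ne_zero, IsRoot, ← pe_eq] at hx
      exact (hQ.2 z hz x hx).le)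
  rw [Polynomial.map_id, coeff_map, HolRing.ev_eq, hd] at this
  refine this.trans ?_
  have h0 := rho_pos Q.natDegree
  gcongr
  · exact (pow_le_pow_of_le_one (rho_pos _).le ((rho_le _).trans (by norm_num))
      (show 1 ≤ Q.natDegree - i by omega)).trans (by rw [pow_one])
  · exact_mod_cast Nat.choose_le_two_pow _ _

theorem SmallRoots.norm_sub_le {Q : (HolRing Ω)[X]} (hQ : SmallRoots Q) {z : V} (hz : z ∈ Ω)
    {x : ℂ} (hx : x ∈ ball (0 : ℂ) 1) :
    ‖x ^ Q.natDegree - pe Q (z, x)‖ ≤ (1 / 2) ^ (Q.natDegree + 1) := by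
  set e := Q.natDegree
  have h1 : (e : ℝ) ≤ 2 ^ e := by exact_mod_cast Nat.lt_two_pow_self.le
  have h2 := rho_pos e
  have hev : (Q.coeff e).fn z = 1 := by
    rw [← HolRing.ev_eq ⟨z, hz⟩, hQ.1.coeff_natDegree, map_one]
  rw [pe, Finset.sum_range_succ, hev, one_mul, sub_add_cancel_right, norm_neg]
  calc _ ≤ ∑ i ∈ Finset.range e, rho e * 2 ^ e := by
        refine norm_sum_le_of_le _ fun i hi => ?_
        rw [norm_mul, norm_pow]
        have h3 : ‖x‖ ^ i ≤ 1 := pow_le_one₀ (norm_nonneg _) (mem_ball_zero_iff.1 hx).le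
        calc _ ≤ rho e * 2 ^ e * 1 := mul_le_mul (hQ.norm_coeff_le hz (Finset.mem_range.1 hi)) h3
              (by positivity) (by positivity)
          _ = _ := mul_one _
    _ = e * (rho e * 2 ^ e) := by rw [Finset.sum_const, Finset.card_range, nsmul_eq_mul]
    _ ≤ 2 ^ e * (rho e * 2 ^ e) := by gcongr
    _ = (1 / 2) ^ (e + 2) * (2 * (1 / 2)) ^ (2 * e) := by rw [rho, mul_pow]; ring
    _ ≤ _ := by
        have : (0 : ℝ) < (1 / 2) ^ (e + 1) := by positivity
        rw [pow_succ (1 / 2 : ℝ) (e + 1), mul_one_div_cancel two_ne_zero, one_pow]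
        linarith

/-- Division by a polynomial with small roots, with extra parameters. -/
theorem SmallRoots.exists_division {V' : Type*} [NormedAddCommGroup V'] [NormedSpace ℂ V']
    [FiniteDimensional ℂ V'] {Ω' : Set V'} (hΩ' : IsOpen Ω') {φ : V' → V}
    (hφ : DifferentiableOn ℂ φ Ω') (hmap : MapsTo φ Ω' Ω)
    {Q : (HolRing Ω)[X]} (hQ : SmallRoots Q) {g : V' × ℂ → ℂ} {M : ℝ} (hg : HolBdd Ω' M g) :
    ∃ (q : V' × ℂ → ℂ) (r : ℕ → V' → ℂ), HolBdd Ω' (2 ^ (Q.natDegree + 1) * M) q ∧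
      (∀ j, DifferentiableOn ℂ (r j) Ω') ∧
      (∀ j < Q.natDegree, ∀ y ∈ Ω', ‖r j y‖ ≤ 2 ^ (Q.natDegree + 1) * M) ∧
      ∀ y ∈ Ω', ∀ X ∈ ball (0 : ℂ) 1, g (y, X) = pe Q (φ y, X) * q (y, X) +
        ∑ j ∈ Finset.range Q.natDegree, r j y * X ^ j := by
  refine HolBdd.exists_division (h := fun p => pe Q (φ p.1, p.2)) hΩ' ?_ ?_ hg
  · refine (differentiableOn_pe Q).comp (f := fun p : V' × ℂ => (φ p.1, p.2))
      (DifferentiableOn.prodMk ?_ ?_) ?_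
    · exact hφ.comp differentiableOn_fst fun z hz => hz.1
    · exact differentiableOn_snd
    · exact fun z hz => ⟨hmap hz.1, mem_univ _⟩
  · exact fun y hy X hX => hQ.norm_sub_le (hmap hy) hX

end Division

section WeierstrassCoordinates

variable {E : Type*} [NormedAddCommGroup E] [NormedSpace ℂ E] [FiniteDimensional ℂ E]

theorem exists_equiv_prod {n : ℕ} (hn : Module.finrank ℂ E = n + 1) {v : E} (hv : v ≠ 0) :
    ∃ L : E ≃L[ℂ] (Fin n → ℂ) × ℂ, ∀ X : ℂ, L.symm (0, X) = X • v := by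
  obtain ⟨g, hg⟩ := SeparatingDual.exists_eq_one (R := ℂ) hv
  let f₂ : ℂ →L[ℂ] E := ContinuousLinearMap.toSpanSingleton ℂ v
  have hinv : Function.RightInverse f₂ g := fun x => by simp [f₂, hg]
  let A := ContinuousLinearEquiv.equivOfRightInverse g f₂ hinv
  have hfin : Module.finrank ℂ g.ker = n := by
    have := A.toLinearEquiv.finrank_eq
    rw [Module.finrank_prod, Module.finrank_self, hn] at this
    omega
  let B : g.ker ≃L[ℂ] (Fin n → ℂ) := ContinuousLinearEquiv.ofFinrankEq (by simp [hfin])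
  refine ⟨(A.trans (ContinuousLinearEquiv.prodComm ℂ ℂ g.ker)).trans
    (B.prodCongr (ContinuousLinearEquiv.refl ℂ ℂ)), fun X => ?_⟩
  rw [ContinuousLinearEquiv.symm_apply_eq]
  have hA : A v = (1, 0) := by
    rw [← ContinuousLinearEquiv.eq_symm_apply]
    simp [A, f₂]
  simp [hA]

theorem exists_factor_pow {φ : ℂ → ℂ} {R : ℝ} (hφ : DifferentiableOn ℂ φ (ball 0 R)) (hR : 0 < R)
    {t : ℂ} (ht : t ∈ ball (0 : ℂ) R) (h : φ t ≠ 0) :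
    ∃ (d : ℕ) (g : ℂ → ℂ) (ρ c : ℝ), 0 < ρ ∧ ρ < R ∧ 0 < c ∧
      DifferentiableOn ℂ g (closedBall 0 ρ) ∧
      (∀ z ∈ closedBall (0 : ℂ) ρ, c ≤ ‖g z‖) ∧ ∀ z ∈ closedBall (0 : ℂ) ρ, φ z = z ^ d * g z := by
  have han : AnalyticAt ℂ φ 0 := hφ.analyticAt (ball_mem_nhds 0 hR)
  have hne : ¬ ∀ᶠ z in 𝓝 0, φ z = 0 := fun h0 =>
    h (eqOn_zero_of_eventuallyEq isOpen_ball (convex_ball (0 : ℂ) R).isPreconnected hφ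
      (mem_ball_self hR) h0 ht)
  obtain ⟨d, g, hg, hg0, he⟩ := han.exists_eventuallyEq_pow_smul_nonzero_iff.2 hne
  have hgn : ∀ᶠ z in 𝓝 (0 : ℂ), ‖g 0‖ / 2 < ‖g z‖ :=
    hg.continuousAt.norm.eventually (lt_mem_nhds (half_lt_self (norm_pos_iff.2 hg0)))
  have hgd : ∀ᶠ z in 𝓝 (0 : ℂ), AnalyticAt ℂ g z := hg.eventually_analyticAt
  obtain ⟨ε, hε, hball⟩ := Metric.eventually_nhds_iff_ball.1 (he.and (hgn.and hgd))
  have hsub : ∀ z ∈ closedBall (0 : ℂ) (min ε R / 2), z ∈ ball (0 : ℂ) ε := by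
    intro z hz
    rw [mem_closedBall] at hz
    have := min_le_left ε R
    rw [mem_ball]
    linarith
  have hRpos : 0 < min ε R := lt_min hε hR
  refine ⟨d, g, min ε R / 2, ‖g 0‖ / 2, by linarith, by linarith [min_le_right ε R],
    half_pos (norm_pos_iff.2 hg0), fun z hz => ?_, fun z hz => ?_, fun z hz => ?_⟩
  · exact ((hball z (hsub z hz)).2.2).differentiableAt.differentiableWithinAt
  · exact (hball z (hsub z hz)).2.1.le
  · simpa using (hball z (hsub z hz)).1

theorem exists_forall_norm_sub_slice_le {F : Type*} [NormedAddCommGroup F] [NormedSpace ℂ F]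
    {Ω : Set E} (hΩ : IsOpen Ω) {h : E → ℂ} (hh : ContinuousOn h Ω) (A : F × ℂ →L[ℂ] E)
    (h0 : ∀ X ∈ closedBall (0 : ℂ) 1, A (0, X) ∈ Ω) {η : ℝ} (hη : 0 < η) :
    ∃ δ > 0, ∀ y ∈ closedBall (0 : F) δ, ∀ X ∈ closedBall (0 : ℂ) 1,
      A (y, X) ∈ Ω ∧ ‖h (A (y, X)) - h (A (0, X))‖ < η := by
  have hc0 : Continuous fun p : F × ℂ => A (0, p.2) := by fun_prop
  set D0 : Set (F × ℂ) := A ⁻¹' Ω ∩ (fun p : F × ℂ => A (0, p.2)) ⁻¹' Ω with hD0'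
  have hD0 : IsOpen D0 := (hΩ.preimage A.continuous).inter (hΩ.preimage hc0)
  have hcont : ContinuousOn (fun p : F × ℂ => ‖h (A p) - h (A (0, p.2))‖) D0 := by
    refine ContinuousOn.norm (ContinuousOn.sub ?_ ?_)
    · exact hh.comp A.continuous.continuousOn fun p hp => hp.1
    · exact hh.comp hc0.continuousOn fun p hp => hp.2
  have hop := hcont.isOpen_inter_preimage hD0 (isOpen_Iio (a := η))
  obtain ⟨A', B, hA, hB, h0A, hXB, hAB⟩ := generalized_tube_lemma
    (isCompact_singleton (x := (0 : F))) (isCompact_closedBall (0 : ℂ) 1) hop (by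
      rintro ⟨y, X⟩ ⟨hy, hX⟩
      obtain rfl : y = 0 := hy
      refine ⟨⟨h0 X hX, h0 X hX⟩, ?_⟩
      simpa using hη)
  obtain ⟨δ, hδ, hδA⟩ := Metric.nhds_basis_closedBall.mem_iff.1 (hA.mem_nhds (h0A rfl))
  refine ⟨δ, hδ, fun y hy X hX => ?_⟩
  obtain ⟨⟨h1, -⟩, h2⟩ := hAB (show (y, X) ∈ A' ×ˢ B from ⟨hδA hy, hXB hX⟩)
  exact ⟨h1, h2⟩

/-- Coordinates in which a holomorphic function is close to a power of the last coordinate. -/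
theorem exists_weierstrass_coordinates {n : ℕ} (hn : Module.finrank ℂ E = n + 1) {Ω : Set E}
    (hΩ : IsOpen Ω) (h0 : 0 ∈ Ω) {h : E → ℂ} (hh : DifferentiableOn ℂ h Ω)
    (hne : ∃ᶠ z in 𝓝 0, h z ≠ 0) :
    ∃ (d : ℕ) (L : E ≃L[ℂ] (Fin n → ℂ) × ℂ) (u : ℂ → ℂ) (c : ℝ), 0 < c ∧
      DifferentiableOn ℂ u (closedBall 0 1) ∧ (∀ X ∈ closedBall (0 : ℂ) 1, c ≤ ‖u X‖) ∧
      ∀ η > 0, ∃ δ > 0, ∀ y ∈ closedBall (0 : Fin n → ℂ) δ, ∀ X ∈ closedBall (0 : ℂ) 1,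
        L.symm (y, X) ∈ Ω ∧ ‖X ^ d - h (L.symm (y, X)) / u X‖ ≤ η := by
  have hnt : Nontrivial E := Module.nontrivial_of_finrank_pos (R := ℂ) (by omega)
  obtain ⟨R, hR, hRΩ⟩ := Metric.isOpen_iff.1 hΩ 0 h0
  obtain ⟨v, hvR, hv0, hv⟩ : ∃ v ∈ ball (0 : E) R, v ≠ 0 ∧ h v ≠ 0 := by
    by_cases hz : h 0 = 0
    · obtain ⟨v, hv, hvR⟩ := (hne.and_eventually (ball_mem_nhds 0 hR)).exists
      exact ⟨v, hvR, fun h' => hv (h' ▸ hz), hv⟩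
    · have hc : ContinuousAt h 0 := (hh.differentiableAt (hΩ.mem_nhds h0)).continuousAt
      have h1 := hc.eventually (isOpen_ne.mem_nhds hz)
      have := Module.punctured_nhds_neBot ℂ E 0
      obtain ⟨v, ⟨hv, hvR⟩, hv0⟩ := (((h1.and (ball_mem_nhds 0 hR)).filter_mono
        nhdsWithin_le_nhds).and (self_mem_nhdsWithin (a := (0 : E)) (s := {0}ᶜ))).exists
      exact ⟨v, hvR, hv0, hv⟩
  have hvpos : 0 < ‖v‖ := norm_pos_iff.2 hv0
  have hmem : ∀ t ∈ ball (0 : ℂ) (R / ‖v‖), t • v ∈ Ω := fun t ht => hRΩ (by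
    rw [mem_ball_zero_iff, norm_smul]
    rw [mem_ball_zero_iff, lt_div_iff₀ hvpos] at ht
    exact ht)
  have hφ : DifferentiableOn ℂ (fun t : ℂ => h (t • v)) (ball 0 (R / ‖v‖)) :=
    hh.comp (by fun_prop) hmem
  obtain ⟨d, g, ρ, c, hρ, hρR, hc, hg, hgc, hfac⟩ := exists_factor_pow hφ (t := 1) (by positivity)
    (by
      rw [mem_ball_zero_iff, norm_one, one_lt_div hvpos]
      simpa using hvR) (by simpa using hv)
  obtain ⟨L, hL⟩ := exists_equiv_prod hn (v := (ρ : ℂ) • v) (by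
    simp [hv0, hρ.ne'])
  have hscale : ∀ X ∈ closedBall (0 : ℂ) 1, X * ρ ∈ closedBall (0 : ℂ) ρ := by
    intro X hX
    rw [mem_closedBall_zero_iff] at hX ⊢
    rw [norm_mul, Complex.norm_of_nonneg hρ.le]
    exact mul_le_of_le_one_left hρ.le hX
  have hu : ∀ X ∈ closedBall (0 : ℂ) 1, ρ ^ d * c ≤ ‖(ρ : ℂ) ^ d * g (X * ρ)‖ := by
    intro X hX
    rw [norm_mul, norm_pow, Complex.norm_of_nonneg hρ.le]
    have := hgc _ (hscale X hX)
    gcongr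
  have hc' : 0 < ρ ^ d * c := by positivity
  refine ⟨d, L, fun X => ρ ^ d * g (X * ρ), ρ ^ d * c, hc', ?_, hu, ?_⟩
  · refine DifferentiableOn.const_mul ?_ _
    exact hg.comp (by fun_prop) hscale
  intro η hη
  have h0D : ∀ X ∈ closedBall (0 : ℂ) 1, L.symm (0, X) ∈ Ω := by
    intro X hX
    rw [hL, smul_smul]
    exact hmem _ (closedBall_subset_ball hρR (hscale X hX))
  have hslice : ∀ X ∈ closedBall (0 : ℂ) 1,
      h (L.symm (0, X)) = X ^ d * (ρ ^ d * g (X * ρ)) := by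
    intro X hX
    rw [hL, smul_smul, hfac _ (hscale X hX)]
    ring
  obtain ⟨δ, hδ, hδ'⟩ := exists_forall_norm_sub_slice_le hΩ hh.continuousOn
    (L.symm : (Fin n → ℂ) × ℂ →L[ℂ] E) h0D (η := η * (ρ ^ d * c)) (by positivity)
  refine ⟨δ, hδ, fun y hy X hX => ?_⟩
  obtain ⟨h1, h2⟩ := hδ' y hy X hX
  refine ⟨h1, ?_⟩
  have hup := hu X hX
  have hune : (ρ : ℂ) ^ d * g (X * ρ) ≠ 0 := norm_pos_iff.1 (hc'.trans_le hup)
  rw [ContinuousLinearEquiv.coe_coe, hslice X hX] at h2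
  rw [← norm_neg, neg_sub]
  have : h (L.symm (y, X)) / (ρ ^ d * g (X * ρ)) - X ^ d =
      (h (L.symm (y, X)) - X ^ d * (ρ ^ d * g (X * ρ))) / (ρ ^ d * g (X * ρ)) := by
    rw [sub_div, mul_div_cancel_right₀ _ hune]
  rw [this, norm_div, div_le_iff₀ (hc'.trans_le hup)]
  exact h2.le.trans (by gcongr)

end WeierstrassCoordinates

section Families

/-- Every bounded family of tuples of `s` holomorphic functions of `n` variables is, near the
origin, generated by finitely many of its members with bounded holomorphic coefficients. -/
def FamilyFinite (n s : ℕ) : Prop :=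
  ∀ (Z : Type) (F : Z → Fin s → (Fin n → ℂ) → ℂ) (r M : ℝ), 0 < r →
    (∀ ζ i, DifferentiableOn ℂ (F ζ i) (ball 0 r)) →
    (∀ ζ i, ∀ w ∈ ball (0 : Fin n → ℂ) r, ‖F ζ i w‖ ≤ M) →
    ∃ (r' C : ℝ) (ι : Type) (_ : Fintype ι) (ζs : ι → Z) (φ : Z → ι → (Fin n → ℂ) → ℂ),
      0 < r' ∧ r' ≤ r ∧ 0 ≤ C ∧ (∀ ζ j, DifferentiableOn ℂ (φ ζ j) (ball 0 r')) ∧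
      (∀ ζ j, ∀ w ∈ ball (0 : Fin n → ℂ) r', ‖φ ζ j w‖ ≤ C) ∧
      ∀ ζ i, ∀ w ∈ ball (0 : Fin n → ℂ) r', F ζ i w = ∑ j, φ ζ j w * F (ζs j) i w

theorem FamilyFinite.zero_right (n : ℕ) : FamilyFinite n 0 := fun _ _ r _ hr _ _ =>
  ⟨r, 0, Empty, inferInstance, Empty.elim, fun _ j => j.elim, hr, le_rfl, le_rfl,
    fun _ j => j.elim, fun _ j => j.elim, fun _ i => i.elim0⟩

theorem norm_sum_mul_le {ι : Type*} [Fintype ι] {a b : ι → ℂ} {A B : ℝ} (hA : 0 ≤ A)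
    (ha : ∀ i, ‖a i‖ ≤ A) (hb : ∀ i, ‖b i‖ ≤ B) :
    ‖∑ i, a i * b i‖ ≤ Fintype.card ι * (A * B) := by
  refine (norm_sum_le_of_le (f := fun i => a i * b i) (n := fun _ => A * B) Finset.univ
    fun i _ => ?_).trans (le_of_eq ?_)
  · rw [norm_mul]
    exact mul_le_mul (ha i) (hb i) (norm_nonneg _) hA
  · simp

theorem FamilyFinite.succ_right {n s : ℕ} (h1 : FamilyFinite n 1) (hs : FamilyFinite n s) :
    FamilyFinite n (s + 1) := by
  intro Z F r M hr hF hM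
  obtain ⟨r₁, C₁, ι, hι, ζ, φ, hr₁, hrr₁, hC₁, hφ, hφC, he⟩ :=
    h1 Z (fun ζ _ => F ζ 0) r M hr (fun ζ _ => hF ζ 0) (fun ζ _ => hM ζ 0)
  have hb₁ : ball (0 : Fin n → ℂ) r₁ ⊆ ball 0 r := ball_subset_ball hrr₁
  let G : Z → Fin (s + 1) → (Fin n → ℂ) → ℂ := fun z i w => F z i w - ∑ j, φ z j w * F (ζ j) i w
  obtain ⟨r₂, C₂, κ, hκ, ξ, ψ, hr₂, hrr₂, hC₂, hψ, hψC, he₂⟩ :=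
    hs Z (fun z i => G z i.succ) r₁ (M + Fintype.card ι * (C₁ * M)) hr₁
      (fun z i => ((hF z _).mono hb₁).sub (DifferentiableOn.fun_sum fun j _ =>
        (hφ z j).mul ((hF (ζ j) _).mono hb₁)))
      (fun z i w hw => (norm_sub_le _ _).trans (add_le_add (hM z _ w (hb₁ hw))
        (norm_sum_mul_le hC₁ (fun j => hφC z j w hw) fun j => hM _ _ w (hb₁ hw))))
  have hb₂ : ball (0 : Fin n → ℂ) r₂ ⊆ ball 0 r₁ := ball_subset_ball hrr₂
  refine ⟨r₂, C₁ + Fintype.card κ * (C₂ * C₁) + C₂, ι ⊕ κ, inferInstance, Sum.elim ζ ξ,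
    fun z => Sum.elim (fun j w => φ z j w - ∑ k, ψ z k w * φ (ξ k) j w) (ψ z),
    hr₂, hrr₂.trans hrr₁, by positivity, ?_, ?_, ?_⟩
  · rintro z (j | k)
    · exact ((hφ z j).mono hb₂).sub (DifferentiableOn.fun_sum fun k _ =>
        (hψ z k).mul ((hφ _ j).mono hb₂))
    · exact hψ z k
  · rintro z (j | k) w hw
    · refine (norm_sub_le _ _).trans ((add_le_add (hφC z j w (hb₂ hw)) (norm_sum_mul_le hC₂
        (fun k => hψC z k w hw) fun k => hφC _ j w (hb₂ hw))).trans ?_)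
      linarith
    · refine (hψC z k w hw).trans ?_
      have : 0 ≤ C₁ + Fintype.card κ * (C₂ * C₁) := by positivity
      simpa using this
  · intro z i w hw
    have hG : G z i w = ∑ k, ψ z k w * G (ξ k) i w := by
      refine Fin.cases ?_ (fun i => he₂ z i w hw) i
      have h0 : ∀ z, G z 0 w = 0 := fun z => by
        have := he z 0 w (hb₂ hw)
        simp only [G]
        rw [← this, sub_self]
      simp [h0]
    simp only [Fintype.sum_sum_type, Sum.elim_inl, Sum.elim_inr]
    have hz : F z i w = ∑ j, φ z j w * F (ζ j) i w + ∑ k, ψ z k w * G (ξ k) i w := by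
      rw [← hG]; simp [G]
    rw [hz]
    simp only [G, mul_sub, sub_mul, Finset.sum_sub_distrib, Finset.mul_sum, Finset.sum_mul]
    rw [Finset.sum_comm (s := (Finset.univ : Finset κ))]
    simp only [mul_assoc]
    ring

theorem FamilyFinite.of_one {n : ℕ} (h1 : FamilyFinite n 1) (s : ℕ) : FamilyFinite n s := by
  induction s with
  | zero => exact .zero_right n
  | succ s ih => exact h1.succ_right ih

theorem FamilyFinite.zero_left : FamilyFinite 0 1 := by
  intro Z F r M hr hF hM
  by_cases h : ∃ z, F z 0 0 ≠ 0
  · obtain ⟨z₀, hz₀⟩ := h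
    refine ⟨r, M / ‖F z₀ 0 0‖, Unit, inferInstance, fun _ => z₀, fun z _ _ => F z 0 0 / F z₀ 0 0,
      hr, le_rfl, ?_, fun _ _ => differentiableOn_const _, ?_, ?_⟩
    · have := (norm_nonneg _).trans (hM z₀ 0 0 (by simpa using hr))
      positivity
    · intro z _ w hw
      rw [norm_div]
      gcongr
      exact hM z 0 0 (by simpa using hr)
    · intro z i w hw
      obtain rfl : w = 0 := Subsingleton.elim _ _
      obtain rfl : i = 0 := Subsingleton.elim _ _
      rw [Fintype.sum_unique, div_mul_cancel₀ _ hz₀]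
  · push Not at h
    refine ⟨r, 0, Empty, inferInstance, Empty.elim, fun _ j => j.elim, hr, le_rfl, le_rfl,
      fun _ j => j.elim, fun _ j => j.elim, fun z i w hw => ?_⟩
    obtain rfl : w = 0 := Subsingleton.elim _ _
    obtain rfl : i = 0 := Subsingleton.elim _ _
    rw [h, Finset.univ_eq_empty, Finset.sum_empty]

theorem FamilyFinite.succ_left {n : ℕ} (hn : ∀ s, FamilyFinite n s) : FamilyFinite (n + 1) 1 := by
  intro Z F r M hr hF hM
  by_cases h : ∃ z, ∃ᶠ w in 𝓝 0, F z 0 w ≠ 0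
  swap
  · push Not at h
    refine ⟨r, 0, Empty, inferInstance, Empty.elim, fun _ j => j.elim, hr, le_rfl, le_rfl,
      fun _ j => j.elim, fun _ j => j.elim, fun z i w hw => ?_⟩
    obtain rfl : i = 0 := Subsingleton.elim _ _
    have h0 : ∀ᶠ w in 𝓝 0, F z 0 w = 0 := by simpa using h z
    simpa using eqOn_zero_of_eventuallyEq isOpen_ball (convex_ball (0 : Fin (n + 1) → ℂ) r).isPreconnected
      (hF z 0) (mem_ball_self hr) h0 hw
  obtain ⟨z₀, hz₀⟩ := h
  have hM0 : 0 ≤ M := (norm_nonneg _).trans (hM z₀ 0 0 (by simpa using hr))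
  obtain ⟨d, L, u, c, hc, hu, huc, hδ⟩ := exists_weierstrass_coordinates (n := n) (by simp)
    isOpen_ball (mem_ball_self hr) (hF z₀ 0) hz₀
  obtain ⟨δ, hδ0, hδ⟩ := hδ ((1 / 2) ^ (d + 1)) (by positivity)
  have hmem : ∀ y ∈ ball (0 : Fin n → ℂ) δ, ∀ X ∈ ball (0 : ℂ) 1, L.symm (y, X) ∈ ball 0 r :=
    fun y hy X hX => (hδ y (ball_subset_closedBall hy) X (ball_subset_closedBall hX)).1
  have hune : ∀ X ∈ ball (0 : ℂ) 1, u X ≠ 0 := fun X hX =>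
    norm_pos_iff.1 (hc.trans_le (huc X (ball_subset_closedBall hX)))
  have hL : ∀ z, DifferentiableOn ℂ (fun p => F z 0 (L.symm p))
      (ball (0 : Fin n → ℂ) δ ×ˢ ball (0 : ℂ) 1) := fun z =>
    (hF z 0).comp L.symm.differentiable.differentiableOn fun p hp => hmem _ hp.1 _ hp.2
  have hdiv := fun z => HolBdd.exists_division (V := Fin n → ℂ) (Ω := ball 0 δ) isOpen_ball (d := d)
    (h := fun p => F z₀ 0 (L.symm p) * (u p.2)⁻¹)
    ((hL z₀).mul (DifferentiableOn.fun_inv (hu.comp (t := closedBall 0 1) differentiableOn_snd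
        fun p hp => ball_subset_closedBall hp.2)
      fun p hp => hune _ hp.2))
    (fun y hy X hX => by
      rw [← div_eq_mul_inv]
      exact (hδ y (ball_subset_closedBall hy) X (ball_subset_closedBall hX)).2)
    (g := fun p => F z 0 (L.symm p)) (M := M)
    ⟨hL z, fun y hy X hX => hM z 0 _ (hmem y hy X hX)⟩
  choose q ρ hq hρ hρM he using hdiv
  obtain ⟨r', C, ι, hι, ζ, ψ, hr', hrr', hC, hψ, hψC, heψ⟩ := hn d Z (fun z j => ρ z j) δ
    (2 ^ (d + 1) * M) hδ0 (fun z j => hρ z j) (fun z j => hρM z j j.2)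
  have hbb : ball (0 : Fin n → ℂ) r' ⊆ ball 0 δ := ball_subset_ball hrr'
  obtain ⟨r₂, hr₂, hr₂L⟩ := Metric.mem_nhds_iff.1
    (L.continuous.continuousAt.preimage_mem_nhds (x := (0 : Fin (n + 1) → ℂ))
      ((isOpen_ball.prod isOpen_ball).mem_nhds
        (show L 0 ∈ ball (0 : Fin n → ℂ) r' ×ˢ ball (0 : ℂ) 1 by simp [hr'])))
  have hLm : ∀ w ∈ ball (0 : Fin (n + 1) → ℂ) (min r₂ r),
      (L w).1 ∈ ball (0 : Fin n → ℂ) r' ∧ (L w).2 ∈ ball (0 : ℂ) 1 := fun w hw =>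
    hr₂L (ball_subset_ball (min_le_left _ _) hw)
  have hMd : 0 ≤ 2 ^ (d + 1) * M := by positivity
  refine ⟨min r₂ r, C + c⁻¹ * (2 ^ (d + 1) * M + Fintype.card ι * (C * (2 ^ (d + 1) * M))),
    Option ι, inferInstance, fun o => o.elim z₀ ζ,
    fun z o => o.elim (fun w => (u (L w).2)⁻¹ * (q z (L w) - ∑ j, ψ z j (L w).1 * q (ζ j) (L w)))
      (fun j w => ψ z j (L w).1), lt_min hr₂ hr, min_le_right _ _, by positivity, ?_, ?_, ?_⟩
  · have hqL : ∀ z, DifferentiableOn ℂ (fun w => q z (L w)) (ball 0 (min r₂ r)) := fun z =>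
      (hq z).1.comp L.differentiable.differentiableOn fun w hw => ⟨hbb (hLm w hw).1, (hLm w hw).2⟩
    have hψL : ∀ z j, DifferentiableOn ℂ (fun w => ψ z j (L w).1) (ball 0 (min r₂ r)) := fun z j =>
      (hψ z j).comp (differentiable_fst.comp L.differentiable).differentiableOn
        fun w hw => (hLm w hw).1
    have huL : DifferentiableOn ℂ (fun w => (u (L w).2)⁻¹) (ball 0 (min r₂ r)) := by
      refine DifferentiableOn.fun_inv (hu.comp
        (differentiable_snd.comp L.differentiable).differentiableOn
        fun w hw => ball_subset_closedBall (hLm w hw).2) fun w hw => hune _ (hLm w hw).2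
    rintro z (_ | j)
    · exact huL.mul ((hqL z).sub (DifferentiableOn.fun_sum fun j _ => (hψL z j).mul (hqL (ζ j))))
    · exact hψL z j
  · rintro z (_ | j) w hw
    · obtain ⟨h1, h2⟩ := hLm w hw
      have hq' : ∀ z, ‖q z (L w)‖ ≤ 2 ^ (d + 1) * M := fun z => (hq z).2 _ (hbb h1) _ h2
      simp only [Option.elim_none, norm_mul, norm_inv]
      have h3 : ‖u (L w).2‖⁻¹ ≤ c⁻¹ := by
        gcongr
        exact huc _ (ball_subset_closedBall h2)
      have h4 := (norm_sub_le (q z (L w)) (∑ j, ψ z j (L w).1 * q (ζ j) (L w))).trans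
        (add_le_add (hq' z) (norm_sum_mul_le hC (fun j => hψC z j _ h1) fun j => hq' (ζ j)))
      exact (mul_le_mul h3 h4 (norm_nonneg _) (by positivity)).trans (le_add_of_nonneg_left hC)
    · refine (hψC z j _ (hLm w hw).1).trans (le_add_of_nonneg_right ?_)
      positivity
  · intro z i w hw
    obtain rfl : i = 0 := Subsingleton.elim _ _
    obtain ⟨h1, h2⟩ := hLm w hw
    have hE : ∀ z, F z 0 w = F z₀ 0 w * (u (L w).2)⁻¹ * q z (L w) +
        ∑ j : Fin d, ρ z j (L w).1 * (L w).2 ^ (j : ℕ) := by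
      intro z
      have := he z (L w).1 (hbb h1) (L w).2 h2
      rw [Finset.sum_range] at this
      simpa using this
    have hR : ∑ j : Fin d, ρ z j (L w).1 * (L w).2 ^ (j : ℕ) =
        ∑ k, ψ z k (L w).1 * ∑ j : Fin d, ρ (ζ k) j (L w).1 * (L w).2 ^ (j : ℕ) := by
      simp only [Finset.mul_sum]
      rw [Finset.sum_comm]
      refine Finset.sum_congr rfl fun j _ => ?_
      rw [heψ z j _ h1, Finset.sum_mul]
      simp only [mul_assoc]
    rw [Fintype.sum_option]
    simp only [Option.elim_none, Option.elim_some]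
    have hS : ∑ k, ψ z k (L w).1 * F (ζ k) 0 w = F z₀ 0 w * (u (L w).2)⁻¹ *
        (∑ k, ψ z k (L w).1 * q (ζ k) (L w)) +
        ∑ j : Fin d, ρ z j (L w).1 * (L w).2 ^ (j : ℕ) := by
      rw [hR, Finset.mul_sum, ← Finset.sum_add_distrib]
      refine Finset.sum_congr rfl fun k _ => ?_
      rw [hE (ζ k)]
      ring
    rw [hS, hE z]
    ring

theorem familyFinite (n s : ℕ) : FamilyFinite n s := by
  induction n generalizing s with
  | zero => exact FamilyFinite.zero_left.of_one s
  | succ n ih => exact (FamilyFinite.succ_left ih).of_one s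

/-- A bounded family of holomorphic functions is dominated by finitely many of its members. -/
theorem exists_finite_domination {n : ℕ} {Z : Type} {F : Z → (Fin n → ℂ) → ℂ} {a : Fin n → ℂ}
    {r M : ℝ} (hr : 0 < r) (hF : ∀ ζ, DifferentiableOn ℂ (F ζ) (ball a r))
    (hM : ∀ ζ, ∀ w ∈ ball a r, ‖F ζ w‖ ≤ M) :
    ∃ (r' C : ℝ) (ι : Type) (_ : Fintype ι) (ζs : ι → Z), 0 < r' ∧ r' ≤ r ∧ 0 ≤ C ∧
      ∀ ζ, ∀ w ∈ ball a r', ‖F ζ w‖ ≤ C * ∑ j, ‖F (ζs j) w‖ := by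
  have hadd : ∀ w ∈ ball (0 : Fin n → ℂ) r, a + w ∈ ball a r := fun w hw => by simpa using hw
  obtain ⟨r', C, ι, hι, ζs, φ, hr', hrr', hC, -, hφ, he⟩ := familyFinite n 1 Z
    (fun ζ _ w => F ζ (a + w)) r M hr (fun ζ _ => (hF ζ).comp (by fun_prop) hadd)
    (fun ζ _ w hw => hM ζ _ (hadd w hw))
  refine ⟨r', C, ι, hι, ζs, hr', hrr', hC, fun ζ w hw => ?_⟩
  have hw' : w - a ∈ ball (0 : Fin n → ℂ) r' := by simpa [dist_eq_norm] using hw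
  have := he ζ 0 _ hw'
  rw [add_sub_cancel] at this
  rw [this, Finset.mul_sum]
  refine norm_sum_le_of_le _ fun j _ => ?_
  rw [norm_mul]
  gcongr
  exact hφ ζ j _ hw'

end Families

section Complexification

/-- A real analytic function is the restriction of a holomorphic one. -/
theorem exists_complexification {K : Type*} [Fintype K] {f : (K → ℝ) → ℝ}
    (hf : AnalyticAt ℝ f 0) :
    ∃ (ρ M : ℝ) (F : (K → ℂ) → ℂ), 0 < ρ ∧ DifferentiableOn ℂ F (ball 0 ρ) ∧
      (∀ x ∈ ball (0 : K → ℂ) ρ, ‖F x‖ ≤ M) ∧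
      ∀ x : K → ℝ, ‖x‖ < ρ → F (fun k => x k) = f x := by
  classical
  obtain ⟨ps, rad, hps⟩ := hf
  obtain ⟨r₀, hr₀, hr₀'⟩ := ENNReal.lt_iff_exists_nnreal_btwn.1 hps.r_pos
  have hr0 : 0 < (r₀ : ℝ) := by exact_mod_cast hr₀
  obtain ⟨C, hC, hCb⟩ := ps.norm_mul_pow_le_of_lt_radius (hr₀'.trans_le hps.r_le)
  set κ : ℝ := ((Fintype.card K : ℕ) : ℝ) with hκ
  have hκ0 : 0 ≤ κ := Nat.cast_nonneg _
  set ρ : ℝ := r₀ / (2 * (κ + 1)) with hρ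
  have hρ0 : 0 < ρ := by positivity
  let P : ℕ → (K → ℂ) → ℂ := fun n x =>
    ∑ σ : Fin n → K, (∏ l, x (σ l)) * ((ps n fun l => Pi.single (σ l) 1 : ℝ) : ℂ)
  have hPd : ∀ n, Differentiable ℂ (P n) := fun n => by
    refine Differentiable.fun_sum fun σ _ => Differentiable.mul_const ?_ _
    fun_prop
  have hPb : ∀ n, ∀ x ∈ ball (0 : K → ℂ) ρ, ‖P n x‖ ≤ C * (1 / 2) ^ n := by
    intro n x hx
    rw [mem_ball_zero_iff] at hx
    have h1 : ‖P n x‖ ≤ ∑ _σ : Fin n → K, ρ ^ n * ‖ps n‖ := by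
      refine norm_sum_le_of_le _ fun σ _ => ?_
      rw [norm_mul, norm_prod, Complex.norm_real]
      refine mul_le_mul ?_ ?_ (norm_nonneg _) (by positivity)
      · refine (Finset.prod_le_prod (fun _ _ => norm_nonneg _)
          (g := fun _ => ρ) fun l _ => (norm_le_pi_norm x _).trans hx.le).trans (by simp)
      · refine (ContinuousMultilinearMap.le_opNorm _ _).trans ?_
        refine mul_le_of_le_one_right (norm_nonneg _) (Finset.prod_le_one
          (fun _ _ => norm_nonneg _) fun l _ => ?_)
        rw [Pi.norm_single, norm_one]
    refine h1.trans ?_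
    rw [Finset.sum_const, nsmul_eq_mul, Finset.card_univ, Fintype.card_fun, Fintype.card_fin,
      Nat.cast_pow, ← hκ]
    have h2 : κ * ρ ≤ r₀ / 2 := by
      rw [hρ, mul_div_assoc', div_le_div_iff₀ (by positivity) (by norm_num)]
      nlinarith
    calc κ ^ n * (ρ ^ n * ‖ps n‖) = (κ * ρ) ^ n * ‖ps n‖ := by rw [mul_pow]; ring
      _ ≤ (r₀ / 2) ^ n * ‖ps n‖ := by gcongr
      _ = (‖ps n‖ * r₀ ^ n) * (1 / 2) ^ n := by rw [div_pow, one_div, inv_pow]; ring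
      _ ≤ C * (1 / 2) ^ n := by gcongr; exact hCb n
  have hgeo : Summable fun n : ℕ => C * (1 / 2 : ℝ) ^ n :=
    (summable_geometric_of_lt_one (by norm_num) (by norm_num)).mul_left C
  have hsum : ∀ x ∈ ball (0 : K → ℂ) ρ, HasSum (fun n => P n x) (∑' n, P n x) := fun x hx =>
    (Summable.of_norm_bounded hgeo fun n => hPb n x hx).hasSum
  have hpart : ∀ s : Finset ℕ, ∀ x ∈ ball (0 : K → ℂ) ρ,
      ‖∑ n ∈ s, P n x‖ ≤ ∑' n : ℕ, C * (1 / 2 : ℝ) ^ n := fun s x hx =>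
    (norm_sum_le_of_le s fun n _ => hPb n x hx).trans
      (hgeo.sum_le_tsum s fun n _ => by positivity)
  refine ⟨ρ, ∑' n : ℕ, C * (1 / 2 : ℝ) ^ n, fun x => ∑' n, P n x, hρ0, ?_, ?_, ?_⟩
  · refine differentiableOn_of_tendsto (l := atTop) (F := fun s x => ∑ n ∈ s, P n x) isOpen_ball
      (.of_forall fun s => ?_) (.of_forall fun s => hpart s) hsum
    exact DifferentiableOn.fun_sum fun n _ => (hPd n).differentiableOn
  · intro x hx
    exact le_of_tendsto (hsum x hx).norm (.of_forall fun s => hpart s x hx)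
  · intro x hx
    have hxr : x ∈ Metric.eball (0 : K → ℝ) rad := by
      rw [mem_eball_zero_iff]
      refine lt_trans ?_ hr₀'
      rw [← ofReal_norm, ← ENNReal.ofReal_coe_nnreal]
      refine (ENNReal.ofReal_lt_ofReal_iff hr0).2 (hx.trans_le ?_)
      exact div_le_self hr0.le (by linarith)
    have h1 := hps.hasSum hxr
    rw [zero_add] at h1
    have h2 : ∀ n, P n (fun k => x k) = ((ps n fun _ => x : ℝ) : ℂ) := by
      intro n
      have hx' : x = ∑ k, x k • (Pi.single k 1 : K → ℝ) := by
        rw [← pi_eq_sum_univ' x]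
      conv_rhs => rw [hx']
      have := (ps n).toMultilinearMap.map_sum (fun (_ : Fin n) k => x k • (Pi.single k 1 : K → ℝ))
      rw [ContinuousMultilinearMap.coe_coe] at this
      rw [this]
      simp only [P, ofReal_sum,
        ContinuousMultilinearMap.map_smul_univ, smul_eq_mul, ofReal_mul, ofReal_prod]
    simp only [h2]
    exact (Complex.hasSum_ofReal.2 h1).tsum_eq

theorem exists_complexification_CN {N : ℕ} {r : CN N → ℝ} {p : CN N} (hr : AnalyticAt ℝ r p) :
    ∃ (ρ M : ℝ) (R : CN N × CN N → ℂ), 0 < ρ ∧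
      DifferentiableOn ℂ R (ball p ρ ×ˢ ball (star p) ρ) ∧
      (∀ z ∈ ball p ρ ×ˢ ball (star p) ρ, ‖R z‖ ≤ M) ∧
      ∀ z ∈ ball p ρ, R (z, star z) = r z := by
  let A : (Fin N ⊕ Fin N → ℝ) →L[ℝ] CN N := LinearMap.toContinuousLinearMap
    { toFun := fun x i => x (.inl i) + x (.inr i) * I
      map_add' := fun x y => by ext i; simp; ring
      map_smul' := fun c x => by ext i; simp; ring }
  have hA : ∀ x i, A x i = x (.inl i) + x (.inr i) * I := fun x i => rfl
  have hf : AnalyticAt ℝ (fun x => r (p + A x)) 0 := by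
    refine AnalyticAt.fun_comp (g := r) ?_ (analyticAt_const.add (A.analyticAt 0))
    simpa using hr
  obtain ⟨ρ, M, F, hρ, hF, hM, he⟩ := exists_complexification hf
  let B : CN N × CN N → (Fin N ⊕ Fin N → ℂ) := fun q =>
    Sum.elim (fun i => ((q.1 i - p i) + (q.2 i - star p i)) / 2)
      (fun i => ((q.1 i - p i) - (q.2 i - star p i)) / (2 * I))
  have hB : Differentiable ℂ B := by
    rw [differentiable_pi]
    rintro (i | i) <;> simp only [B, Sum.elim_inl, Sum.elim_inr] <;> fun_prop
  have hBm : MapsTo B (ball p ρ ×ˢ ball (star p) ρ) (ball 0 ρ) := by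
    rintro ⟨z, w⟩ ⟨hz, hw⟩
    simp only [mem_ball_iff_norm] at hz hw
    have h1 : ∀ i, ‖z i - p i‖ < ρ := fun i => (norm_le_pi_norm (z - p) i).trans_lt hz
    have h2 : ∀ i, ‖w i - star p i‖ < ρ := fun i => (norm_le_pi_norm (w - star p) i).trans_lt hw
    rw [mem_ball_zero_iff, pi_norm_lt_iff hρ]
    rintro (i | i)
    · simp only [B, Sum.elim_inl, norm_div, Complex.norm_ofNat]
      have := norm_add_le (z i - p i) (w i - star p i)
      have := h1 i
      have := h2 i
      linarith
    · simp only [B, Sum.elim_inr, norm_div, norm_mul, Complex.norm_ofNat, norm_I]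
      have := norm_sub_le (z i - p i) (w i - star p i)
      have := h1 i
      have := h2 i
      linarith
  refine ⟨ρ, M, F ∘ B, hρ, hF.comp hB.differentiableOn hBm, fun z hz => hM _ (hBm hz), ?_⟩
  intro z hz
  have hBz : B (z, star z) = fun k => ((Sum.elim (fun i => (z i - p i).re)
      (fun i => (z i - p i).im) k : ℝ) : ℂ) := by
    ext (i | i)
    · have := Complex.add_conj (z i - p i)
      simp only [B, Sum.elim_inl, Pi.star_apply, ← star_sub]
      rw [Complex.star_def, this]
      push_cast
      ring
    · have := Complex.sub_conj (z i - p i)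
      simp only [B, Sum.elim_inr, Pi.star_apply, ← star_sub]
      rw [Complex.star_def, this]
      push_cast
      field_simp
  have hn := hBm (show (z, star z) ∈ ball p ρ ×ˢ ball (star p) ρ from ⟨hz, by
    rw [mem_ball_iff_norm, ← star_sub, norm_star]
    rwa [mem_ball_iff_norm] at hz⟩)
  rw [hBz, mem_ball_zero_iff] at hn
  rw [Function.comp_apply, hBz, he]
  · congr 2
    ext i
    rw [Pi.add_apply, hA]
    simp only [Sum.elim_inl, Sum.elim_inr, Complex.re_add_im, add_sub_cancel]
  · rw [pi_norm_lt_iff hρ] at hn ⊢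
    intro i
    simpa using hn i

end Complexification

section Uniqueness

variable {E : Type*} [NormedAddCommGroup E] [NormedSpace ℂ E]

theorem eqOn_zero_of_real {O : Set ℂ} (hO : IsOpen O) (hc : IsPreconnected O) {φ : ℂ → ℂ}
    (hφ : DifferentiableOn ℂ φ O) {s₀ : ℂ} (hs₀ : s₀ ∈ O) (him : s₀.im = 0)
    (h : ∀ᶠ s in 𝓝 s₀, s.im = 0 → φ s = 0) : EqOn φ 0 O := by
  refine (hφ.analyticOnNhd hO).eqOn_zero_of_preconnected_of_frequently_eq_zero hc hs₀ ?_
  have ht : Tendsto (fun t : ℝ => s₀ + t) (𝓝[≠] 0) (𝓝[≠] s₀) := by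
    refine tendsto_nhdsWithin_iff.2 ⟨?_, ?_⟩
    · refine Tendsto.mono_left ?_ nhdsWithin_le_nhds
      have : Continuous fun t : ℝ => s₀ + t := by fun_prop
      simpa using this.tendsto 0
    · filter_upwards [self_mem_nhdsWithin] with t ht
      simpa using ht
  refine ht.frequently (Eventually.frequently ?_)
  filter_upwards [ht.eventually (h.filter_mono nhdsWithin_le_nhds)] with t ht
  exact ht (by simp [him])

/-- A holomorphic function vanishing on the real level set of a submersion vanishes nearby. -/
theorem eventually_eq_zero_of_real_level [FiniteDimensional ℂ E] {f g : E → ℂ} {q : E}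
    (hf : ∀ᶠ z in 𝓝 q, DifferentiableAt ℂ f z) (hg : ∀ᶠ z in 𝓝 q, DifferentiableAt ℂ g z)
    (hd : fderiv ℂ f q ≠ 0) (him : (f q).im = 0) (h : ∀ᶠ z in 𝓝 q, (f z).im = 0 → g z = 0) :
    ∀ᶠ z in 𝓝 q, g z = 0 := by
  obtain ⟨v, hv⟩ : ∃ v, fderiv ℂ f q v ≠ 0 := by
    by_contra! h0
    exact hd (ContinuousLinearMap.ext h0)
  obtain ⟨ρ, hρ, hball⟩ := Metric.eventually_nhds_iff_ball.1 (hf.and (hg.and h))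
  let m : (E × ℂ) × ℂ → E := fun w => w.1.1 + w.2 • v
  have hm : Differentiable ℂ m := by fun_prop
  have hO : IsOpen (m ⁻¹' ball q ρ) := isOpen_ball.preimage hm.continuous
  have hG : DifferentiableOn ℂ (fun w : (E × ℂ) × ℂ => f (m w) - w.1.2) (m ⁻¹' ball q ρ) := by
    refine DifferentiableOn.sub ?_ (by fun_prop)
    exact DifferentiableOn.comp (t := ball q ρ) (g := f)
      (fun z hz => (hball z hz).1.differentiableWithinAt) hm.differentiableOn fun _ h => h
  have h0 : ((q, f q), (0 : ℂ)) ∈ m ⁻¹' ball q ρ := by simp [m, hρ]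
  have hder : fderiv ℂ (fun w : (E × ℂ) × ℂ => f (m w) - w.1.2) ((q, f q), 0) (0, 1) ≠ 0 := by
    have h1 : HasFDerivAt m ((ContinuousLinearMap.fst ℂ E ℂ).comp (ContinuousLinearMap.fst ℂ _ ℂ) +
        (ContinuousLinearMap.toSpanSingleton ℂ v).comp (ContinuousLinearMap.snd ℂ (E × ℂ) ℂ))
        ((q, f q), 0) := by
      have := ((ContinuousLinearMap.fst ℂ E ℂ).comp (ContinuousLinearMap.fst ℂ _ ℂ) +
        (ContinuousLinearMap.toSpanSingleton ℂ v).comp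
          (ContinuousLinearMap.snd ℂ (E × ℂ) ℂ)).hasFDerivAt (x := ((q, f q), 0))
      exact this
    have h2 : HasFDerivAt f (fderiv ℂ f q) (m ((q, f q), 0)) := by
      have : m ((q, f q), 0) = q := by simp [m]
      rw [this]
      exact (hball q (mem_ball_self hρ)).1.hasFDerivAt
    have h3 : HasFDerivAt (fun w : (E × ℂ) × ℂ => w.1.2)
        ((ContinuousLinearMap.snd ℂ E ℂ).comp (ContinuousLinearMap.fst ℂ (E × ℂ) ℂ))
        ((q, f q), 0) :=
      ((ContinuousLinearMap.snd ℂ E ℂ).comp (ContinuousLinearMap.fst ℂ (E × ℂ) ℂ)).hasFDerivAt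
    have h4 : HasFDerivAt (fun w : (E × ℂ) × ℂ => f (m w) - w.1.2) _ ((q, f q), 0) :=
      (h2.comp _ h1).sub h3
    rw [h4.fderiv]
    simpa using hv
  obtain ⟨δ, ε, ζ, hδ, hε, hζ, hsub, hζm, hiff⟩ := exists_implicit hO hG h0 (by simp [m]) hder
  have hcont : ContinuousAt (fun z => (z, f z)) q :=
    continuousAt_id.prodMk (hball q (mem_ball_self hρ)).1.continuousAt
  filter_upwards [hcont.preimage_mem_nhds (ball_mem_nhds _ hδ), ball_mem_nhds q hδ] with z hz hzq
  have hmaps : ∀ s ∈ ball (f q) δ, (z, s) ∈ ball (q, f q) δ := fun s hs => by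
    rw [← ball_prod_same]
    exact ⟨hzq, hs⟩
  have hmm : ∀ s ∈ ball (f q) δ, m ((z, s), ζ (z, s)) ∈ ball q ρ := fun s hs =>
    hsub ⟨hmaps s hs, hζm _ (hmaps s hs)⟩
  have hφ : DifferentiableOn ℂ (fun s => g (m ((z, s), ζ (z, s)))) (ball (f q) δ) := by
    refine DifferentiableOn.comp (t := ball q ρ) (g := g)
      (fun z hz => (hball z hz).2.1.differentiableWithinAt) ?_ hmm
    have hζs : DifferentiableOn ℂ (fun s => ζ (z, s)) (ball (f q) δ) :=
      hζ.comp (by fun_prop) hmaps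
    exact hm.comp_differentiableOn (DifferentiableOn.prodMk (by fun_prop) hζs)
  have hfm : ∀ s ∈ ball (f q) δ, f (m ((z, s), ζ (z, s))) = s := fun s hs =>
    sub_eq_zero.1 ((hiff _ (hmaps s hs) _ (hζm _ (hmaps s hs))).2 rfl)
  have hfz : f z ∈ ball (f q) δ := by
    have : (z, f z) ∈ ball (q, f q) δ := hz
    rw [← ball_prod_same] at this
    exact this.2
  have hz0 := eqOn_zero_of_real isOpen_ball (convex_ball _ _).isPreconnected hφ
    (mem_ball_self hδ) him (by
      filter_upwards [ball_mem_nhds _ hδ] with s hs hs0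
      exact (hball _ (hmm s hs)).2.2 (by rw [hfm s hs]; exact hs0)) hfz
  have h00 : (0 : ℂ) = ζ (z, f z) := (hiff _ hz 0 (mem_ball_self hε)).1 (by simp [m])
  simpa [m, ← h00] using hz0

/-- A holomorphic function on a product vanishing on the conjugate diagonal is zero. -/
theorem eq_zero_of_conj_diagonal [StarAddMonoid E] [NormedStarGroup E] [StarModule ℂ E]
    {a : E} {ρ : ℝ} {G : E × E → ℂ} (hG : DifferentiableOn ℂ G (ball a ρ ×ˢ ball (star a) ρ))
    (h : ∀ z ∈ ball a ρ, G (z, star z) = 0) {z w : E} (hz : z ∈ ball a ρ)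
    (hw : w ∈ ball (star a) ρ) : G (z, w) = 0 := by
  set b : E := (1 / 2 : ℂ) • (z + star w) with hb
  set v : E := (1 / (2 * I) : ℂ) • (z - star w) with hv
  have hIv : I • v = (1 / 2 : ℂ) • (z - star w) := by
    rw [hv, smul_smul]
    congr 1
    field_simp
  have hz' : b + I • v = z := by
    rw [hIv, hb, ← smul_add, add_add_sub_cancel, ← two_smul ℂ z, smul_smul]
    norm_num
  have hw'' : b - I • v = star w := by
    rw [hIv, hb, ← smul_sub, add_sub_sub_cancel, ← two_smul ℂ (star w), smul_smul]
    norm_num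
  have hw' : star b + I • star v = w := by
    have := congrArg star hw''
    rw [star_star, star_sub, star_smul I, Complex.star_def, conj_I, neg_smul, sub_neg_eq_add] at this
    exact this
  let m : ℂ → E × E := fun ζ => (b + ζ • v, star b + ζ • star v)
  have hm : Differentiable ℂ m := by fun_prop
  set O := m ⁻¹' (ball a ρ ×ˢ ball (star a) ρ)
  have hO : IsOpen O := (isOpen_ball.prod isOpen_ball).preimage hm.continuous
  have hconv : Convex ℝ O := by
    have h1 : Convex ℝ (ball a ρ ×ˢ ball (star a) ρ) := (convex_ball _ _).prod (convex_ball _ _)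
    intro x hx y hy s t hs ht hst
    have := h1 hx hy hs ht hst
    have he : m (s • x + t • y) = s • m x + t • m y := by
      ext1 <;> simp only [m, Prod.fst_add, Prod.snd_add, Prod.smul_fst, Prod.smul_snd] <;>
        rw [add_smul, smul_assoc, smul_assoc, smul_add, smul_add, add_add_add_comm, ← add_smul,
          hst, one_smul]
    change m _ ∈ ball a ρ ×ˢ ball (star a) ρ
    rwa [he]
  have hI : I ∈ O := by
    change m I ∈ ball a ρ ×ˢ ball (star a) ρ
    simp only [m, hz', hw']
    exact ⟨hz, hw⟩
  have hba : b ∈ ball a ρ := by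
    have hsw : star w ∈ ball a ρ := by
      rw [mem_ball_iff_norm] at hw ⊢
      rwa [← norm_star, star_sub, star_star]
    have := (convex_ball a ρ) hz hsw (a := 1 / 2) (b := 1 / 2) (by norm_num) (by norm_num)
      (by norm_num)
    rw [← smul_add, ← Complex.coe_smul] at this
    simpa [hb] using this
  have hmreal : ∀ ζ : ℂ, ζ.im = 0 → m ζ = (b + ζ • v, star (b + ζ • v)) := by
    intro ζ hζ
    simp only [m, star_add, star_smul, Complex.star_def, Complex.conj_eq_iff_im.2 hζ]
  have h0 : (0 : ℂ) ∈ O := by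
    change m 0 ∈ ball a ρ ×ˢ ball (star a) ρ
    rw [hmreal 0 rfl]
    simp only [zero_smul, add_zero]
    refine ⟨hba, ?_⟩
    rw [mem_ball_iff_norm] at hba ⊢
    rwa [← star_sub, norm_star]
  have := eqOn_zero_of_real hO hconv.isPreconnected (φ := G ∘ m)
    (hG.comp hm.differentiableOn fun _ h => h) h0 rfl (by
      filter_upwards [hO.mem_nhds h0] with ζ hζ hζ0
      have h1 : m ζ ∈ ball a ρ ×ˢ ball (star a) ρ := hζ
      rw [hmreal ζ hζ0] at h1
      rw [Function.comp_apply, hmreal ζ hζ0]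
      exact h _ h1.1) hI
  simpa [m, hz', hw'] using this

end Uniqueness

section RealZeroSets

theorem norm_le_of_re_im {x y : ℂ} (h1 : |x.re| ≤ |y.re|) (h2 : |x.im| ≤ |y.im|) : ‖x‖ ≤ ‖y‖ := by
  rw [Complex.norm_def, Complex.norm_def]
  refine Real.sqrt_le_sqrt ?_
  rw [normSq_apply, normSq_apply]
  have := sq_le_sq.2 h1
  have := sq_le_sq.2 h2
  nlinarith

theorem exists_rolle {f f' : ℝ → ℝ} {t : ℝ} (ht : t ≠ 0)
    (hf : ∀ x ∈ uIcc 0 t, HasDerivAt f (f' x) x) (h0 : f 0 = 0) (h1 : f t = 0) :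
    ∃ x ∈ uIcc 0 t, x ≠ 0 ∧ f' x = 0 := by
  rcases lt_or_gt_of_ne ht with h | h
  · rw [uIcc_of_ge h.le] at hf ⊢
    obtain ⟨x, hx, hx0⟩ := exists_hasDerivAt_eq_zero h
      (fun x hx => (hf x hx).continuousAt.continuousWithinAt) (h1.trans h0.symm)
      (fun x hx => hf x (Ioo_subset_Icc_self hx))
    exact ⟨x, Ioo_subset_Icc_self hx, hx.2.ne, hx0⟩
  · rw [uIcc_of_le h.le] at hf ⊢
    obtain ⟨x, hx, hx0⟩ := exists_hasDerivAt_eq_zero h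
      (fun x hx => (hf x hx).continuousAt.continuousWithinAt) (h0.trans h1.symm)
      (fun x hx => hf x (Ioo_subset_Icc_self hx))
    exact ⟨x, Ioo_subset_Icc_self hx, hx.1.ne', hx0⟩

variable {V : Type*} [NormedAddCommGroup V] [NormedSpace ℂ V] [FiniteDimensional ℂ V]

/-- A real analytic function vanishing on `Im s = 0` has, near some real point, no other zeros. -/
theorem exists_zeros_subset_real {r : V × ℂ → ℝ} {b₀ : V × ℂ} {ρ : ℝ}
    (hr : AnalyticOnNhd ℝ r (ball b₀ ρ)) (hb₀ : b₀.2.im = 0)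
    (hne : ∃ b ∈ ball b₀ ρ, r b ≠ 0) :
    ∃ b₁ ∈ ball b₀ ρ, b₁.2.im = 0 ∧ ∀ᶠ b in 𝓝 b₁, r b = 0 → b.2.im = 0 := by
  classical
  let e : V × ℂ := (0, I)
  let g : ℕ → V × ℂ → ℝ := fun j => Nat.rec r (fun _ φ b => fderiv ℝ φ b e) j
  have hgs : ∀ j b, g (j + 1) b = fderiv ℝ (g j) b e := fun j b => rfl
  have hg : ∀ j, AnalyticOnNhd ℝ (g j) (ball b₀ ρ) := by
    intro j
    induction j with
    | zero => exact hr
    | succ j ih =>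
      exact ((ContinuousLinearMap.apply ℝ ℝ e).comp_analyticOnNhd ih.fderiv)
  have hline : ∀ j (c : V × ℂ) (t : ℝ), c + t • e ∈ ball b₀ ρ →
      HasDerivAt (fun t : ℝ => g j (c + t • e)) (g (j + 1) (c + t • e)) t := by
    intro j c t h
    have h1 : HasDerivAt (fun t : ℝ => c + t • e) e t := by
      simpa using ((hasDerivAt_id t).smul_const e).const_add c
    exact ((hg j _ h).differentiableAt.hasFDerivAt).comp_hasDerivAt t h1
  have hproj : ∀ (b₁ b : V × ℂ) (ε t : ℝ), b₁.2.im = 0 → b ∈ ball b₁ ε → |t| ≤ |b.2.im| →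
      ((b.1, (b.2.re : ℂ)) + t • e : V × ℂ) ∈ ball b₁ ε := by
    intro b₁ b ε t h1 hb ht
    obtain ⟨y₁, s₁⟩ := b₁
    obtain ⟨y, s⟩ := b
    rw [← ball_prod_same] at hb ⊢
    refine ⟨?_, ?_⟩
    · simpa [e] using hb.1
    · have := hb.2
      simp only [mem_ball_iff_norm] at this ⊢
      refine lt_of_le_of_lt (norm_le_of_re_im ?_ ?_) this
      · simp [e]
      · simp only at h1 ht
        simpa [e, h1] using ht
  have hself : ∀ b : V × ℂ, (b.1, (b.2.re : ℂ)) + b.2.im • e = b := by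
    rintro ⟨y, s⟩
    ext1
    · simp [e]
    · simp [e, Complex.re_add_im]
  have hex : ∃ j, ∃ b ∈ ball b₀ ρ, b.2.im = 0 ∧ g j b ≠ 0 := by
    by_contra! hall
    obtain ⟨b, hb, hbne⟩ := hne
    set c : V × ℂ := (b.1, (b.2.re : ℂ)) with hc
    let m : ℝ → V × ℂ := fun t => c + t • e
    have hm : Continuous m := by fun_prop
    set J : Set ℝ := m ⁻¹' ball b₀ ρ
    have hJo : IsOpen J := isOpen_ball.preimage hm
    have hJc : Convex ℝ J := by
      intro x hx y hy s t hs ht hst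
      have := (convex_ball b₀ ρ) hx hy hs ht hst
      have he : m (s • x + t • y) = s • m x + t • m y := by
        simp only [m]
        rw [add_smul, smul_assoc, smul_assoc, smul_add, smul_add, add_add_add_comm, ← add_smul,
          hst, one_smul]
      change m _ ∈ ball b₀ ρ
      rwa [he]
    have h0J : (0 : ℝ) ∈ J := by
      have := hproj b₀ b ρ 0 hb₀ hb (by simp)
      exact this
    have h1J : b.2.im ∈ J := hproj b₀ b ρ b.2.im hb₀ hb le_rfl
    have hφ : AnalyticOnNhd ℝ (fun t => r (m t)) J := fun t ht => by
      have h1 : AnalyticAt ℝ m t := by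
        have : AnalyticAt ℝ (fun t : ℝ => t • e) t :=
          ((ContinuousLinearMap.id ℝ ℝ).smulRight e).analyticAt t
        exact analyticAt_const.add this
      exact AnalyticAt.fun_comp (hr _ ht) h1
    have hit : ∀ i, ∀ t ∈ J, iteratedDeriv i (fun t => r (m t)) t = g i (m t) := by
      intro i
      induction i with
      | zero => intro t _; simp [g]
      | succ i ih =>
        intro t ht
        rw [iteratedDeriv_succ]
        have : iteratedDeriv i (fun t => r (m t)) =ᶠ[𝓝 t] fun t => g i (m t) := by
          filter_upwards [hJo.mem_nhds ht] with t ht using ih t ht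
        rw [this.deriv_eq]
        exact (hline i c t ht).deriv
    have htop : analyticOrderAt (fun t => r (m t)) 0 = ⊤ := by
      refine ENat.eq_top_iff_forall_ge.2 fun n => ?_
      rw [natCast_le_analyticOrderAt_iff_iteratedDeriv_eq_zero (hφ 0 h0J)]
      intro i _
      rw [hit i 0 h0J]
      exact hall i _ h0J (by simp [m, c])
    have hz := hφ.eqOn_zero_of_preconnected_of_eventuallyEq_zero hJc.isPreconnected h0J
      (analyticOrderAt_eq_top.1 htop) h1J
    apply hbne
    rw [← hself b]
    exact hz
  obtain ⟨j, ⟨b₁, hb₁, him, hgb⟩, hmin'⟩ : ∃ j, (∃ b ∈ ball b₀ ρ, b.2.im = 0 ∧ g j b ≠ 0) ∧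
      ∀ i < j, ¬ ∃ b ∈ ball b₀ ρ, b.2.im = 0 ∧ g i b ≠ 0 := by
    obtain ⟨j, hj, hj'⟩ := wellFounded_lt.has_min
      {j | ∃ b ∈ ball b₀ ρ, b.2.im = 0 ∧ g j b ≠ 0} hex
    exact ⟨j, hj, fun i hi h => hj' i h hi⟩
  have hmin : ∀ i < j, ∀ b ∈ ball b₀ ρ, b.2.im = 0 → g i b = 0 := fun i hi b hb hb' => by
    by_contra h
    exact hmin' i hi ⟨b, hb, hb', h⟩
  refine ⟨b₁, hb₁, him, ?_⟩
  have h1 := (hg j b₁ hb₁).continuousAt.eventually_ne hgb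
  obtain ⟨ε, hε, hball⟩ := Metric.eventually_nhds_iff_ball.1 (h1.and (isOpen_ball.mem_nhds hb₁))
  filter_upwards [ball_mem_nhds b₁ hε] with b hb hrb
  by_contra hbim
  have hmemc : ∀ t : ℝ, |t| ≤ |b.2.im| → ((b.1, (b.2.re : ℂ)) + t • e : V × ℂ) ∈ ball b₁ ε :=
    fun t ht => hproj b₁ b ε t him hb ht
  have key : ∀ i ≤ j, ∃ t : ℝ, t ≠ 0 ∧ |t| ≤ |b.2.im| ∧ g i ((b.1, (b.2.re : ℂ)) + t • e) = 0 := by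
    intro i
    induction i with
    | zero => exact fun _ => ⟨b.2.im, hbim, le_rfl, by rw [hself]; exact hrb⟩
    | succ i ih =>
      intro hij
      obtain ⟨t, ht0, ht, hgt⟩ := ih (by omega)
      have habs : ∀ x ∈ uIcc 0 t, |x| ≤ |b.2.im| := fun x hx => by
        have := abs_sub_left_of_mem_uIcc hx
        simp only [sub_zero] at this
        exact this.trans ht
      obtain ⟨x, hx, hx0, hgx⟩ := exists_rolle ht0
        (f := fun t : ℝ => g i ((b.1, (b.2.re : ℂ)) + t • e))
        (fun x hx => hline i _ x (hball _ (hmemc x (habs x hx))).2)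
        (by
          simp only [zero_smul, add_zero]
          refine hmin i (by omega) _ (hball _ ?_).2 (by simp)
          simpa using hmemc 0 (by simp)) hgt
      exact ⟨x, hx0, habs x hx, hgx⟩
  obtain ⟨t, -, ht, hgt⟩ := key j le_rfl
  exact (hball _ (hmemc t ht)).1 hgt

/-- Near `a`, the zero set of `r` is a smooth Levi-flat hypersurface. -/
def GoodPt {E : Type*} [NormedAddCommGroup E] [NormedSpace ℂ E] (r : E → ℝ) (a : E) : Prop :=
  r a = 0 ∧ ∃ τ : E → ℂ, (∀ᶠ z in 𝓝 a, DifferentiableAt ℂ τ z) ∧ fderiv ℂ τ a ≠ 0 ∧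
    ∀ᶠ z in 𝓝 a, r z = 0 ↔ (τ z).im = 0

theorem mem_closure_goodPt {r : V × ℂ → ℝ} {B : Set (V × ℂ)} (hB : IsOpen B)
    (hr : AnalyticOnNhd ℝ r B) {Ω : Set (V × ℂ)} (hΩ : IsOpen Ω) {ξ : V × ℂ → ℂ}
    (hξ : DifferentiableOn ℂ ξ Ω) {b₀ : V × ℂ} (hb₀ : b₀ ∈ Ω) (him : b₀.2.im = 0)
    (hd : fderiv ℂ ξ b₀ (0, 1) ≠ 0) (haB : (b₀.1, ξ b₀) ∈ B)
    (hne : ∃ᶠ z in 𝓝 (b₀.1, ξ b₀), r z ≠ 0)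
    (h0 : ∀ b ∈ Ω, b.2.im = 0 → (b.1, ξ b) ∈ B → r (b.1, ξ b) = 0) :
    (b₀.1, ξ b₀) ∈ closure {a | GoodPt r a} := by
  rw [_root_.mem_closure_iff]
  intro O hO haO
  let Ψ : V × ℂ → V × ℂ := fun b => (b.1, ξ b)
  have hΨ : DifferentiableOn ℂ Ψ Ω := differentiableOn_fst.prodMk hξ
  let m : (V × ℂ) × ℂ → V × ℂ := fun w => (w.1.1, w.2)
  have hm : Differentiable ℂ m := by fun_prop
  have hG : DifferentiableOn ℂ (fun w : (V × ℂ) × ℂ => ξ (m w) - w.1.2) (m ⁻¹' Ω) := by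
    refine DifferentiableOn.sub ?_ (by fun_prop)
    exact hξ.comp hm.differentiableOn fun _ h => h
  obtain ⟨δ, ε, τ, hδ, hε, hτ, hsub, hτm, hiff⟩ := exists_implicit (v₀ := Ψ b₀) (x₀ := b₀.2)
    (hΩ.preimage hm.continuous) hG hb₀ (by simp [m, Ψ]) (by
      have h1 : HasFDerivAt ξ (fderiv ℂ ξ b₀) (m (Ψ b₀, b₀.2)) :=
        (hξ.differentiableAt (hΩ.mem_nhds hb₀)).hasFDerivAt
      have h2 : HasFDerivAt m (((ContinuousLinearMap.fst ℂ V ℂ).comp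
        (ContinuousLinearMap.fst ℂ (V × ℂ) ℂ)).prod (ContinuousLinearMap.snd ℂ (V × ℂ) ℂ))
          (Ψ b₀, b₀.2) := (((ContinuousLinearMap.fst ℂ V ℂ).comp
        (ContinuousLinearMap.fst ℂ (V × ℂ) ℂ)).prod
          (ContinuousLinearMap.snd ℂ (V × ℂ) ℂ)).hasFDerivAt
      have h3 : HasFDerivAt (fun w : (V × ℂ) × ℂ => w.1.2)
        ((ContinuousLinearMap.snd ℂ V ℂ).comp (ContinuousLinearMap.fst ℂ (V × ℂ) ℂ))
        (Ψ b₀, b₀.2) :=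
        ((ContinuousLinearMap.snd ℂ V ℂ).comp (ContinuousLinearMap.fst ℂ (V × ℂ) ℂ)).hasFDerivAt
      have h4 : HasFDerivAt (fun w : (V × ℂ) × ℂ => ξ (m w) - w.1.2) _ (Ψ b₀, b₀.2) :=
        (h1.comp _ h2).sub h3
      rw [h4.fderiv]
      simpa using hd)
  have hΨτ : ∀ z ∈ ball (Ψ b₀) δ, Ψ (z.1, τ z) = z ∧ (z.1, τ z) ∈ Ω := fun z hz => by
    have h1 := (hiff z hz _ (hτm z hz)).2 rfl
    refine ⟨Prod.ext rfl (sub_eq_zero.1 h1), ?_⟩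
    exact hsub (show (z, τ z) ∈ ball (Ψ b₀) δ ×ˢ ball b₀.2 ε from ⟨hz, hτm z hz⟩)
  have hΨc : ContinuousAt Ψ b₀ := (hΨ.differentiableAt (hΩ.mem_nhds hb₀)).continuousAt
  obtain ⟨ρ, hρ, hball⟩ := Metric.mem_nhds_iff.1 (inter_mem (hΩ.mem_nhds hb₀)
    (inter_mem (hΨc.preimage_mem_nhds ((ball_mem_nhds _ hδ)))
    (inter_mem (hΨc.preimage_mem_nhds ((hO.inter hB).mem_nhds ⟨haO, haB⟩)) (ball_mem_nhds b₀ hε))))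
  have hτΨ : ∀ b ∈ ball b₀ ρ, τ (Ψ b) = b.2 := fun b hb => by
    obtain ⟨h1, h2, h3, h4⟩ := hball hb
    refine ((hiff _ h2 b.2 ?_).1 (by simp [m, Ψ])).symm
    rw [← ball_prod_same] at h4
    exact h4.2
  have hinv : ∀ b ∈ ball b₀ ρ, ContinuousAt (fun z : V × ℂ => (z.1, τ z)) (Ψ b) ∧
      ((Ψ b).1, τ (Ψ b)) = b := fun b hb => by
    obtain ⟨h1, h2, h3, h4⟩ := hball hb
    refine ⟨continuousAt_fst.prodMk (hτ.differentiableAt (isOpen_ball.mem_nhds h2)).continuousAt,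
      ?_⟩
    rw [hτΨ b hb]
  have hran : AnalyticOnNhd ℝ (fun b => r (Ψ b)) (ball b₀ ρ) := by
    intro b hb
    obtain ⟨h1, h2, h3, h4⟩ := hball hb
    have : AnalyticAt ℝ Ψ b := (analyticOnNhd_of_differentiableOn hΩ hΨ b h1).restrictScalars
    exact AnalyticAt.fun_comp (hr _ h3.2) this
  have hb₀ρ := mem_ball_self (x := b₀) hρ
  have hnear : ∀ b ∈ ball b₀ ρ, ∀ p : V × ℂ → Prop, (∀ᶠ b' in 𝓝 b, p b') →
      ∀ᶠ z in 𝓝 (Ψ b), p (z.1, τ z) := fun b hb p hp => by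
    have h1 := (hinv b hb).1.tendsto
    rw [(hinv b hb).2] at h1
    exact h1.eventually hp
  obtain ⟨b₁, hb₁, him₁, hev⟩ := exists_zeros_subset_real hran him (by
    obtain ⟨z, hz, hz1, hz2⟩ := (hne.and_eventually
      ((hnear b₀ hb₀ρ _ (ball_mem_nhds b₀ hρ)).and (ball_mem_nhds _ hδ))).exists
    refine ⟨_, hz1, ?_⟩
    rwa [(hΨτ z hz2).1])
  obtain ⟨h1, h2, h3, h4⟩ := hball hb₁
  refine ⟨Ψ b₁, h3.1, h0 _ h1 him₁ h3.2, τ, ?_, fun hd0 => ?_, ?_⟩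
  · filter_upwards [isOpen_ball.mem_nhds h2] with z hz
    exact hτ.differentiableAt (isOpen_ball.mem_nhds hz)
  · have hc1 : HasFDerivAt (fun b => τ (Ψ b)) ((fderiv ℂ τ (Ψ b₁)).comp (fderiv ℂ Ψ b₁)) b₁ :=
      (hτ.differentiableAt (isOpen_ball.mem_nhds h2)).hasFDerivAt.comp _
        (hΨ.differentiableAt (hΩ.mem_nhds h1)).hasFDerivAt
    have hc2 : HasFDerivAt (fun b => τ (Ψ b)) (ContinuousLinearMap.snd ℂ V ℂ) b₁ :=
      (ContinuousLinearMap.snd ℂ V ℂ).hasFDerivAt.congr_of_eventuallyEq (by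
        filter_upwards [isOpen_ball.mem_nhds hb₁] with b hb using hτΨ b hb)
    have := congrArg (fun L : V × ℂ →L[ℂ] ℂ => L (0, 1)) (hc1.unique hc2)
    simp [hd0] at this
  · filter_upwards [hnear b₁ hb₁ _ hev, hnear b₁ hb₁ _ (isOpen_ball.mem_nhds hb₁),
      isOpen_ball.mem_nhds h2] with z hz1 hz2 hz3
    rw [(hΨτ z hz3).1] at hz1
    refine ⟨hz1, fun hz => ?_⟩
    have := h0 _ (hball hz2).1 hz (hball hz2).2.2.1.2
    rwa [show ((z.1, τ z).1, ξ (z.1, τ z)) = z from (hΨτ z hz3).1] at this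

end RealZeroSets

section Transversality

variable {V : Type*} [NormedAddCommGroup V] [NormedSpace ℂ V] [FiniteDimensional ℂ V]
  [StarAddMonoid V] [NormedStarGroup V] [StarModule ℂ V]

theorem DifferentiableOn.star_star' {E F : Type*} [NormedAddCommGroup E] [NormedSpace ℂ E]
    [StarAddMonoid E] [NormedStarGroup E] [StarModule ℂ E] [NormedAddCommGroup F] [NormedSpace ℂ F]
    [StarAddMonoid F] [ContinuousStar F] [StarModule ℂ F] {Ω Ω' : Set E} (hΩ : IsOpen Ω)
    {f : E → F} (hf : DifferentiableOn ℂ f Ω) (h : MapsTo star Ω' Ω) :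
    DifferentiableOn ℂ (fun z => star (f (star z))) Ω' := fun z hz => by
  have := (hf.differentiableAt (hΩ.mem_nhds (h hz))).star_star
  rw [star_star] at this
  exact this.differentiableWithinAt

theorem star_mem_ball {E : Type*} [NormedAddCommGroup E] [StarAddMonoid E] [NormedStarGroup E]
    {a z : E} {ρ : ℝ} : star z ∈ ball a ρ ↔ z ∈ ball (star a) ρ := by
  rw [mem_ball_iff_norm, mem_ball_iff_norm, ← norm_star, star_sub, star_star]

/-- The polydisc of radii `δ`, `1`. -/
def bid (V : Type*) [NormedAddCommGroup V] (δ : ℝ) : Set (V × ℂ) := ball (0 : V) δ ×ˢ ball (0 : ℂ) 1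

theorem isOpen_bid (δ : ℝ) : IsOpen (bid V δ) := isOpen_ball.prod isOpen_ball

theorem star_mem_bid {δ : ℝ} {a : V × ℂ} : star a ∈ bid V δ ↔ a ∈ bid V δ := by
  simp [bid, Set.mem_prod]

/-- The level set of a Levi function has points transverse to the last coordinate. -/
theorem frequently_transverse {δ : ℝ} {S : (V × ℂ) × (V × ℂ) → ℂ}
    (hS : DifferentiableOn ℂ S (bid V δ ×ˢ bid V δ)) {a₀ : V × ℂ} (ha₀ : a₀ ∈ bid V δ)
    {f : V × ℂ → ℂ} (hf : ∀ᶠ z in 𝓝 a₀, DifferentiableAt ℂ f z) (hd : fderiv ℂ f a₀ ≠ 0)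
    (him : (f a₀).im = 0) (hz : ∀ᶠ z in 𝓝 a₀, (f z).im = 0 → S (z, star z) = 0)
    (hne : ∃ X ∈ ball (0 : ℂ) 1, S ((a₀.1, X), star a₀) ≠ 0) :
    ∃ᶠ a in 𝓝 a₀, (f a).im = 0 ∧ fderiv ℂ f a (0, 1) ≠ 0 := by
  intro hcon
  obtain ⟨y₀, X₀⟩ := a₀
  obtain ⟨r, hr, hball⟩ := Metric.eventually_nhds_iff_ball.1 hf
  have hfr : DifferentiableOn ℂ f (ball (y₀, X₀) r) := fun z hz' =>
    (hball z hz').differentiableWithinAt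
  have hg : ∀ᶠ z in 𝓝 (y₀, X₀), fderiv ℂ f z (0, 1) = 0 := by
    refine eventually_eq_zero_of_real_level hf ?_ hd him ?_
    · filter_upwards [ball_mem_nhds (y₀, X₀) hr] with z hz'
      exact (differentiableOn_fderiv_apply isOpen_ball hfr (0, 1)).differentiableAt
        (isOpen_ball.mem_nhds hz')
    · filter_upwards [hcon] with z hz' h1
      by_contra h2
      exact hz' ⟨h1, h2⟩
  obtain ⟨ρ, hρ, hall⟩ := Metric.eventually_nhds_iff_ball.1 (hf.and (hg.and (hz.and
    ((isOpen_bid (V := V) δ).mem_nhds ha₀))))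
  have hsl : ∀ X ∈ ball X₀ ρ, (y₀, X) ∈ ball (y₀, X₀) ρ := fun X hX => by
    rw [← ball_prod_same]
    exact ⟨mem_ball_self hρ, hX⟩
  have hfc : ∀ X ∈ ball X₀ ρ, f (y₀, X) = f (y₀, X₀) := fun X hX => by
    have hder : ∀ W ∈ ball X₀ ρ, HasDerivAt (fun W => f (y₀, W)) 0 W := fun W hW => by
      have h1 : HasDerivAt (fun W : ℂ => (y₀, W)) ((0 : V), (1 : ℂ)) W :=
        (hasDerivAt_const W y₀).prodMk (hasDerivAt_id W)
      have h2 := (hall _ (hsl W hW)).1.hasFDerivAt.comp_hasDerivAt W h1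
      rwa [(hall _ (hsl W hW)).2.1] at h2
    exact isOpen_ball.is_const_of_deriv_eq_zero (convex_ball X₀ ρ).isPreconnected
      (fun W hW => (hder W hW).differentiableAt.differentiableWithinAt)
      (fun W hW => (hder W hW).deriv) hX (mem_ball_self hρ)
  have hy₀ : star y₀ ∈ ball (0 : V) δ := by simpa using ha₀.1
  have hX₁ : ∀ X ∈ ball X₀ ρ, X ∈ ball (0 : ℂ) 1 := fun X hX => (hall _ (hsl X hX)).2.2.2.2
  have hzero : ∀ X ∈ ball X₀ ρ, S ((y₀, X), (star y₀, star X₀)) = 0 := by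
    intro X hX
    refine eq_zero_of_conj_diagonal (a := X₀) (ρ := ρ)
      (G := fun p : ℂ × ℂ => S ((y₀, p.1), (star y₀, p.2))) ?_ ?_ hX (mem_ball_self hρ)
    · have hm : Differentiable ℂ fun p : ℂ × ℂ => ((y₀, p.1), (star y₀, p.2)) := by fun_prop
      refine hS.comp (f := fun p : ℂ × ℂ => ((y₀, p.1), (star y₀, p.2)))
        hm.differentiableOn fun p hp => ⟨⟨ha₀.1, hX₁ _ hp.1⟩, hy₀, ?_⟩
      have := hX₁ _ (star_mem_ball.2 hp.2)
      simpa using this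
    · intro X hX
      refine (hall _ (hsl X hX)).2.2.1 ?_
      rw [hfc X hX]
      exact him
  obtain ⟨X, hX, hXne⟩ := hne
  refine hXne (eqOn_zero_of_eventuallyEq (f := fun X => S ((y₀, X), star (y₀, X₀))) (a := X₀)
    isOpen_ball (convex_ball (0 : ℂ) 1).isPreconnected ?_ ha₀.2 ?_ hX)
  · have hm : Differentiable ℂ fun X : ℂ => ((y₀, X), star (y₀, X₀)) := by fun_prop
    exact hS.comp (f := fun X : ℂ => ((y₀, X), star (y₀, X₀))) hm.differentiableOn
      fun X hX => ⟨⟨ha₀.1, hX⟩, star_mem_bid.2 ha₀⟩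
  · filter_upwards [ball_mem_nhds X₀ hρ] with X hX using hzero X hX

/-- The leaves near a transverse point, as graphs `X = x(y, s)`. -/
theorem exists_leaf_graph {δ : ℝ} {S : (V × ℂ) × (V × ℂ) → ℂ}
    (hS : DifferentiableOn ℂ S (bid V δ ×ˢ bid V δ)) {a₀ : V × ℂ} (ha₀ : a₀ ∈ bid V δ)
    {f : V × ℂ → ℂ} (hf : ∀ᶠ z in 𝓝 a₀, DifferentiableAt ℂ f z)
    (him : (f a₀).im = 0) (hz : ∀ᶠ z in 𝓝 a₀, (f z).im = 0 → S (z, star z) = 0)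
    (hd : fderiv ℂ f a₀ (0, 1) ≠ 0) :
    ∃ (ρ : ℝ) (x : V × ℂ → ℂ), 0 < ρ ∧ DifferentiableOn ℂ x (ball (a₀.1, f a₀) ρ) ∧
      x (a₀.1, f a₀) = a₀.2 ∧ (∀ b ∈ ball (a₀.1, f a₀) ρ, (b.1, x b) ∈ bid V δ) ∧
      (∀ b ∈ ball (a₀.1, f a₀) ρ, fderiv ℂ x b (0, 1) ≠ 0) ∧
      ∀ y ∈ ball a₀.1 ρ, ∀ y' ∈ ball a₀.1 ρ, ∀ s ∈ ball (f a₀) ρ,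
        S ((y, x (y, s)), star (y', x (y', star s))) = 0 := by
  obtain ⟨y₀, X₀⟩ := a₀
  obtain ⟨r, hr, hball⟩ := Metric.eventually_nhds_iff_ball.1 (hf.and (hz.and
    ((isOpen_bid (V := V) δ).mem_nhds ha₀)))
  have hfr : DifferentiableOn ℂ f (ball (y₀, X₀) r) := fun z hz' =>
    (hball z hz').1.differentiableWithinAt
  let m : (V × ℂ) × ℂ → V × ℂ := fun w => (w.1.1, w.2)
  let ml : (V × ℂ) × ℂ →L[ℂ] V × ℂ := ((ContinuousLinearMap.fst ℂ V ℂ).comp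
        (ContinuousLinearMap.fst ℂ (V × ℂ) ℂ)).prod (ContinuousLinearMap.snd ℂ (V × ℂ) ℂ)
  have hm : Differentiable ℂ m := by fun_prop
  have hG : DifferentiableOn ℂ (fun w : (V × ℂ) × ℂ => f (m w) - w.1.2)
      (m ⁻¹' ball (y₀, X₀) r) := by
    refine DifferentiableOn.sub ?_ (by fun_prop)
    exact hfr.comp hm.differentiableOn fun _ h => h
  set t₀ := f (y₀, X₀) with ht₀
  obtain ⟨δ', ε, x, hδ', hε, hx, hsub, hxm, hiff⟩ := exists_implicit (v₀ := (y₀, t₀)) (x₀ := X₀)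
    (isOpen_ball.preimage hm.continuous) hG (mem_ball_self hr) (by simp [m, t₀]) (by
      have h1 : HasFDerivAt f (fderiv ℂ f (y₀, X₀)) (m ((y₀, t₀), X₀)) :=
        (hball _ (mem_ball_self hr)).1.hasFDerivAt
      have h2 : HasFDerivAt m ml ((y₀, t₀), X₀) := ml.hasFDerivAt
      have h3 : HasFDerivAt (fun w : (V × ℂ) × ℂ => w.1.2)
        ((ContinuousLinearMap.snd ℂ V ℂ).comp (ContinuousLinearMap.fst ℂ (V × ℂ) ℂ))
        ((y₀, t₀), X₀) :=
        ((ContinuousLinearMap.snd ℂ V ℂ).comp (ContinuousLinearMap.fst ℂ (V × ℂ) ℂ)).hasFDerivAt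
      have h4 : HasFDerivAt (fun w : (V × ℂ) × ℂ => f (m w) - w.1.2) _ ((y₀, t₀), X₀) :=
        (h1.comp _ h2).sub h3
      rw [h4.fderiv]
      simpa [ml] using hd)
  have hgr : ∀ b ∈ ball (y₀, t₀) δ', f (b.1, x b) = b.2 ∧ (b.1, x b) ∈ ball (y₀, X₀) r :=
    fun b hb => by
      have h1 := (hiff b hb _ (hxm b hb)).2 rfl
      refine ⟨sub_eq_zero.1 h1, ?_⟩
      exact hsub (show (b, x b) ∈ ball (y₀, t₀) δ' ×ˢ ball X₀ ε from ⟨hb, hxm b hb⟩)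
  have hmemb : ∀ y ∈ ball y₀ δ', ∀ s ∈ ball t₀ δ', (y, s) ∈ ball (y₀, t₀) δ' := fun y hy s hs => by
    rw [← ball_prod_same]
    exact ⟨hy, hs⟩
  have hxd : ∀ b ∈ ball (y₀, t₀) δ', HasFDerivAt x (fderiv ℂ x b) b := fun b hb =>
    (hx.differentiableAt (isOpen_ball.mem_nhds hb)).hasFDerivAt
  have ht₀s : star t₀ = t₀ := by
    rw [Complex.star_def, Complex.conj_eq_iff_im]
    exact him
  have hstar : ∀ s ∈ ball t₀ δ', star s ∈ ball t₀ δ' := fun s hs => by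
    rw [star_mem_ball, ht₀s]
    exact hs
  have hzx : DifferentiableOn ℂ (fun b : V × ℂ => (b.1, x b)) (ball (y₀, t₀) δ') :=
    differentiableOn_fst.prodMk hx
  refine ⟨δ', x, hδ', hx, ?_, fun b hb => (hball _ (hgr b hb).2).2.2, ?_, ?_⟩
  · exact ((hiff _ (mem_ball_self hδ') X₀ (mem_ball_self hε)).1 (by simp [m, t₀])).symm
  · intro b hb h0
    have h1 : HasFDerivAt (fun b : V × ℂ => f (b.1, x b))
        ((fderiv ℂ f (b.1, x b)).comp ((ContinuousLinearMap.fst ℂ V ℂ).prod (fderiv ℂ x b))) b :=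
      (hball _ (hgr b hb).2).1.hasFDerivAt.comp b
        ((ContinuousLinearMap.fst ℂ V ℂ).hasFDerivAt.prodMk (hxd b hb))
    have h2 : HasFDerivAt (fun b : V × ℂ => f (b.1, x b)) (ContinuousLinearMap.snd ℂ V ℂ) b :=
      (ContinuousLinearMap.snd ℂ V ℂ).hasFDerivAt.congr_of_eventuallyEq (by
        filter_upwards [isOpen_ball.mem_nhds hb] with b hb using (hgr b hb).1)
    have := congrArg (fun L : V × ℂ →L[ℂ] ℂ => L (0, 1)) (h1.unique h2)
    simp [h0, Prod.mk_zero_zero] at this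
  · intro y hy y' hy'
    have hreal : ∀ s ∈ ball t₀ δ', s.im = 0 → S ((y, x (y, s)), star (y', x (y', star s))) = 0 := by
      intro s hs hs0
      have hss : star s = s := by
        rw [Complex.star_def, Complex.conj_eq_iff_im]
        exact hs0
      have hφ : DifferentiableOn ℂ (fun y => (y, x (y, s))) (ball y₀ δ') :=
        hzx.comp (f := fun y => (y, s)) (by fun_prop) fun y hy => hmemb y hy s hs
      have hψ := DifferentiableOn.star_star' (Ω' := ball (star y₀) δ') isOpen_ball hφ
        (fun w hw => star_mem_ball.2 hw)
      have key := eq_zero_of_conj_diagonal (a := y₀) (ρ := δ') (z := y) (w := star y')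
        (G := fun p : V × V => S ((p.1, x (p.1, s)), star (star p.2, x (star p.2, s)))) ?_ ?_ hy
        (by rw [star_mem_ball, star_star]; exact hy')
      · rw [hss]
        simpa using key
      · refine hS.comp (f := fun p : V × V =>
          ((p.1, x (p.1, s)), star (star p.2, x (star p.2, s)))) (DifferentiableOn.prodMk
          (hφ.comp differentiableOn_fst fun p hp => hp.1)
          (hψ.comp differentiableOn_snd fun p hp => hp.2)) ?_
        rintro p ⟨hp1, hp2⟩
        refine ⟨(hball _ (hgr _ (hmemb _ hp1 s hs)).2).2.2, star_mem_bid.2 ?_⟩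
        exact (hball _ (hgr _ (hmemb _ (star_mem_ball.2 hp2) s hs)).2).2.2
      · intro y hy
        rw [star_star]
        refine (hball _ (hgr _ (hmemb _ hy s hs)).2).2.1 ?_
        rw [(hgr _ (hmemb _ hy s hs)).1]
        exact hs0
    have hφ : DifferentiableOn ℂ (fun s => (y, x (y, s))) (ball t₀ δ') :=
      hzx.comp (f := fun s => (y, s)) (by fun_prop) fun s hs => hmemb y hy s hs
    have hφ' : DifferentiableOn ℂ (fun s => (y', x (y', s))) (ball t₀ δ') :=
      hzx.comp (f := fun s => (y', s)) (by fun_prop) fun s hs => hmemb y' hy' s hs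
    have hψ := DifferentiableOn.star_star' (Ω' := ball t₀ δ') isOpen_ball hφ' hstar
    refine eqOn_zero_of_real (φ := fun s => S ((y, x (y, s)), star (y', x (y', star s))))
      isOpen_ball (convex_ball t₀ δ').isPreconnected ?_ (mem_ball_self hδ') him ?_
    · refine hS.comp (f := fun s => ((y, x (y, s)), star (y', x (y', star s))))
        (hφ.prodMk hψ) ?_
      intro s hs
      refine ⟨(hball _ (hgr _ (hmemb _ hy s hs)).2).2.2, star_mem_bid.2 ?_⟩
      exact (hball _ (hgr _ (hmemb _ hy' _ (hstar s hs))).2).2.2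
    · filter_upwards [ball_mem_nhds t₀ hδ'] with s hs using hreal s hs

end Transversality

section LeafPolynomial

variable {V : Type*} [NormedAddCommGroup V] [NormedSpace ℂ V] [FiniteDimensional ℂ V]

theorem remainder_eq_zero {Ω : Set V} (hΩ : IsOpen Ω) (hc : IsConnected Ω) {Q : (HolRing Ω)[X]}
    (hQ : Q.Monic) (hirr : Irreducible Q) {O : Set V} (hO : IsOpen O) (hne : O.Nonempty)
    (hsub : O ⊆ Ω) {x : V → ℂ} (h1 : ∀ b ∈ O, pe Q (b, x b) = 0) {r : ℕ → V → ℂ}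
    (hr : ∀ j, DifferentiableOn ℂ (r j) Ω)
    (h2 : ∀ b ∈ O, ∑ j ∈ Finset.range Q.natDegree, r j b * x b ^ j = 0) :
    ∀ j < Q.natDegree, ∀ b ∈ Ω, r j b = 0 := by
  have := HolRing.isDomain hΩ hc
  set A : (HolRing Ω)[X] := polyOf Q.natDegree fun j => HolRing.mk (r j) (hr j) with hA
  have hA0 : A = 0 := by
    by_contra hA0
    have hdvd : Q ∣ A := dvd_of_vanish hΩ hc hQ hirr hO hne hsub h1 fun b hb => by
      rw [hA, pe_polyOf _ _ (hsub hb), ← h2 b hb]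
      exact Finset.sum_congr rfl fun j _ => by rw [HolRing.fn_mk (hsub hb)]
    have hdeg := degree_polyOf_lt Q.natDegree fun j => HolRing.mk (r j) (hr j)
    rw [← hA, ← natDegree_lt_iff_degree_lt hA0] at hdeg
    exact not_dvd_of_natDegree_lt hA0 hdeg hdvd
  intro j hj b hb
  have h3 := congrArg (fun P => HolRing.ev ⟨b, hb⟩ (coeff P j)) hA0
  simp only [hA, coeff_polyOf, if_pos hj, coeff_zero, map_zero, HolRing.ev_mk] at h3
  exact h3

variable [StarAddMonoid V] [NormedStarGroup V] [StarModule ℂ V]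

theorem exists_near_power {δ : ℝ} {S : (V × ℂ) × (V × ℂ) → ℂ}
    (hS : DifferentiableOn ℂ S (bid V δ ×ˢ bid V δ)) {M : ℝ}
    (hM : ∀ a ∈ bid V δ, ∀ b ∈ bid V δ, ‖S (a, b)‖ ≤ M) {u : ℂ → ℂ} {c : ℝ} (hc : 0 < c)
    (huc : ∀ X ∈ ball (0 : ℂ) 1, c ≤ ‖u X‖) {C : ℂ} {d : ℕ} {b₀ : V × ℂ}
    (hb₀ : b₀ ∈ bid V δ) {η : ℝ} (hη : 0 < η)
    (hclose : ∀ y ∈ ball (0 : V) δ, ∀ X ∈ ball (0 : ℂ) 1,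
      ‖X ^ d - C * S ((y, X), b₀) / u X‖ ≤ η / 2) :
    ∀ᶠ b in 𝓝 b₀, b ∈ bid V δ ∧ ∀ y ∈ ball (0 : V) δ, ∀ X ∈ ball (0 : ℂ) 1,
      ‖X ^ d - C * S ((y, X), b) / u X‖ ≤ η := by
  obtain ⟨r, hr, hrB⟩ := Metric.isOpen_iff.1 (isOpen_bid (V := V) δ) b₀ hb₀
  have hlim : Tendsto (fun b => ‖C‖ * (2 * M / r * ‖b - b₀‖) / c) (𝓝 b₀) (𝓝 0) := by
    have : Continuous fun b => ‖C‖ * (2 * M / r * ‖b - b₀‖) / c := by fun_prop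
    simpa using this.tendsto b₀
  filter_upwards [hlim.eventually (gt_mem_nhds (half_pos hη)), ball_mem_nhds b₀ hr] with b h1 h2
  refine ⟨hrB h2, fun y hy X hX => ?_⟩
  have ha : (y, X) ∈ bid V δ := ⟨hy, hX⟩
  have hu := hc.trans_le (huc X hX)
  have hdiff : DifferentiableOn ℂ (fun b => S ((y, X), b)) (ball b₀ r) :=
    hS.comp (f := fun b => ((y, X), b)) (by fun_prop) fun b hb => ⟨ha, hrB hb⟩
  have h3 := norm_sub_le_of_bounded (w := b - b₀) hdiff (fun b hb => hM _ ha _ (hrB hb))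
    (mem_ball_iff_norm.1 h2)
  rw [add_sub_cancel] at h3
  have h4 : ‖C * S ((y, X), b) / u X - C * S ((y, X), b₀) / u X‖ ≤ η / 2 := by
    rw [← sub_div, ← mul_sub, norm_div, norm_mul]
    refine le_trans ?_ h1.le
    exact div_le_div₀ (mul_nonneg (norm_nonneg _) ((norm_nonneg _).trans h3))
      (mul_le_mul_of_nonneg_left h3 (norm_nonneg _)) hc (huc X hX)
  calc ‖X ^ d - C * S ((y, X), b) / u X‖
      = ‖(X ^ d - C * S ((y, X), b₀) / u X)
        - (C * S ((y, X), b) / u X - C * S ((y, X), b₀) / u X)‖ := by congr 1; ring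
    _ ≤ _ := norm_sub_le _ _
    _ ≤ η := by linarith [hclose y hy X hX]

/-- The leaf graph is cut out by an irreducible Weierstrass polynomial over a full polydisc. -/
theorem exists_leaf_polynomial {δ : ℝ} {S : (V × ℂ) × (V × ℂ) → ℂ}
    (hS : DifferentiableOn ℂ S (bid V δ ×ˢ bid V δ)) {M : ℝ}
    (hM : ∀ a ∈ bid V δ, ∀ b ∈ bid V δ, ‖S (a, b)‖ ≤ M) {u : ℂ → ℂ} {c : ℝ}
    (hu : DifferentiableOn ℂ u (ball 0 1)) (hc : 0 < c)
    (huc : ∀ X ∈ ball (0 : ℂ) 1, c ≤ ‖u X‖) {C : ℂ} {d : ℕ} {a₀ : V × ℂ}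
    (ha₀ : a₀ ∈ bid V δ)
    (hclose : ∀ y ∈ ball (0 : V) δ, ∀ X ∈ ball (0 : ℂ) 1,
      ‖X ^ d - C * S ((y, X), star a₀) / u X‖ ≤ eta d / 2)
    {t₀ : ℂ} (him : t₀.im = 0) {ρ : ℝ} {x : V × ℂ → ℂ} (hρ : 0 < ρ)
    (hx : DifferentiableOn ℂ x (ball (a₀.1, t₀) ρ)) (hx0 : x (a₀.1, t₀) = a₀.2)
    (hxB : ∀ b ∈ ball (a₀.1, t₀) ρ, (b.1, x b) ∈ bid V δ)
    (hTR : ∀ y ∈ ball a₀.1 ρ, ∀ y' ∈ ball a₀.1 ρ, ∀ s ∈ ball t₀ ρ,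
        S ((y, x (y, s)), star (y', x (y', star s))) = 0) :
    ∃ ε, 0 < ε ∧ ε ≤ ρ ∧ ∃ Q : (HolRing (ball (0 : V) δ ×ˢ ball t₀ ε))[X],
      Irreducible Q ∧ SmallRoots Q ∧ Q.natDegree ≤ d ∧
      ∀ b ∈ ball (a₀.1, t₀) ε, pe Q (b, x b) = 0 := by
  have ht₀ : star t₀ = t₀ := by
    rw [Complex.star_def, Complex.conj_eq_iff_im]
    exact him
  have hstar : ∀ {ε : ℝ}, MapsTo star (ball t₀ ε) (ball t₀ ε) := fun {ε} s hs => by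
    rw [star_mem_ball, ht₀]
    exact hs
  have hslice : DifferentiableOn ℂ (fun s => (a₀.1, x (a₀.1, s))) (ball t₀ ρ) :=
    (differentiableOn_const _).prodMk (hx.comp (f := fun s => (a₀.1, s)) (by fun_prop)
      fun s hs => by
        rw [← ball_prod_same]
        exact ⟨mem_ball_self hρ, hs⟩)
  have hψ : DifferentiableOn ℂ (fun s => star (a₀.1, x (a₀.1, star s))) (ball t₀ ρ) :=
    DifferentiableOn.star_star' isOpen_ball hslice hstar
  have hψ0 : (fun s => star (a₀.1, x (a₀.1, star s))) t₀ = star a₀ := by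
    beta_reduce
    rw [ht₀, hx0]
  have hψc : Tendsto (fun s => star (a₀.1, x (a₀.1, star s))) (𝓝 t₀) (𝓝 (star a₀)) := by
    have := (hψ.differentiableAt (isOpen_ball.mem_nhds (mem_ball_self hρ))).continuousAt.tendsto
    simp only [ht₀, hx0] at this
    exact this
  obtain ⟨ε, hε, hnear⟩ := Metric.eventually_nhds_iff_ball.1 ((hψc.eventually (exists_near_power hS hM
    hc huc (star_mem_bid.2 ha₀) (eta_pos d) hclose)).and (ball_mem_nhds t₀ hρ))
  obtain ⟨ε', hε', hε'ε, hε'ρ⟩ : ∃ ε', 0 < ε' ∧ ε' ≤ ε ∧ ε' ≤ ρ :=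
    ⟨min ε ρ, lt_min hε hρ, min_le_left _ _, min_le_right _ _⟩
  set Ω := ball (0 : V) δ ×ˢ ball t₀ ε' with hΩdef
  have hΩ : IsOpen Ω := isOpen_ball.prod isOpen_ball
  have hsub : ball (a₀.1, t₀) ε' ⊆ Ω := fun b hb => by
    have h1 := (hxB b (ball_subset_ball hε'ρ hb)).1
    rw [← ball_prod_same] at hb
    exact ⟨h1, hb.2⟩
  have hb0 := mem_ball_self (x := (a₀.1, t₀)) hε'
  have hcon : IsConnected Ω := ⟨⟨_, hsub hb0⟩,
    ((convex_ball _ _).prod (convex_ball _ _)).isPreconnected⟩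
  have hdom := HolRing.isDomain hΩ hcon
  let h : (V × ℂ) × ℂ → ℂ := fun w =>
    C * S ((w.1.1, w.2), star (a₀.1, x (a₀.1, star w.1.2))) / u w.2
  obtain ⟨P, hPm, hPd, hPh, hPr⟩ := exists_weierstrass (Ω := Ω) hΩ (h := h) (d := d) (by
      have hS' : DifferentiableOn ℂ (fun w : (V × ℂ) × ℂ =>
          S ((w.1.1, w.2), star (a₀.1, x (a₀.1, star w.1.2)))) (Ω ×ˢ ball 0 1) := by
        refine hS.comp (f := fun w : (V × ℂ) × ℂ =>
          ((w.1.1, w.2), star (a₀.1, x (a₀.1, star w.1.2)))) (DifferentiableOn.prodMk (by fun_prop)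
          (hψ.comp (f := fun w : (V × ℂ) × ℂ => w.1.2) (by fun_prop)
            fun w hw => ball_subset_ball hε'ρ hw.1.2)) ?_
        intro w hw
        exact ⟨⟨hw.1.1, hw.2⟩, (hnear _ (ball_subset_ball hε'ε hw.1.2)).1.1⟩
      have hu' : DifferentiableOn ℂ (fun w : (V × ℂ) × ℂ => u w.2) (Ω ×ˢ ball 0 1) :=
        hu.comp differentiableOn_snd fun w hw => hw.2
      simp only [h, div_eq_mul_inv]
      exact (hS'.const_mul C).mul (hu'.fun_inv fun w hw =>
        norm_pos_iff.1 (hc.trans_le (huc _ hw.2))))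
    (fun b hb X hX => (hnear _ (ball_subset_ball hε'ε hb.2)).1.2 _ hb.1 _ hX)
  have hPS : SmallRoots P := ⟨hPm, by rwa [hPd]⟩
  have hxO : DifferentiableOn ℂ (fun b => (b, x b)) (ball (a₀.1, t₀) ε') :=
    differentiableOn_id.prodMk (hx.mono (ball_subset_ball hε'ρ))
  obtain ⟨Q, hQm, hQirr, hQP, hQx⟩ := exists_irreducible_factor hPm
    (fun A => ∀ b ∈ ball (a₀.1, t₀) ε', pe A (b, x b) = 0)
    (fun h1 => by
      have := h1 _ hb0
      rw [pe_one (hsub hb0)] at this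
      exact one_ne_zero this)
    (fun A B hAB => by
      by_contra! hcon
      obtain ⟨⟨b, hb, hA⟩, ⟨b', hb', hB⟩⟩ := hcon
      have hdA : DifferentiableOn ℂ (fun b => pe A (b, x b)) (ball (a₀.1, t₀) ε') :=
        (differentiableOn_pe A).comp hxO fun b hb => ⟨hsub hb, mem_univ _⟩
      have hdB : DifferentiableOn ℂ (fun b => pe B (b, x b)) (ball (a₀.1, t₀) ε') :=
        (differentiableOn_pe B).comp hxO fun b hb => ⟨hsub hb, mem_univ _⟩
      have hfr := frequently_ne_zero isOpen_ball (convex_ball _ _).isPreconnected hdA hb hA hb'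
      have hBn := (hdB.differentiableAt (isOpen_ball.mem_nhds hb')).continuousAt.eventually_ne hB
      obtain ⟨b'', h1, h2, h3⟩ := (hfr.and_eventually (hBn.and (isOpen_ball.mem_nhds hb'))).exists
      have := hAB b'' h3
      rw [pe_mul _ _ (hsub h3)] at this
      exact (mul_ne_zero h1 h2) this)
    (fun b hb => by
      have hbB := hxB b (ball_subset_ball hε'ρ hb)
      refine hPh b (hsub hb) _ hbB.2 ?_
      have hb' := hb
      rw [← ball_prod_same] at hb'
      have := hTR b.1 (ball_subset_ball hε'ρ hb'.1) a₀.1 (mem_ball_self hρ) b.2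
        (ball_subset_ball hε'ρ hb'.2)
      simp only [h]
      rw [show (b.1, x b) = (b.1, x (b.1, b.2)) from rfl, this]
      simp)
  obtain ⟨h1, h2⟩ := hPS.of_dvd hQm hQP
  exact ⟨ε', hε', hε'ρ, Q, hQirr, h1, h2.trans hPd.le, hQx⟩

/-- Polarization spreads from the leaf graph to all roots of its polynomial. -/
theorem eq_zero_of_roots {δ : ℝ} {S : (V × ℂ) × (V × ℂ) → ℂ}
    (hS : DifferentiableOn ℂ S (bid V δ ×ˢ bid V δ)) {M : ℝ}
    (hM : ∀ a ∈ bid V δ, ∀ b ∈ bid V δ, ‖S (a, b)‖ ≤ M) {a₀ : V × ℂ}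
    {t₀ : ℂ} (him : t₀.im = 0) {ε : ℝ} {x : V × ℂ → ℂ} (hε : 0 < ε)
    (hx : DifferentiableOn ℂ x (ball (a₀.1, t₀) ε))
    (hxB : ∀ b ∈ ball (a₀.1, t₀) ε, (b.1, x b) ∈ bid V δ)
    (hTR : ∀ y ∈ ball a₀.1 ε, ∀ y' ∈ ball a₀.1 ε, ∀ s ∈ ball t₀ ε,
        S ((y, x (y, s)), star (y', x (y', star s))) = 0)
    {Q : (HolRing (ball (0 : V) δ ×ˢ ball t₀ ε))[X]} (hirr : Irreducible Q) (hQ : SmallRoots Q)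
    (hQx : ∀ b ∈ ball (a₀.1, t₀) ε, pe Q (b, x b) = 0) {y y' : V} (hy : y ∈ ball 0 δ)
    (hy' : y' ∈ ball 0 δ) {s : ℂ} (hs : s ∈ ball t₀ ε) {X₁ X₂ : ℂ}
    (h1 : pe Q ((y, s), X₁) = 0) (h2 : pe Q ((y', star s), X₂) = 0) :
    S ((y, X₁), star (y', X₂)) = 0 := by
  have ht₀ : star t₀ = t₀ := by
    rw [Complex.star_def, Complex.conj_eq_iff_im]
    exact him
  have hstar : MapsTo star (ball t₀ ε) (ball t₀ ε) := fun s hs => by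
    rw [star_mem_ball, ht₀]
    exact hs
  have hΩ : IsOpen (ball (0 : V) δ ×ˢ ball t₀ ε) := isOpen_ball.prod isOpen_ball
  have hsub : ball (a₀.1, t₀) ε ⊆ (ball (0 : V) δ ×ˢ ball t₀ ε) := fun b hb => by
    have h1 := (hxB b hb).1
    rw [← ball_prod_same] at hb
    exact ⟨h1, hb.2⟩
  have hb0 := mem_ball_self (x := (a₀.1, t₀)) hε
  have hcon : IsConnected (ball (0 : V) δ ×ˢ ball t₀ ε) := ⟨⟨_, hsub hb0⟩,
    ((convex_ball _ _).prod (convex_ball _ _)).isPreconnected⟩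
  have hX : ∀ b ∈ (ball (0 : V) δ ×ˢ ball t₀ ε), ∀ X, pe Q (b, X) = 0 → X ∈ ball (0 : ℂ) 1 := fun b hb X h => by
    rw [mem_ball_zero_iff]
    linarith [hQ.2 b hb X h, rho_le Q.natDegree]
  obtain ⟨q, r, -, hr, hrb, hdiv⟩ := hQ.exists_division (V' := (V × ℂ) × (V × ℂ))
    (Ω' := (ball (0 : V) δ ×ˢ ball t₀ ε) ×ˢ bid V δ) (φ := Prod.fst) (M := M) (hΩ.prod (isOpen_bid δ)) differentiableOn_fst
    (fun p hp => hp.1) (g := fun w => S ((w.1.1.1, w.2), w.1.2)) (by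
      refine ⟨hS.comp (f := fun w : ((V × ℂ) × (V × ℂ)) × ℂ => ((w.1.1.1, w.2), w.1.2))
        (by fun_prop) fun w hw => ⟨⟨hw.1.1.1, hw.2⟩, hw.1.2⟩, ?_⟩
      exact fun b hb X hX => hM (b.1.1, X) ⟨hb.1.1, hX⟩ b.2 hb.2)
  -- the remainder vanishes on the conjugate graph
  have hstep1 : ∀ j < Q.natDegree, ∀ y' ∈ ball a₀.1 ε, ∀ b ∈ (ball (0 : V) δ ×ˢ ball t₀ ε),
      r j (b, star (y', x (y', star b.2))) = 0 := by
    intro j hj y' hy'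
    have hmem : ∀ s ∈ ball t₀ ε, (y', star s) ∈ ball (a₀.1, t₀) ε := fun s hs => by
      rw [← ball_prod_same]
      exact ⟨hy', hstar hs⟩
    have hslice : DifferentiableOn ℂ (fun s => (y', x (y', s))) (ball t₀ ε) :=
      (differentiableOn_const _).prodMk (hx.comp (f := fun s => (y', s)) (by fun_prop)
        fun s hs => by
          rw [← ball_prod_same]
          exact ⟨hy', hs⟩)
    have hψ : DifferentiableOn ℂ (fun s => star (y', x (y', star s))) (ball t₀ ε) :=
      DifferentiableOn.star_star' isOpen_ball hslice hstar
    have hψB : ∀ s ∈ ball t₀ ε, star (y', x (y', star s)) ∈ bid V δ := fun s hs =>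
      star_mem_bid.2 (hxB _ (hmem s hs))
    refine remainder_eq_zero hΩ hcon hQ.1 hirr isOpen_ball ⟨_, hb0⟩ hsub hQx
      (r := fun j b => r j (b, star (y', x (y', star b.2)))) (fun j => ?_) (fun b hb => ?_) j hj
    · exact (hr j).comp (f := fun b : V × ℂ => (b, star (y', x (y', star b.2))))
        (differentiableOn_id.prodMk (hψ.comp differentiableOn_snd fun b hb => hb.2))
        fun b hb => ⟨hb, hψB _ hb.2⟩
    · have h3 := hdiv (b, star (y', x (y', star b.2))) ⟨hsub hb, hψB _ (hsub hb).2⟩ (x b)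
        (hxB b hb).2
      have hb' := hb
      rw [← ball_prod_same] at hb'
      rw [show S (((b, star (y', x (y', star b.2))).1.1, x b), star (y', x (y', star b.2))) = 0 from
        hTR b.1 hb'.1 y' hy' b.2 hb'.2, show (b, star (y', x (y', star b.2))).1 = b from rfl,
        hQx b hb, zero_mul, zero_add] at h3
      exact h3.symm
  have hb1 : (y, s) ∈ (ball (0 : V) δ ×ˢ ball t₀ ε) := ⟨hy, hs⟩
  have hb2 : (y', star s) ∈ (ball (0 : V) δ ×ˢ ball t₀ ε) := ⟨hy', hstar hs⟩
  -- the remainder vanishes on all conjugate roots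
  have hstep2 : ∀ j < Q.natDegree, r j ((y, s), star (y', X₂)) = 0 := by
    intro j hj
    have hmemB : ∀ w ∈ (ball (0 : V) δ ×ˢ ball t₀ ε) ×ˢ ball (0 : ℂ) 1, star (w.1.1, w.2) ∈ bid V δ := fun w hw =>
      star_mem_bid.2 ⟨hw.1.1, hw.2⟩
    have hgd : DifferentiableOn ℂ
        (fun w : (V × ℂ) × ℂ => star (r j ((y, star w.1.2), star (w.1.1, w.2))))
        ((ball (0 : V) δ ×ˢ ball t₀ ε) ×ˢ ball (0 : ℂ) 1) := by
      have h3 : DifferentiableOn ℂ (fun w : (V × ℂ) × ℂ => r j ((y, w.1.2), (w.1.1, w.2)))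
          ((ball (0 : V) δ ×ˢ ball t₀ ε) ×ˢ ball (0 : ℂ) 1) := (hr j).comp
          (f := fun w : (V × ℂ) × ℂ => ((y, w.1.2), (w.1.1, w.2))) (by fun_prop)
          fun w hw => ⟨⟨hy, hw.1.2⟩, hw.1.1, hw.2⟩
      intro w hw
      have h4 : star w ∈ (ball (0 : V) δ ×ˢ ball t₀ ε) ×ˢ ball (0 : ℂ) 1 := by
        refine ⟨⟨?_, hstar hw.1.2⟩, ?_⟩
        · simpa using hw.1.1
        · simpa using hw.2
      have h5 := (h3.differentiableAt ((hΩ.prod isOpen_ball).mem_nhds h4))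
      have h6 := h5.hasFDerivAt.star_star
      rw [star_star] at h6
      exact h6.differentiableAt.differentiableWithinAt
    have hbd : HolBdd (ball (0 : V) δ ×ˢ ball t₀ ε) (2 ^ (Q.natDegree + 1) * M)
        fun w => star (r j ((y, star w.1.2), star (w.1.1, w.2))) := by
      refine ⟨hgd, fun b hb X hX => ?_⟩
      rw [norm_star]
      exact hrb j hj _ ⟨⟨hy, hstar hb.2⟩, star_mem_bid.2 ⟨hb.1, hX⟩⟩
    obtain ⟨q', r', -, hr', -, hdiv'⟩ := hQ.exists_division hΩ differentiableOn_id
      (mapsTo_id (ball (0 : V) δ ×ˢ ball t₀ ε)) hbd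
    have hr'0 := remainder_eq_zero hΩ hcon hQ.1 hirr isOpen_ball ⟨_, hb0⟩ hsub hQx hr' (by
      intro b hb
      have h3 := hdiv' b (hsub hb) (x b) (hxB b hb).2
      have hb' := hb
      rw [← ball_prod_same] at hb'
      have h4 := hstep1 j hj b.1 hb'.1 (y, star b.2) ⟨hy, hstar hb'.2⟩
      simp only [star_star] at h4
      rw [id, hQx b hb, zero_mul, zero_add, show x b = x (b.1, b.2) from rfl] at h3
      simp only [h4, star_zero] at h3
      exact h3.symm)
    have h3 := hdiv' (y', star s) hb2 X₂ (hX _ hb2 _ h2)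
    rw [id, h2, zero_mul, zero_add, Finset.sum_eq_zero fun i hi => by
      rw [hr'0 i (Finset.mem_range.1 hi) _ hb2, zero_mul]] at h3
    simpa using h3
  have h3 := hdiv ((y, s), star (y', X₂))
    ⟨hb1, star_mem_bid.2 ⟨hy', hX _ hb2 _ h2⟩⟩ X₁ (hX _ hb1 _ h1)
  simp only at h3
  rw [h3, h1, zero_mul, zero_add]
  exact Finset.sum_eq_zero fun i hi => by rw [hstep2 i (Finset.mem_range.1 hi), zero_mul]

end LeafPolynomial

section RootContinuity

theorem exists_isRoot_near {p : ℂ[X]} (hp : p.Monic) (hd : 0 < p.natDegree) (x : ℂ) :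
    ∃ y, p.IsRoot y ∧ ‖x - y‖ ^ p.natDegree ≤ ‖p.eval x‖ := by
  have hs : p.Splits := IsAlgClosed.splits p
  have hcard : Multiset.card p.roots = p.natDegree := hs.natDegree_eq_card_roots.symm
  have hne : p.roots ≠ 0 := fun h => by
    rw [h, Multiset.card_zero] at hcard
    omega
  obtain ⟨y, hy, hmin⟩ := Finset.exists_min_image p.roots.toFinset (fun y => ‖x - y‖)
    (Multiset.toFinset_nonempty.2 hne)
  refine ⟨y, (mem_roots'.1 (Multiset.mem_toFinset.1 hy)).2, ?_⟩
  rw [hs.eval_eq_prod_roots_of_monic hp x, ← hcard]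
  have h1 : ‖(p.roots.map fun a => x - a).prod‖ = (p.roots.map fun a => ‖x - a‖).prod := by
    rw [← coe_nnnorm, ← nnnormHom_apply, map_multiset_prod, Multiset.map_map]
    push_cast
    rw [Multiset.map_map]
    rfl
  rw [h1]
  have h2 := Multiset.prod_map_le_prod_map₀ (s := p.roots) (fun _ => ‖x - y‖)
    (fun a => ‖x - a‖) (fun _ _ => norm_nonneg _)
    (fun a ha => hmin a (Multiset.mem_toFinset.2 ha))
  simpa using h2

variable {V : Type*} [NormedAddCommGroup V] [NormedSpace ℂ V] [FiniteDimensional ℂ V] {Ω : Set V}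

theorem exists_pe_root_near {Q : (HolRing Ω)[X]} (hQ : Q.Monic) (hd : 0 < Q.natDegree) {z : V}
    (hz : z ∈ Ω) (x : ℂ) : ∃ y, pe Q (z, y) = 0 ∧ ‖x - y‖ ^ Q.natDegree ≤ ‖pe Q (z, x)‖ := by
  obtain ⟨y, hy, h⟩ := exists_isRoot_near (hQ.map (HolRing.ev ⟨z, hz⟩))
    (by rwa [hQ.natDegree_map]) x
  rw [hQ.natDegree_map, ← pe_eq] at h
  exact ⟨y, by rw [pe_eq Q hz]; exact hy, h⟩

theorem natDegree_pos_of_root {Q : (HolRing Ω)[X]} (hQ : Q.Monic) {z : V} (hz : z ∈ Ω) {x : ℂ}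
    (h : pe Q (z, x) = 0) : 0 < Q.natDegree := by
  rw [Nat.pos_iff_ne_zero]
  intro h0
  rw [hQ.natDegree_eq_zero.1 h0, pe_one hz] at h
  exact one_ne_zero h

theorem fderiv_pe_snd (hΩ : IsOpen Ω) (Q : (HolRing Ω)[X]) {z : V} (hz : z ∈ Ω) (x : ℂ) :
    fderiv ℂ (pe Q) (z, x) (0, 1) = pe (derivative Q) (z, x) := by
  have h1 : HasDerivAt (fun x : ℂ => (z, x)) (0, 1) x :=
    (hasDerivAt_const x z).prodMk (hasDerivAt_id x)
  have h2 := ((differentiableOn_pe Q).differentiableAt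
    ((hΩ.prod isOpen_univ).mem_nhds (show (z, x) ∈ Ω ×ˢ univ from ⟨hz, mem_univ _⟩))).hasFDerivAt
  have h3 := h2.comp_hasDerivAt x h1
  have h4 := (Q.map (HolRing.ev ⟨z, hz⟩)).hasDerivAt x
  rw [h3.unique (h4.congr_of_eventuallyEq (Eventually.of_forall fun x => pe_eq Q hz x)),
    pe_eq _ hz, derivative_map]

/-- Coefficientwise derivative of a monic polynomial in a direction of the base. -/
def dirDeriv (hΩ : IsOpen Ω) (Q : (HolRing Ω)[X]) (w : V) : (HolRing Ω)[X] :=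
  polyOf Q.natDegree fun i => HolRing.mk (fun z => fderiv ℂ (Q.coeff i).fn z w)
    (differentiableOn_fderiv_apply hΩ (Q.coeff i).differentiableOn_fn w)

theorem fderiv_pe_fst (hΩ : IsOpen Ω) {Q : (HolRing Ω)[X]} (hQ : Q.Monic) {z : V} (hz : z ∈ Ω)
    (w : V) (x : ℂ) : fderiv ℂ (pe Q) (z, x) (w, 0) = pe (dirDeriv hΩ Q w) (z, x) := by
  have h1 : HasFDerivAt (fun z : V => (z, x)) (ContinuousLinearMap.inl ℂ V ℂ) z :=
    hasFDerivAt_prodMk_left z x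
  have h2 := ((differentiableOn_pe Q).differentiableAt
    ((hΩ.prod isOpen_univ).mem_nhds (show (z, x) ∈ Ω ×ˢ univ from ⟨hz, mem_univ _⟩))).hasFDerivAt
  have h3 := h2.comp z h1
  have h4 : HasFDerivAt (fun z => ∑ i ∈ Finset.range (Q.natDegree + 1),
      (Q.coeff i).fn z * x ^ i) (∑ i ∈ Finset.range (Q.natDegree + 1),
      x ^ i • fderiv ℂ (Q.coeff i).fn z) z := HasFDerivAt.fun_sum fun i _ =>
    ((Q.coeff i).differentiableOn_fn.differentiableAt (hΩ.mem_nhds hz)).hasFDerivAt.mul_const _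
  have h5 : fderiv ℂ (Q.coeff Q.natDegree).fn z = 0 := by
    have : (Q.coeff Q.natDegree).fn =ᶠ[𝓝 z] fun _ => 1 := by
      filter_upwards [hΩ.mem_nhds hz] with b hb
      rw [hQ.coeff_natDegree, ← HolRing.ev_eq ⟨b, hb⟩, map_one]
    rw [this.fderiv_eq]
    simp
  have h6 := congrArg (fun L : V →L[ℂ] ℂ => L w) (h3.unique h4)
  simp only [ContinuousLinearMap.comp_apply, ContinuousLinearMap.inl_apply] at h6
  have h7 : ∀ i, (x ^ i • fderiv ℂ (Q.coeff i).fn z) w = fderiv ℂ (Q.coeff i).fn z w * x ^ i :=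
    fun i => by rw [_root_.smul_apply, smul_eq_mul, mul_comm]
  rw [h6, dirDeriv, pe_polyOf _ _ hz, _root_.sum_apply, Finset.sum_range_succ, h7, h5,
    _root_.zero_apply, zero_mul, add_zero]
  exact Finset.sum_congr rfl fun i _ => by rw [h7, HolRing.fn_mk hz]

/-- Differentiating along a graph of roots. -/
theorem pe_derivative_graph (hΩ : IsOpen Ω) {Q : (HolRing Ω)[X]} (hQ : Q.Monic) {O : Set V}
    (hO : IsOpen O) (hsub : O ⊆ Ω) {x : V → ℂ} (hx : DifferentiableOn ℂ x O)
    (h : ∀ b ∈ O, pe Q (b, x b) = 0) {b : V} (hb : b ∈ O) (w : V) :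
    pe (dirDeriv hΩ Q w) (b, x b) + fderiv ℂ x b w * pe (derivative Q) (b, x b) = 0 := by
  have h1 : HasFDerivAt (fun b => (b, x b)) ((ContinuousLinearMap.id ℂ V).prod (fderiv ℂ x b)) b :=
    (hasFDerivAt_id b).prodMk (hx.differentiableAt (hO.mem_nhds hb)).hasFDerivAt
  have h2 := ((differentiableOn_pe Q).differentiableAt ((hΩ.prod isOpen_univ).mem_nhds
    (show (b, x b) ∈ Ω ×ˢ univ from ⟨hsub hb, mem_univ _⟩))).hasFDerivAt
  have h3 := h2.comp b h1
  have h4 : HasFDerivAt (pe Q ∘ fun b => (b, x b)) (0 : V →L[ℂ] ℂ) b :=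
    (hasFDerivAt_const (0 : ℂ) b).congr_of_eventuallyEq (by
      filter_upwards [hO.mem_nhds hb] with b hb using h b hb)
  have h5 := congrArg (fun L : V →L[ℂ] ℂ => L w) (h3.unique h4)
  simp only [ContinuousLinearMap.comp_apply, ContinuousLinearMap.prod_apply,
    ContinuousLinearMap.id_apply, _root_.zero_apply] at h5
  rw [← fderiv_pe_fst hΩ hQ (hsub hb), ← fderiv_pe_snd hΩ Q (hsub hb), ← smul_eq_mul, ← map_smul,
    ← map_add]
  simpa using h5

/-- A root with nondegenerate dependence on the parameter lies in the closure of good points. -/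
theorem mem_closure_goodPt_of_regular {U : Type*} [NormedAddCommGroup U] [NormedSpace ℂ U]
    [FiniteDimensional ℂ U] {Ω : Set (U × ℂ)} (hΩ : IsOpen Ω) {r : U × ℂ → ℝ} {B : Set (U × ℂ)}
    (hB : IsOpen B) (hr : AnalyticOnNhd ℝ r B) (hne : ∀ a ∈ B, ∃ᶠ z in 𝓝 a, r z ≠ 0)
    {Q : (HolRing Ω)[X]} (hQ : Q.Monic)
    (hzero : ∀ b ∈ Ω, b.2.im = 0 → ∀ X, pe Q (b, X) = 0 → (b.1, X) ∈ B → r (b.1, X) = 0)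
    {b : U × ℂ} (hb : b ∈ Ω) (him : b.2.im = 0) {X : ℂ} (hX : pe Q (b, X) = 0)
    (hXB : (b.1, X) ∈ B) (h1 : pe (derivative Q) (b, X) ≠ 0)
    (h2 : pe (dirDeriv hΩ Q (0, 1)) (b, X) ≠ 0) :
    (b.1, X) ∈ closure {a | GoodPt r a} := by
  obtain ⟨δ, ε, ξ, hδ, hε, hξ, hsub, hξm, hiff⟩ := exists_implicit (hΩ.prod isOpen_univ)
    (differentiableOn_pe Q) (v₀ := b) (x₀ := X) ⟨hb, mem_univ _⟩ hX
    (by rwa [fderiv_pe_snd hΩ Q hb])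
  have hbδ := mem_ball_self (x := b) hδ
  have hξb : ξ b = X := ((hiff b hbδ X (mem_ball_self hε)).1 hX).symm
  have hsub' : ball b δ ⊆ Ω := fun v hv => (hsub (show (v, X) ∈ _ from ⟨hv, mem_ball_self hε⟩)).1
  have hroot : ∀ v ∈ ball b δ, pe Q (v, ξ v) = 0 := fun v hv => (hiff v hv _ (hξm v hv)).2 rfl
  rw [← hξb]
  refine mem_closure_goodPt hB hr isOpen_ball hξ hbδ him (fun h => h2 ?_) (by rwa [hξb])
    (hne _ (by rwa [hξb])) fun v hv hvim hvB => hzero v (hsub' hv) hvim _ (hroot v hv) hvB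
  have h3 := pe_derivative_graph hΩ hQ isOpen_ball hsub' hξ hroot hbδ (0, 1)
  rwa [h, zero_mul, add_zero, hξb] at h3

/-- Every root over a real parameter lies in the closure of good points. -/
theorem mem_closure_goodPt_of_root {U : Type*} [NormedAddCommGroup U] [NormedSpace ℂ U]
    [FiniteDimensional ℂ U] {Ω : Set (U × ℂ)} (hΩ : IsOpen Ω) (hc : IsConnected Ω)
    {r : U × ℂ → ℝ} {B : Set (U × ℂ)}
    (hB : IsOpen B) (hr : AnalyticOnNhd ℝ r B) (hne : ∀ a ∈ B, ∃ᶠ z in 𝓝 a, r z ≠ 0)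
    {Q : (HolRing Ω)[X]} (hQ : Q.Monic) (hirr : Irreducible Q)
    (hroots : ∀ b ∈ Ω, ∀ X, pe Q (b, X) = 0 → (b.1, X) ∈ B)
    (hzero : ∀ b ∈ Ω, b.2.im = 0 → ∀ X, pe Q (b, X) = 0 → r (b.1, X) = 0)
    {O : Set (U × ℂ)} (hO : IsOpen O) (hOne : O.Nonempty) (hsub : O ⊆ Ω) {x : U × ℂ → ℂ}
    (hx : DifferentiableOn ℂ x O) (hdx : ∀ b ∈ O, fderiv ℂ x b (0, 1) ≠ 0)
    (hQx : ∀ b ∈ O, pe Q (b, x b) = 0)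
    {b : U × ℂ} (hb : b ∈ Ω) (him : b.2.im = 0) {X : ℂ} (hX : pe Q (b, X) = 0) :
    (b.1, X) ∈ closure {a | GoodPt r a} := by
  have hchar := HolRing.charZero hc.nonempty
  have hdom := HolRing.isDomain hΩ hc
  have hdvd1 : ¬ Q ∣ derivative Q := not_dvd_derivative hQ hirr
  have hdvd2 : ¬ Q ∣ dirDeriv hΩ Q (0, 1) := fun ⟨A, hA⟩ => hdvd1 <|
    dvd_of_vanish hΩ hc hQ hirr hO hOne hsub hQx fun v hv => by
      have h3 := pe_derivative_graph hΩ hQ hO hsub hx hQx hv (0, 1)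
      rw [hA, pe_mul _ _ (hsub hv), hQx v hv, zero_mul, zero_add] at h3
      exact (mul_eq_zero.1 h3).resolve_left (hdx v hv)
  obtain ⟨-, -, γ₁, hγ₁, -, h1⟩ := exists_bezout_pe hΩ hc hQ hirr hdvd1
  obtain ⟨-, -, γ₂, hγ₂, -, h2⟩ := exists_bezout_pe hΩ hc hQ hirr hdvd2
  have hfr : ∃ᶠ v in 𝓝 b, v.2.im = 0 ∧ (γ₁ * γ₂).fn v ≠ 0 := by
    intro hev
    refine HolRing.frequently_fn_ne_zero hΩ hc.isPreconnected (mul_ne_zero hγ₁ hγ₂) hb ?_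
    have hd : ∀ᶠ z in 𝓝 b, DifferentiableAt ℂ (γ₁ * γ₂).fn z := by
      filter_upwards [hΩ.mem_nhds hb] with z hz
      exact (γ₁ * γ₂).differentiableOn_fn.differentiableAt (hΩ.mem_nhds hz)
    have := eventually_eq_zero_of_real_level (f := Prod.snd) (Eventually.of_forall fun z =>
      differentiableAt_snd) hd (q := b) (fun h => by
        rw [fderiv_snd] at h
        have := congrArg (fun L : U × ℂ →L[ℂ] ℂ => L (0, 1)) h
        simp at this) him (hev.mono fun z hz him => by
          by_contra h
          exact hz ⟨him, h⟩)
    exact this.mono fun z hz => not_not_intro hz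
  have he := natDegree_pos_of_root hQ hb hX
  rw [← closure_closure, Metric.mem_closure_iff]
  intro η hη
  have hcont : Tendsto (fun v => pe Q (v, X)) (𝓝 b) (𝓝 0) := by
    have h3 := ((differentiableOn_pe Q).differentiableAt ((hΩ.prod isOpen_univ).mem_nhds
      (show (b, X) ∈ Ω ×ˢ univ from ⟨hb, mem_univ _⟩))).continuousAt
    have h4 : ContinuousAt (fun v => pe Q (v, X)) b :=
      h3.comp (f := fun v => (v, X)) (by fun_prop)
    have := h4.tendsto
    rwa [hX] at this
  have hfst : Tendsto (fun v : U × ℂ => v.1) (𝓝 b) (𝓝 b.1) := continuous_fst.tendsto b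
  obtain ⟨v, ⟨hvim, hvγ⟩, hvX, hvb, hvΩ⟩ := (hfr.and_eventually
    ((hcont.eventually (ball_mem_nhds 0 (pow_pos hη Q.natDegree))).and
      ((hfst.eventually (ball_mem_nhds b.1 hη)).and (hΩ.mem_nhds hb)))).exists
  obtain ⟨X', hX', hle⟩ := exists_pe_root_near hQ he hvΩ X
  have hγ : γ₁.fn v ≠ 0 ∧ γ₂.fn v ≠ 0 := by
    rw [← HolRing.ev_eq ⟨v, hvΩ⟩, map_mul, HolRing.ev_eq, HolRing.ev_eq] at hvγ
    exact mul_ne_zero_iff.1 hvγ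
  refine ⟨(v.1, X'), ?_, ?_⟩
  · exact mem_closure_goodPt_of_regular hΩ hB hr hne hQ
      (fun b hb him X h _ => hzero b hb him X h) hvΩ hvim hX' (hroots v hvΩ X' hX')
      (fun h => hγ.1 (h1 v hvΩ X' hX' h)) fun h => hγ.2 (h2 v hvΩ X' hX' h)
  · rw [Prod.dist_eq, max_lt_iff]
    refine ⟨by rw [dist_comm]; exact hvb, ?_⟩
    rw [dist_eq_norm]
    exact lt_of_pow_lt_pow_left₀ _ hη.le (hle.trans_lt (mem_ball_zero_iff.1 hvX))

end RootContinuity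

section Leaf

variable {V : Type*} [NormedAddCommGroup V] [NormedSpace ℂ V] [FiniteDimensional ℂ V]

/-- Freezing the parameter in a monic polynomial with a parameter. -/
theorem exists_restrict {Δ : Set V} {Ω : Set (V × ℂ)} (hne : Δ.Nonempty) {Q : (HolRing Ω)[X]}
    (hQ : Q.Monic) {t₀ : ℂ} (h : ∀ y ∈ Δ, (y, t₀) ∈ Ω) :
    ∃ P : (HolRing Δ)[X], P.Monic ∧ P.natDegree = Q.natDegree ∧
      ∀ y ∈ Δ, ∀ x, pe P (y, x) = pe Q ((y, t₀), x) := by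
  have := HolRing.charZero hne
  have hnt : Nontrivial (HolRing Δ) := inferInstance
  have hd : ∀ i, DifferentiableOn ℂ (fun y => (Q.coeff i).fn (y, t₀)) Δ := fun i =>
    (Q.coeff i).differentiableOn_fn.comp (f := fun y => (y, t₀)) (by fun_prop) h
  have hlt := degree_polyOf_lt Q.natDegree fun i => HolRing.mk _ (hd i)
  refine ⟨X ^ Q.natDegree + polyOf Q.natDegree fun i => HolRing.mk _ (hd i),
    monic_X_pow_add hlt, ?_, fun y hy x => ?_⟩
  · rw [natDegree_add_eq_left_of_degree_lt, natDegree_X_pow]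
    rwa [degree_X_pow]
  · rw [pe_add _ _ hy, pe_X_pow _ hy, pe_polyOf _ _ hy, pe, Finset.sum_range_succ, add_comm]
    congr 1
    · exact Finset.sum_congr rfl fun i _ => by rw [HolRing.fn_mk hy]
    · rw [hQ.coeff_natDegree, ← HolRing.ev_eq ⟨_, h y hy⟩, map_one, one_mul]

variable [StarAddMonoid V] [NormedStarGroup V] [StarModule ℂ V]

theorem exists_leaf {δ : ℝ} {S : (V × ℂ) × (V × ℂ) → ℂ}
    (hS : DifferentiableOn ℂ S (bid V δ ×ˢ bid V δ)) {M : ℝ}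
    (hM : ∀ a ∈ bid V δ, ∀ b ∈ bid V δ, ‖S (a, b)‖ ≤ M) {r : V × ℂ → ℝ}
    (hr : AnalyticOnNhd ℝ r (bid V δ)) (hrS : ∀ a ∈ bid V δ, S (a, star a) = r a)
    (hrne : ∀ a ∈ bid V δ, ∃ᶠ z in 𝓝 a, r z ≠ 0) {u : ℂ → ℂ} {c : ℝ}
    (hu : DifferentiableOn ℂ u (ball 0 1)) (hc : 0 < c)
    (huc : ∀ X ∈ ball (0 : ℂ) 1, c ≤ ‖u X‖) {C : ℂ} {d : ℕ} {a₀ : V × ℂ} (ha₀ : a₀ ∈ bid V δ)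
    (hclose : ∀ y ∈ ball (0 : V) δ, ∀ X ∈ ball (0 : ℂ) 1,
      ‖X ^ d - C * S ((y, X), star a₀) / u X‖ ≤ eta d / 2 / 2)
    {f : V × ℂ → ℂ} (hf : ∀ᶠ z in 𝓝 a₀, DifferentiableAt ℂ f z) (hd : fderiv ℂ f a₀ ≠ 0)
    (him : (f a₀).im = 0) (hlev : ∀ᶠ z in 𝓝 a₀, (f z).im = 0 → r z = 0) {η : ℝ} (hη : 0 < η) :
    ∃ Q : (HolRing (ball (0 : V) δ))[X], SmallRoots Q ∧ Q.natDegree ≤ d ∧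
      (∀ y ∈ ball (0 : V) δ, ∀ X, pe Q (y, X) = 0 → (y, X) ∈ closure {a | GoodPt r a}) ∧
      ∃ a ∈ bid V δ, dist a a₀ < η ∧ pe Q a = 0 := by
  have hB := isOpen_bid (V := V) δ
  have hδ : 0 < δ := (norm_nonneg _).trans_lt (mem_ball_zero_iff.1 ha₀.1)
  have hlevS : ∀ᶠ z in 𝓝 a₀, (f z).im = 0 → S (z, star z) = 0 := by
    filter_upwards [hlev, hB.mem_nhds ha₀] with z hz hzB h0
    rw [hrS z hzB, hz h0, ofReal_zero]
  have hne : ∃ X ∈ ball (0 : ℂ) 1, S ((a₀.1, X), star a₀) ≠ 0 := by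
    have hX : (1 / 2 : ℂ) ∈ ball (0 : ℂ) 1 := by
      rw [mem_ball_zero_iff]
      norm_num
    refine ⟨1 / 2, hX, fun h0 => ?_⟩
    have h1 := hclose a₀.1 ha₀.1 _ hX
    rw [h0, mul_zero, zero_div, sub_zero, norm_pow] at h1
    have h2 := eta_le d
    have h3 : ‖(1 / 2 : ℂ)‖ = 1 / 2 := by norm_num
    have h4 : (0 : ℝ) < (1 / 2) ^ d := by positivity
    rw [h3] at h1
    rw [pow_succ] at h2
    linarith
  have hnear := exists_near_power hS hM hc huc (star_mem_bid.2 ha₀) (half_pos (eta_pos d)) hclose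
  have hstar : Tendsto (star : V × ℂ → V × ℂ) (𝓝 a₀) (𝓝 (star a₀)) :=
    continuous_star.tendsto a₀
  obtain ⟨a, ⟨haim, had⟩, ⟨-, hacl⟩, haB, haη, haf, halev⟩ :=
    ((frequently_transverse hS ha₀ hf hd him hlevS hne).and_eventually
      ((hstar.eventually hnear).and ((hB.eventually_mem ha₀).and ((isOpen_ball.eventually_mem (mem_ball_self hη)).and
        (hf.eventually_nhds.and hlevS.eventually_nhds))))).exists
  obtain ⟨ρ, x, hρ, hx, hx0, hxB, hxd, hTR⟩ := exists_leaf_graph hS haB haf haim halev had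
  obtain ⟨ε, hε, hερ, Q, hirr, hQ, hQd, hQx⟩ := exists_leaf_polynomial hS hM hu hc huc haB hacl haim
    hρ hx hx0 hxB hTR
  have hballs : ∀ b ∈ ball (a.1, f a) ε, b ∈ ball (a.1, f a) ρ := fun b hb =>
    ball_subset_ball hερ hb
  have hsub : ball (a.1, f a) ε ⊆ ball (0 : V) δ ×ˢ ball (f a) ε := fun b hb => by
    have h1 := (hxB b (hballs b hb)).1
    rw [← ball_prod_same] at hb
    exact ⟨h1, hb.2⟩
  have hΩ : IsOpen (ball (0 : V) δ ×ˢ ball (f a) ε) := isOpen_ball.prod isOpen_ball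
  have hb0 := mem_ball_self (x := (a.1, f a)) hε
  have hcon : IsConnected (ball (0 : V) δ ×ˢ ball (f a) ε) := ⟨⟨_, hsub hb0⟩,
    ((convex_ball _ _).prod (convex_ball _ _)).isPreconnected⟩
  have hroots : ∀ b ∈ ball (0 : V) δ ×ˢ ball (f a) ε, ∀ X, pe Q (b, X) = 0 →
      (b.1, X) ∈ bid V δ := fun b hb X h => ⟨hb.1, by
    rw [mem_ball_zero_iff]
    linarith [hQ.2 b hb X h, rho_le Q.natDegree]⟩
  have hzero : ∀ b ∈ ball (0 : V) δ ×ˢ ball (f a) ε, b.2.im = 0 → ∀ X, pe Q (b, X) = 0 →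
      r (b.1, X) = 0 := fun b hb hbim X h => by
    have hs : star b.2 = b.2 := by
      rw [Complex.star_def, Complex.conj_eq_iff_im]
      exact hbim
    have h1 := eq_zero_of_roots hS hM haim hε (hx.mono (ball_subset_ball hερ))
      (fun b hb => hxB b (hballs b hb)) (fun y hy y' hy' s hs => hTR y (ball_subset_ball hερ hy) y'
        (ball_subset_ball hερ hy') s (ball_subset_ball hερ hs)) hirr hQ hQx hb.1 hb.1 hb.2 h
        (X₂ := X) (by rw [hs]; exact h)
    rw [hrS _ (hroots b hb X h)] at h1
    exact_mod_cast h1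
  have hmem : ∀ y ∈ ball (0 : V) δ, (y, f a) ∈ ball (0 : V) δ ×ˢ ball (f a) ε := fun y hy =>
    ⟨hy, mem_ball_self hε⟩
  obtain ⟨P, hPm, hPd, hP⟩ := exists_restrict ⟨0, mem_ball_self hδ⟩ hQ.1 hmem
  refine ⟨P, ⟨hPm, fun y hy X h => ?_⟩, by rwa [hPd], fun y hy X h => ?_, a, haB, haη, ?_⟩
  · rw [hPd]
    exact hQ.2 _ (hmem y hy) X (by rwa [← hP y hy])
  · exact mem_closure_goodPt_of_root hΩ hcon hB hr hrne hQ.1 hirr hroots hzero isOpen_ball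
      ⟨_, hb0⟩ hsub (hx.mono (ball_subset_ball hερ)) (fun b hb => hxd b (hballs b hb)) hQx
      (hmem y hy) haim (by rwa [← hP y hy])
  · rw [show a = (a.1, a.2) from rfl, hP _ haB.1, ← hx0]
    exact hQx _ hb0

end Leaf

section Limit

variable {V : Type*} [NormedAddCommGroup V] [NormedSpace ℂ V] [FiniteDimensional ℂ V]

/-- Polynomials with small roots form a normal family, and roots converge to roots. -/
theorem exists_limit_polynomial {δ : ℝ} {K : Set (V × ℂ)} (hK : IsClosed K) {d : ℕ} {a₀ : V × ℂ}
    (ha₀ : a₀ ∈ bid V δ)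
    (h : ∀ η > 0, ∃ Q : (HolRing (ball (0 : V) δ))[X], SmallRoots Q ∧ Q.natDegree ≤ d ∧
      (∀ y ∈ ball (0 : V) δ, ∀ x, pe Q (y, x) = 0 → (y, x) ∈ K) ∧
      ∃ a ∈ bid V δ, dist a a₀ < η ∧ pe Q a = 0) :
    ∃ Q : (HolRing (ball (0 : V) δ))[X], Q.Monic ∧
      (∀ y ∈ ball (0 : V) δ, ∀ x, pe Q (y, x) = 0 → (y, x) ∈ K ∧ ‖x‖ < 1) ∧ pe Q a₀ = 0 := by
  choose! q hq hqd hqK a haB had hqa using h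
  let η : ℕ → ℝ := fun k => 1 / (k + 1)
  have hη : ∀ k, 0 < η k := fun k => by positivity
  let 𝒰 : Ultrafilter ℕ := hyperfilter ℕ
  have h𝒰 : (𝒰 : Filter ℕ) ≤ atTop := Nat.hyperfilter_le_atTop
  obtain ⟨e, he⟩ : ∃ e, ∀ᶠ k in (𝒰 : Filter ℕ), (q (η k)).natDegree = e := by
    have h1 : ∀ᶠ k in (𝒰 : Filter ℕ), ∃ e ∈ Iic d, (q (η k)).natDegree = e :=
      Eventually.of_forall fun k => ⟨_, hqd _ (hη k), rfl⟩
    obtain ⟨e, -, he⟩ := (Ultrafilter.eventually_exists_mem_iff (finite_Iic d)).1 h1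
    exact ⟨e, he⟩
  have hbd : ∀ i < e, ∀ᶠ k in (𝒰 : Filter ℕ), ∀ y ∈ ball (0 : V) δ,
      ‖((q (η k)).coeff i).fn y‖ ≤ rho e * 2 ^ e := fun i hi => he.mono fun k hk y hy => by
    rw [← hk]
    exact (hq _ (hη k)).norm_coeff_le hy (by rwa [hk])
  have hlim : ∀ i y, ∃ l : ℂ, i < e → y ∈ ball (0 : V) δ →
      Tendsto (fun k => ((q (η k)).coeff i).fn y) 𝒰 (𝓝 l) := by
    intro i y
    by_cases hiy : i < e ∧ y ∈ ball (0 : V) δ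
    · have h1 := (isCompact_closedBall (0 : ℂ) (rho e * 2 ^ e)).ultrafilter_le_nhds
        (𝒰.map fun k => ((q (η k)).coeff i).fn y) (by
          rw [le_principal_iff, Ultrafilter.mem_coe, Ultrafilter.mem_map]
          filter_upwards [hbd i hiy.1] with k hk
          rw [mem_preimage, mem_closedBall_zero_iff]
          exact hk y hiy.2)
      obtain ⟨l, -, hl⟩ := h1
      exact ⟨l, fun _ _ => hl⟩
    · exact ⟨0, fun h1 h2 => absurd ⟨h1, h2⟩ hiy⟩
  choose g hg using hlim
  have hghol : ∀ i < e, DifferentiableOn ℂ (g i) (ball (0 : V) δ) := fun i hi =>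
    differentiableOn_of_tendsto (l := (𝒰 : Filter ℕ)) isOpen_ball
      (Eventually.of_forall fun k => ((q (η k)).coeff i).differentiableOn_fn) (hbd i hi)
      fun y hy => hg i y hi hy
  classical
  let G : ℕ → HolRing (ball (0 : V) δ) := fun i =>
    if hi : i < e then HolRing.mk (g i) (hghol i hi) else 0
  have hne : (ball (0 : V) δ).Nonempty := ⟨_, ha₀.1⟩
  have hchar := HolRing.charZero hne
  have hnt : Nontrivial (HolRing (ball (0 : V) δ)) := inferInstance
  have hlt := degree_polyOf_lt e G
  have hQ : (X ^ e + polyOf e G).Monic := monic_X_pow_add hlt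
  have hdeg : (X ^ e + polyOf e G).natDegree = e := by
    rw [natDegree_add_eq_left_of_degree_lt, natDegree_X_pow]
    rwa [degree_X_pow]
  have hQe : ∀ y ∈ ball (0 : V) δ, ∀ x, pe (X ^ e + polyOf e G) (y, x) =
      ∑ i ∈ Finset.range e, g i y * x ^ i + x ^ e := fun y hy x => by
    rw [pe_add _ _ hy, pe_X_pow _ hy, pe_polyOf _ _ hy, add_comm]
    congr 1
    refine Finset.sum_congr rfl fun i hi => ?_
    simp only [G, dif_pos (Finset.mem_range.1 hi)]
    rw [HolRing.fn_mk hy]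
  have hpe : ∀ y ∈ ball (0 : V) δ, ∀ x, Tendsto (fun k => pe (q (η k)) (y, x)) 𝒰
      (𝓝 (pe (X ^ e + polyOf e G) (y, x))) := fun y hy x => by
    rw [hQe y hy]
    have h1 : Tendsto (fun k => ∑ i ∈ Finset.range e, ((q (η k)).coeff i).fn y * x ^ i + x ^ e) 𝒰
        (𝓝 (∑ i ∈ Finset.range e, g i y * x ^ i + x ^ e)) :=
      (tendsto_finsetSum _ fun i hi =>
        (hg i y (Finset.mem_range.1 hi) hy).mul_const _).add_const _
    refine h1.congr' (he.mono fun k hk => ?_)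
    beta_reduce
    rw [pe, Finset.sum_range_succ, (hq _ (hη k)).1.coeff_natDegree, ← HolRing.ev_eq ⟨y, hy⟩ 1,
      map_one, one_mul, hk]
  refine ⟨X ^ e + polyOf e G, hQ, fun y hy x hx => ?_, ?_⟩
  · have he0 : 0 < e := hdeg ▸ natDegree_pos_of_root hQ hy hx
    have h1 : ∀ k, ∃ x', (q (η k)).natDegree = e → pe (q (η k)) (y, x') = 0 ∧
        ‖x - x'‖ ^ e ≤ ‖pe (q (η k)) (y, x)‖ := fun k => by
      by_cases hk : (q (η k)).natDegree = e
      · obtain ⟨x', h2, h3⟩ := exists_pe_root_near (hq _ (hη k)).1 (by rwa [hk]) hy x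
        rw [hk] at h3
        exact ⟨x', fun _ => ⟨h2, h3⟩⟩
      · exact ⟨0, fun h => absurd h hk⟩
    choose x' hx' using h1
    have h2 : Tendsto (fun k => ‖pe (q (η k)) (y, x)‖) 𝒰 (𝓝 0) := by
      have := (hpe y hy x).norm
      rwa [hx, norm_zero] at this
    have h3 : Tendsto (fun k => ‖x - x' k‖ ^ e) 𝒰 (𝓝 0) :=
      tendsto_of_tendsto_of_tendsto_of_le_of_le' tendsto_const_nhds h2
        (Eventually.of_forall fun k => by positivity) (he.mono fun k hk => (hx' k hk).2)
    have h4 : Tendsto x' 𝒰 (𝓝 x) := by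
      rw [Metric.tendsto_nhds]
      intro ε hε
      filter_upwards [h3.eventually (gt_mem_nhds (pow_pos hε e))] with k hk
      rw [dist_comm, dist_eq_norm]
      exact lt_of_pow_lt_pow_left₀ _ hε.le hk
    refine ⟨hK.mem_of_tendsto (b := (𝒰 : Filter ℕ)) (tendsto_const_nhds.prodMk_nhds h4)
      (he.mono fun k hk => hqK _ (hη k) y hy _ (hx' k hk).1), ?_⟩
    have h5 : ‖x‖ ≤ rho e := le_of_tendsto h4.norm (he.mono fun k hk => by
      have := (hq _ (hη k)).2 y hy _ (hx' k hk).1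
      rw [hk] at this
      exact this.le)
    linarith [rho_le e]
  · obtain ⟨r, hr, hrB⟩ := Metric.isOpen_iff.1 (show IsOpen (bid V δ) from isOpen_ball.prod isOpen_ball) a₀ ha₀
    have ha : Tendsto (fun k => ‖a (η k) - a₀‖) 𝒰 (𝓝 0) := by
      refine squeeze_zero (fun k => norm_nonneg _) (fun k => ?_)
        (tendsto_one_div_add_atTop_nhds_zero_nat.mono_left h𝒰)
      rw [← dist_eq_norm]
      exact (had _ (hη k)).le
    have hb : ∀ k, ∀ z ∈ ball a₀ r, ‖pe (q (η k)) z‖ ≤ 2 := fun k z hz => by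
      have hz' := hrB hz
      have h1 := (hq _ (hη k)).norm_sub_le hz'.1 hz'.2
      have h2 : ‖z.2 ^ (q (η k)).natDegree‖ ≤ 1 := by
        rw [norm_pow]
        exact pow_le_one₀ (norm_nonneg _) (mem_ball_zero_iff.1 hz'.2).le
      have h3 : ((1 : ℝ) / 2) ^ ((q (η k)).natDegree + 1) ≤ 1 :=
        pow_le_one₀ (by norm_num) (by norm_num)
      calc ‖pe (q (η k)) z‖ = ‖z.2 ^ (q (η k)).natDegree
            - (z.2 ^ (q (η k)).natDegree - pe (q (η k)) (z.1, z.2))‖ := by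
              rw [sub_sub_cancel]
        _ ≤ _ := norm_sub_le _ _
        _ ≤ 2 := by linarith
    have h1 : Tendsto (fun k => 2 * 2 / r * ‖a (η k) - a₀‖) 𝒰 (𝓝 0) := by
      simpa using ha.const_mul (2 * 2 / r)
    have h2 : Tendsto (fun k => pe (q (η k)) a₀) 𝒰 (𝓝 0) := by
      refine squeeze_zero_norm' ?_ h1
      filter_upwards [ha.eventually (gt_mem_nhds hr)] with k hk
      have h3 := norm_sub_le_of_bounded (w := a (η k) - a₀) ((differentiableOn_pe (q (η k))).mono
        fun z hz => ⟨(hrB hz).1, mem_univ _⟩) (hb k) hk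
      rwa [add_sub_cancel, hqa _ (hη k), zero_sub, norm_neg] at h3
    exact tendsto_nhds_unique (hpe a₀.1 ha₀.1 a₀.2) h2

end Limit

section GoodPoints

variable {E F : Type*} [NormedAddCommGroup E] [NormedSpace ℂ E] [FiniteDimensional ℂ E]
  [NormedAddCommGroup F] [NormedSpace ℂ F] [FiniteDimensional ℂ F]

theorem continuousAt_fderiv {f : E → ℂ} {a : E} (hf : ∀ᶠ z in 𝓝 a, DifferentiableAt ℂ f z) :
    ContinuousAt (fderiv ℂ f) a := by
  obtain ⟨r, hr, hball⟩ := Metric.eventually_nhds_iff_ball.1 hf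
  exact ((differentiableOn_fderiv isOpen_ball fun z hz =>
    (hball z hz).differentiableWithinAt).differentiableAt
      (isOpen_ball.mem_nhds (mem_ball_self hr))).continuousAt

theorem GoodPt.eventually {r : E → ℝ} {a : E} (h : GoodPt r a) :
    ∀ᶠ z in 𝓝 a, r z = 0 → GoodPt r z := by
  obtain ⟨-, τ, h1, h2, h3⟩ := h
  filter_upwards [h1.eventually_nhds, (continuousAt_fderiv h1).eventually_ne h2,
    h3.eventually_nhds] with z hz1 hz2 hz3 h0 using ⟨h0, τ, hz1, hz2, hz3⟩

theorem GoodPt.frequently_ne {r : E → ℝ} {a : E} (h : GoodPt r a) : ∃ᶠ z in 𝓝 a, r z ≠ 0 := by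
  obtain ⟨-, τ, h1, h2, h3⟩ := h
  intro hev
  obtain ⟨v, hv⟩ : ∃ v, fderiv ℂ τ a v ≠ 0 := by
    by_contra! h0
    exact h2 (ContinuousLinearMap.ext h0)
  set w := fderiv ℂ τ a v with hw
  have hl : HasDerivAt (fun t : ℂ => a + t • ((I / w) • v)) ((I / w) • v) 0 := by
    simpa using ((hasDerivAt_id (0 : ℂ)).smul_const ((I / w) • v)).const_add a
  have hτ : HasFDerivAt τ (fderiv ℂ τ a) (a + (0 : ℂ) • ((I / w) • v)) := by
    simpa using h1.self_of_nhds.hasFDerivAt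
  have h4 := (hτ.comp_hasDerivAt (0 : ℂ) hl)
  rw [map_smul, ← hw, smul_eq_mul, div_mul_cancel₀ _ hv] at h4
  have h5 : HasDerivAt (fun t : ℝ => ((τ ∘ fun t : ℂ => a + t • ((I / w) • v)) t).im) 1 0 := by
    have := h4.comp_ofReal (z := 0)
    have h6 := (imCLM.hasFDerivAt).comp_hasDerivAt (0 : ℝ) this
    rwa [imCLM_apply, I_im] at h6
  have h6 : HasDerivAt (fun t : ℝ => ((τ ∘ fun t : ℂ => a + t • ((I / w) • v)) t).im) 0 0 := by
    refine (hasDerivAt_const (0 : ℝ) (0 : ℝ)).congr_of_eventuallyEq ?_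
    have hc : Tendsto (fun t : ℝ => a + (t : ℂ) • ((I / w) • v)) (𝓝 0) (𝓝 a) := by
      have : Continuous fun t : ℝ => a + (t : ℂ) • ((I / w) • v) := by fun_prop
      simpa using this.tendsto 0
    filter_upwards [hc.eventually (hev.and h3)] with t ht
    exact ht.2.1 (not_not.1 ht.1)
  exact one_ne_zero (h5.unique h6)

theorem GoodPt.comp {r : F → ℝ} {φ : E → F} (hφ : Differentiable ℂ φ) {a : E}
    (hs : Function.Surjective (fderiv ℂ φ a)) (h : GoodPt r (φ a)) : GoodPt (r ∘ φ) a := by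
  obtain ⟨h0, τ, h1, h2, h3⟩ := h
  have hc := hφ.continuous.tendsto a
  refine ⟨h0, τ ∘ φ, (hc.eventually h1).mono fun z hz => hz.comp z (hφ z), fun hd => h2 ?_,
    hc.eventually h3⟩
  rw [fderiv_comp a h1.self_of_nhds (hφ a)] at hd
  ext v
  obtain ⟨w, rfl⟩ := hs v
  exact congrArg (fun L : E →L[ℂ] ℂ => L w) hd

theorem goodPt_comp_affine {r : F → ℝ} (L : E ≃L[ℂ] F) (p : F) (a : E) :
    GoodPt (fun z => r (p + L z)) a ↔ GoodPt r (p + L a) := by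
  refine ⟨fun h => ?_, fun h => ?_⟩
  · have hd : ∀ z, HasFDerivAt (fun z => L.symm (z - p)) (L.symm : F →L[ℂ] E) z := fun z =>
      L.symm.hasFDerivAt.comp z ((hasFDerivAt_id z).sub_const p)
    have h1 := GoodPt.comp (r := fun z => r (p + L z)) (φ := fun z => L.symm (z - p))
      (a := p + L a) (fun z => (hd z).differentiableAt)
      (by rw [(hd _).fderiv]; exact L.symm.surjective) (by simpa using h)
    simpa [Function.comp_def] using h1
  · have hd : ∀ z, HasFDerivAt (fun z => p + L z) (L : E →L[ℂ] F) z := fun z =>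
      L.hasFDerivAt.const_add p
    exact GoodPt.comp (r := r) (φ := fun z => p + L z) (fun z => (hd z).differentiableAt)
      (by rw [(hd _).fderiv]; exact L.surjective) h

theorem frequently_ne_of_analytic {r : E → ℝ} {p : E} {ρ : ℝ}
    (hr : AnalyticOnNhd ℝ r (ball p ρ)) {q : E} (hq : q ∈ ball p ρ)
    (hne : ∃ᶠ z in 𝓝 q, r z ≠ 0) {a : E} (ha : a ∈ ball p ρ) : ∃ᶠ z in 𝓝 a, r z ≠ 0 := by
  intro hev
  have h1 := hr.eqOn_zero_of_preconnected_of_eventuallyEq_zero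
    (convex_ball p ρ).isPreconnected ha (hev.mono fun z hz => not_not.1 hz)
  refine hne ?_
  filter_upwards [isOpen_ball.mem_nhds hq] with z hz using not_not_intro (h1 hz)

end GoodPoints

section Slices

variable {E : Type*} [NormedAddCommGroup E] [NormedSpace ℂ E] [FiniteDimensional ℂ E]
  [StarAddMonoid E] [NormedStarGroup E] [StarModule ℂ E]

/-- Some slice of the polarization at a good point does not vanish identically. -/
theorem exists_goodPt_slice {r : E → ℝ} {p : E} {ρ : ℝ} {R : E × E → ℂ}
    (hR : DifferentiableOn ℂ R (ball p ρ ×ˢ ball (star p) ρ))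
    (hRr : ∀ z ∈ ball p ρ, R (z, star z) = r z) {O : Set E} (hO : IsOpen O) (hOB : O ⊆ ball p ρ)
    {q₀ : E} (hq₀ : q₀ ∈ O) (hgood : GoodPt r q₀) :
    ∃ q ∈ O, GoodPt r q ∧ ∃ z ∈ ball p ρ, R (z, star q) ≠ 0 := by
  by_contra! hcon
  have hstar : ∀ {z : E}, z ∈ ball p ρ → star z ∈ ball (star p) ρ := fun {z} hz => by
    rw [star_mem_ball, star_star]
    exact hz
  have hvan : ∀ z ∈ ball p ρ, ∀ w ∈ ball p ρ, R (z, star w) = 0 := by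
    intro z hz w hw
    have hg : DifferentiableOn ℂ (fun q => star (R (z, star q))) (ball p ρ) :=
      DifferentiableOn.star_star' (f := fun w => R (z, w)) isOpen_ball
        (hR.comp (f := fun w => (z, w)) (by fun_prop) fun w hw => ⟨hz, hw⟩) fun q hq => hstar hq
    obtain ⟨h0, τ, h1, h2, h3⟩ := id hgood
    have hev := eventually_eq_zero_of_real_level (g := fun q => star (R (z, star q))) h1
      (by filter_upwards [isOpen_ball.mem_nhds (hOB hq₀)] with q hq
          exact hg.differentiableAt (isOpen_ball.mem_nhds hq)) h2 (h3.self_of_nhds.1 h0)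
      (by filter_upwards [hgood.eventually, h3, hO.mem_nhds hq₀] with q hq1 hq2 hq3 him
          rw [hcon q hq3 (hq1 (hq2.2 him)) z hz, star_zero])
    have := eqOn_zero_of_eventuallyEq isOpen_ball (convex_ball p ρ).isPreconnected hg (hOB hq₀) hev
      hw
    exact star_eq_zero.1 this
  refine hgood.frequently_ne ?_
  filter_upwards [isOpen_ball.mem_nhds (hOB hq₀)] with z hz
  have := hvan z hz z hz
  rw [hRr z hz] at this
  exact not_not_intro (by exact_mod_cast this)

end Slices

section LimitSlice

variable {n : ℕ}

/-- Normalized slices of a bounded polarization accumulate at a nonzero holomorphic function. -/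
theorem exists_limit_slice {m : ℕ} {p : Fin m → ℂ} {ρ M : ℝ} (hρ : 0 < ρ)
    {R : (Fin m → ℂ) × (Fin m → ℂ) → ℂ}
    (hR : DifferentiableOn ℂ R (ball p ρ ×ˢ ball (star p) ρ))
    (hM : ∀ z ∈ ball p ρ ×ˢ ball (star p) ρ, ‖R z‖ ≤ M) {G : Set (Fin m → ℂ)}
    (hG : ∀ ε > 0, ε ≤ ρ → ∃ q ∈ ball p ε, q ∈ G ∧ ∃ z ∈ ball p ρ, R (z, star q) ≠ 0) :
    ∃ (q : ℕ → Fin m → ℂ) (c : ℕ → ℂ) (f : (Fin m → ℂ) → ℂ), (∀ k, q k ∈ G ∧ q k ∈ ball p ρ) ∧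
      Tendsto q atTop (𝓝 p) ∧ DifferentiableOn ℂ f (ball p ρ) ∧ (∃ z ∈ ball p ρ, f z ≠ 0) ∧
      TendstoLocallyUniformlyOn (fun k z => c k * R (z, star (q k))) f (hyperfilter ℕ)
        (ball p ρ) := by
  obtain ⟨r', C, ι, _, ζs, hr', hrr', hC, hdom⟩ := exists_finite_domination
    (Z := ball p ρ) (F := fun ζ w => R (ζ, w)) (a := star p) (r := ρ) (M := M) hρ
    (fun ζ => hR.comp (f := fun w => ((ζ : Fin m → ℂ), w)) (by fun_prop) fun w hw => ⟨ζ.2, hw⟩)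
    fun ζ w hw => hM _ ⟨ζ.2, hw⟩
  have hpos : ∀ k : ℕ, (0 : ℝ) < 1 / (k + 1) := fun k => by positivity
  choose q hqb hqG z hzρ hRz using fun k : ℕ =>
    hG (min r' (1 / (k + 1))) (lt_min hr' (hpos k)) ((min_le_left _ _).trans hrr')
  have hq1 : ∀ k, dist (q k) p < r' := fun k => (mem_ball.1 (hqb k)).trans_le (min_le_left _ _)
  have hq2 : ∀ k, dist (q k) p ≤ 1 / (k + 1) := fun k =>
    (mem_ball.1 (hqb k)).le.trans (min_le_right _ _)
  have hstar : ∀ {s : ℝ} {w : Fin m → ℂ}, w ∈ ball p s → star w ∈ ball (star p) s :=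
    fun {s w} hw => by rwa [star_mem_ball, star_star]
  have hqρ : ∀ k, q k ∈ ball p ρ := fun k => (hq1 k).trans_le hrr'
  let c : ℕ → ℝ := fun k => ∑ j, ‖R (ζs j, star (q k))‖
  have hdom' : ∀ k, ∀ w ∈ ball p ρ, ‖R (w, star (q k))‖ ≤ C * c k := fun k w hw =>
    hdom ⟨w, hw⟩ _ (hstar (hq1 k))
  have hc : ∀ k, 0 < c k := by
    intro k
    have h0 : 0 ≤ c k := Finset.sum_nonneg fun j _ => norm_nonneg _
    refine h0.lt_of_ne fun h => hRz k ?_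
    have := hdom' k _ (hzρ k)
    rw [← h, mul_zero] at this
    exact norm_le_zero_iff.1 this
  have hnc : ∀ k, ‖((c k : ℂ))⁻¹‖ = (c k)⁻¹ := fun k => by
    rw [norm_inv, Complex.norm_real, Real.norm_of_nonneg (hc k).le]
  let F : ℕ → (Fin m → ℂ) → ℂ := fun k w => (c k : ℂ)⁻¹ * R (w, star (q k))
  have hFC : ∀ k, ∀ w ∈ ball p ρ, ‖F k w‖ ≤ C := by
    intro k w hw
    rw [norm_mul, hnc, inv_mul_le_iff₀ (hc k), mul_comm]
    exact hdom' k w hw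
  have hFd : ∀ k, DifferentiableOn ℂ (F k) (ball p ρ) := fun k =>
    (hR.comp (f := fun w => (w, star (q k))) (by fun_prop)
      fun w hw => ⟨hw, hstar (hqρ k)⟩).const_mul _
  have hlim : ∀ w, ∃ y, w ∈ ball p ρ → Tendsto (fun k => F k w) (hyperfilter ℕ) (𝓝 y) := by
    intro w
    by_cases hw : w ∈ ball p ρ
    · obtain ⟨y, -, hy⟩ := (isCompact_closedBall (0 : ℂ) C).ultrafilter_le_nhds
        ((hyperfilter ℕ).map fun k => F k w) (by
          rw [le_principal_iff, Ultrafilter.mem_coe, Ultrafilter.mem_map]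
          exact Filter.mem_of_superset univ_mem fun k _ =>
            mem_closedBall_zero_iff.2 (hFC k w hw))
      exact ⟨y, fun _ => hy⟩
    · exact ⟨0, fun h => absurd h hw⟩
  choose f hf using hlim
  have hsum : ∑ j, ‖f (ζs j)‖ = 1 := by
    refine tendsto_nhds_unique (tendsto_finsetSum (f := fun j (k : ℕ) => ‖F k (ζs j)‖)
      (x := (hyperfilter ℕ : Filter ℕ)) Finset.univ fun j _ => (hf (ζs j) (ζs j).2).norm)
      (tendsto_const_nhds.congr fun k => ?_)
    simp only [F, norm_mul, hnc]
    rw [← Finset.mul_sum, inv_mul_cancel₀ (hc k).ne']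
  refine ⟨q, fun k => (c k : ℂ)⁻¹, f, fun k => ⟨hqG k, hqρ k⟩,
    tendsto_iff_dist_tendsto_zero.2
      (squeeze_zero (fun _ => dist_nonneg) hq2 tendsto_one_div_add_atTop_nhds_zero_nat),
    differentiableOn_of_tendsto isOpen_ball (Eventually.of_forall hFd) (Eventually.of_forall hFC)
      hf, ?_,
    tendstoLocallyUniformlyOn_of_bounded isOpen_ball (Eventually.of_forall hFd)
      (Eventually.of_forall hFC) hf⟩
  by_contra! h
  rw [Finset.sum_eq_zero fun j _ => by rw [h _ (ζs j).2, norm_zero]] at hsum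
  exact zero_ne_one hsum

end LimitSlice

section Polynomials

variable {n : ℕ}

/-- Near an accumulation point of good points there is a monic polynomial with holomorphic
coefficients whose zero set lies in the closure of the good points. -/
theorem exists_polynomial_in_closure {p : Fin (n + 1) → ℂ} {ρ M : ℝ} (hρ : 0 < ρ)
    {R : (Fin (n + 1) → ℂ) × (Fin (n + 1) → ℂ) → ℂ}
    (hR : DifferentiableOn ℂ R (ball p ρ ×ˢ ball (star p) ρ))
    (hM : ∀ z ∈ ball p ρ ×ˢ ball (star p) ρ, ‖R z‖ ≤ M) {r : (Fin (n + 1) → ℂ) → ℝ}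
    (hr : AnalyticOnNhd ℝ r (ball p ρ)) (hRr : ∀ z ∈ ball p ρ, R (z, star z) = r z)
    (hp : p ∈ closure {a | GoodPt r a}) :
    ∃ (L : (Fin (n + 1) → ℂ) ≃L[ℂ] (Fin n → ℂ) × ℂ) (δ : ℝ), 0 < δ ∧
      (∀ a ∈ bid (Fin n → ℂ) δ, p + L.symm a ∈ ball p ρ) ∧
      ∃ Q : (HolRing (ball (0 : Fin n → ℂ) δ))[X], Q.Monic ∧
        (∀ y ∈ ball (0 : Fin n → ℂ) δ, ∀ x, pe Q (y, x) = 0 →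
          (y, x) ∈ closure {a | GoodPt (fun a => r (p + L.symm a)) a} ∧ ‖x‖ < 1) ∧
        pe Q (0, 0) = 0 := by
  obtain ⟨q, C, f, hq, hqp, hf, ⟨z₀, hz₀, hfz₀⟩, hlim⟩ := exists_limit_slice
    (G := {a | GoodPt r a}) hρ hR hM fun ε hε hερ => by
      obtain ⟨q₀, hq₀, hg⟩ := _root_.mem_closure_iff.1 hp _ isOpen_ball (mem_ball_self hε)
      exact exists_goodPt_slice hR hRr isOpen_ball (ball_subset_ball hερ) hq₀ hg
  have hmaps : MapsTo (fun w => p + w) (ball (0 : Fin (n + 1) → ℂ) ρ) (ball p ρ) :=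
    fun w hw => by simpa using hw
  have hh : DifferentiableOn ℂ (fun w => f (p + w)) (ball 0 ρ) := hf.comp (by fun_prop) hmaps
  obtain ⟨d, L, u, c, hc, hu, huc, hL⟩ := exists_weierstrass_coordinates (n := n) (by simp)
    isOpen_ball (mem_ball_self hρ) hh (frequently_ne_zero isOpen_ball
      (convex_ball _ _).isPreconnected hh (b := z₀ - p) (by simpa [dist_eq_norm] using hz₀)
      (by simpa using hfz₀) (mem_ball_self hρ))
  have hη : 0 < eta d / 8 := by have := eta_pos d; positivity
  obtain ⟨δ, hδ, hLδ⟩ := hL _ hη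
  have hcl : ∀ a ∈ bid (Fin n → ℂ) δ, a.1 ∈ closedBall (0 : Fin n → ℂ) δ ∧
      a.2 ∈ closedBall (0 : ℂ) 1 := fun a ha =>
    ⟨ball_subset_closedBall ha.1, ball_subset_closedBall ha.2⟩
  have hιρ : ∀ a ∈ bid (Fin n → ℂ) δ, p + L.symm a ∈ ball p ρ := fun a ha =>
    hmaps (hLδ a.1 (hcl a ha).1 a.2 (hcl a ha).2).1
  let ι : (Fin n → ℂ) × ℂ ≃ₜ (Fin (n + 1) → ℂ) :=
    L.symm.toHomeomorph.trans (Homeomorph.addLeft p)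
  have hι : ∀ a, ι a = p + L.symm a := fun a => rfl
  have h0 : (0 : (Fin n → ℂ) × ℂ) ∈ bid (Fin n → ℂ) δ :=
    ⟨mem_ball_self hδ, mem_ball_self one_pos⟩
  have hstar : ∀ {s : ℝ} {w : Fin (n + 1) → ℂ}, w ∈ ball p s → star w ∈ ball (star p) s :=
    fun {s w} hw => by rwa [star_mem_ball, star_star]
  have hB := isOpen_bid (V := Fin n → ℂ) δ
  have hrne : ∀ a ∈ bid (Fin n → ℂ) δ, ∃ᶠ z in 𝓝 a, r (p + L.symm z) ≠ 0 := by
    intro a ha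
    have h1 := frequently_ne_of_analytic hr (hq 0).2 (hq 0).1.frequently_ne (hιρ a ha)
    rw [← hι, ← ι.map_nhds_eq] at h1
    exact h1
  have hd : Differentiable ℂ fun a => p + L.symm a := by fun_prop
  have hra : AnalyticOnNhd ℝ (fun a => r (p + L.symm a)) (bid (Fin n → ℂ) δ) := by
    intro a ha
    refine AnalyticAt.fun_comp (hr _ (hιρ a ha)) ?_
    exact analyticAt_const.add
      (((L.symm : (Fin n → ℂ) × ℂ →L[ℂ] (Fin (n + 1) → ℂ)).restrictScalars ℝ).analyticAt a)
  have hS : DifferentiableOn ℂ (fun ab : ((Fin n → ℂ) × ℂ) × ((Fin n → ℂ) × ℂ) =>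
      R (p + L.symm ab.1, star (p + L.symm (star ab.2))))
      (bid (Fin n → ℂ) δ ×ˢ bid (Fin n → ℂ) δ) := by
    have hs : DifferentiableOn ℂ (fun b => star (p + L.symm (star b))) (bid (Fin n → ℂ) δ) :=
      DifferentiableOn.star_star' hB hd.differentiableOn fun b hb => star_mem_bid.2 hb
    refine hR.comp (f := fun ab : ((Fin n → ℂ) × ℂ) × ((Fin n → ℂ) × ℂ) =>
      (p + L.symm ab.1, star (p + L.symm (star ab.2)))) (DifferentiableOn.prodMk (by fun_prop)
        (hs.comp (f := fun ab : ((Fin n → ℂ) × ℂ) × ((Fin n → ℂ) × ℂ) => ab.2) (by fun_prop)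
          fun ab hab => hab.2)) fun ab hab => ⟨hιρ _ hab.1, hstar (hιρ _ (star_mem_bid.2 hab.2))⟩
  have hK : IsCompact ((fun a => p + L.symm a) ''
      (closedBall (0 : Fin n → ℂ) δ ×ˢ closedBall (0 : ℂ) 1)) :=
    ((isCompact_closedBall _ _).prod (isCompact_closedBall _ _)).image hd.continuous
  have hKρ : (fun a => p + L.symm a) ''
      (closedBall (0 : Fin n → ℂ) δ ×ˢ closedBall (0 : ℂ) 1) ⊆ ball p ρ := by
    rintro _ ⟨a, ha, rfl⟩
    exact hmaps (hLδ a.1 ha.1 a.2 ha.2).1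
  have hunif := Metric.tendstoUniformlyOn_iff.1
    ((tendstoLocallyUniformlyOn_iff_forall_isCompact isOpen_ball).1 hlim _ hKρ hK)
    (c * (eta d / 8)) (by positivity)
  have hak : Tendsto (fun k => L (q k - p)) atTop (𝓝 0) := by
    have h1 : Tendsto (fun k => L (q k - p)) atTop (𝓝 (L (p - p))) :=
      (L.continuous.tendsto _).comp (hqp.sub_const p)
    simpa using h1
  refine ⟨L, δ, hδ, hιρ, exists_limit_polynomial (d := d) isClosed_closure h0 fun η hη' => ?_⟩
  obtain ⟨k, ⟨hk1, hk2⟩, hk3⟩ := ((hunif.and ((hak.eventually (isOpen_ball.eventually_mem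
    (mem_ball_self (half_pos hη')))).filter_mono Nat.hyperfilter_le_atTop)).and
      ((hak.eventually (hB.eventually_mem h0)).filter_mono Nat.hyperfilter_le_atTop)).exists
  have hqk : p + L.symm (L (q k - p)) = q k := by simp
  obtain ⟨hr0, f', hf'1, hf'2, hf'3⟩ :=
    (goodPt_comp_affine L.symm p (L (q k - p))).2 (hqk.symm ▸ (hq k).1)
  have hclose : ∀ y ∈ ball (0 : Fin n → ℂ) δ, ∀ X ∈ ball (0 : ℂ) 1,
      ‖X ^ d - C k * R (p + L.symm (y, X), star (p + L.symm (star (star (L (q k - p)))))) / u X‖ ≤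
        eta d / 2 / 2 := by
    intro y hy X hX
    have hy' := ball_subset_closedBall hy
    have hX' := ball_subset_closedBall hX
    have h1 := (hLδ y hy' X hX').2
    have h2 := (hk1 _ ⟨(y, X), ⟨hy', hX'⟩, rfl⟩).le
    have huX : 0 < ‖u X‖ := hc.trans_le (huc X hX')
    rw [dist_eq_norm] at h2
    rw [star_star, hqk]
    have h3 : ‖f (p + L.symm (y, X)) / u X - C k * R (p + L.symm (y, X), star (q k)) / u X‖ ≤
        eta d / 8 := by
      rw [← sub_div, norm_div, div_le_iff₀ huX]
      calc _ ≤ c * (eta d / 8) := h2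
        _ ≤ ‖u X‖ * (eta d / 8) := by gcongr; exact huc X hX'
        _ = _ := mul_comm _ _
    calc _ = ‖(X ^ d - f (p + L.symm (y, X)) / u X) + (f (p + L.symm (y, X)) / u X -
          C k * R (p + L.symm (y, X), star (q k)) / u X)‖ := by ring_nf
      _ ≤ eta d / 8 + eta d / 8 := (norm_add_le _ _).trans (add_le_add h1 h3)
      _ = _ := by ring
  obtain ⟨Q, hQ1, hQ2, hQ3, a, haB, hdist, hQa⟩ := exists_leaf (C := C k) (d := d) hS
    (fun a ha b hb => hM _ ⟨hιρ _ ha, hstar (hιρ _ (star_mem_bid.2 hb))⟩) hra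
    (fun a ha => by rw [star_star]; exact hRr _ (hιρ a ha)) hrne
    (hu.mono ball_subset_closedBall) hc (fun X hX => huc X (ball_subset_closedBall hX)) hk3
    hclose hf'1 hf'2 (hf'3.self_of_nhds.1 hr0) (hf'3.mono fun z hz => hz.2) (half_pos hη')
  refine ⟨Q, hQ1, hQ2, hQ3, a, haB, ?_, hQa⟩
  calc dist a 0 ≤ dist a (L (q k - p)) + dist (L (q k - p)) 0 := dist_triangle _ _ _
    _ < η / 2 + η / 2 := add_lt_add hdist hk2
    _ = η := add_halves η

end Polynomials

section Hypersurfaces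

variable {N : ℕ} {H V : Set (CN N)} {r : CN N → ℝ} {a : CN N}

theorem goodPt_of_isLeviFlatHypAt (hV : IsOpen V) (hHV : H ∩ V = {z ∈ V | r z = 0}) (haV : a ∈ V)
    (haH : a ∈ H) (h : IsLeviFlatHypAt N H a) : GoodPt r a := by
  obtain ⟨W, f, hW, haW, hf, hd, hHW⟩ := h
  have hmem : ∀ z ∈ V, z ∈ H ↔ r z = 0 := fun z hz =>
    ⟨fun h => ((Set.ext_iff.1 hHV z).1 ⟨h, hz⟩).2, fun h => ((Set.ext_iff.1 hHV z).2 ⟨hz, h⟩).1⟩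
  have hmem' : ∀ z ∈ W, z ∈ H ↔ (f z).im = 0 := fun z hz =>
    ⟨fun h => ((Set.ext_iff.1 hHW z).1 ⟨h, hz⟩).2, fun h => ((Set.ext_iff.1 hHW z).2 ⟨hz, h⟩).1⟩
  refine ⟨(hmem a haV).1 haH, f, ?_, hd a haW, ?_⟩
  · filter_upwards [hW.mem_nhds haW] with z hz
    exact (hW.analyticOn_iff_analyticOnNhd.1 hf z hz).differentiableAt
  · filter_upwards [hW.mem_nhds haW, hV.mem_nhds haV] with z hz1 hz2
    rw [← hmem z hz2, hmem' z hz1]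

theorem fderiv_im_ne_zero {E : Type*} [NormedAddCommGroup E] [NormedSpace ℂ E] {τ : E → ℂ} {z : E}
    (hτ : DifferentiableAt ℂ τ z) (h : fderiv ℂ τ z ≠ 0) :
    fderiv ℝ (fun z => (τ z).im) z ≠ 0 := by
  have h1 : HasFDerivAt (fun z => (τ z).im) (imCLM.comp ((fderiv ℂ τ z).restrictScalars ℝ)) z :=
    imCLM.hasFDerivAt.comp z (hτ.hasFDerivAt.restrictScalars ℝ)
  rw [h1.fderiv]
  refine fun h0 => h ?_
  have him : ∀ v, (fderiv ℂ τ z v).im = 0 := fun v => congrArg (fun L : E →L[ℝ] ℝ => L v) h0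
  ext v
  refine Complex.ext ?_ (him v)
  simpa using him (I • v)

theorem mem_hypStar_of_goodPt (hN : 0 < N) (hV : IsOpen V) (hHV : H ∩ V = {z ∈ V | r z = 0})
    (haV : a ∈ V) (h : GoodPt r a) : a ∈ hypStar N H := by
  have hmem : ∀ z ∈ V, z ∈ H ↔ r z = 0 := fun z hz =>
    ⟨fun h => ((Set.ext_iff.1 hHV z).1 ⟨h, hz⟩).2, fun h => ((Set.ext_iff.1 hHV z).2 ⟨hz, h⟩).1⟩
  obtain ⟨h0, τ, h1, h2, h3⟩ := h
  refine ⟨(hmem a haV).2 h0, ?_⟩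
  obtain ⟨ε, hε, hball⟩ := Metric.eventually_nhds_iff_ball.1
    (((h1.and ((continuousAt_fderiv h1).eventually_ne h2)).and h3).and (hV.eventually_mem haV))
  have hτ : AnalyticOnNhd ℂ τ (ball a ε) := analyticOnNhd_of_differentiableOn isOpen_ball
    fun z hz => (hball z hz).1.1.1.differentiableWithinAt
  have hdim : 2 * N - (2 * N - 1) = 1 := by omega
  unfold IsSubmanifoldAtDim
  rw [hdim]
  refine ⟨ball a ε, fun _ z => (τ z).im, isOpen_ball, mem_ball_self hε, fun _ => ?_,
    fun z hz => ?_, ?_⟩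
  · exact ((imCLM.analyticOnNhd univ).comp hτ.restrictScalars fun z _ => mem_univ _).analyticOn
  · rw [linearIndependent_unique_iff]
    exact fderiv_im_ne_zero (hball z hz).1.1.1 (hball z hz).1.1.2
  · ext z
    refine ⟨fun hz => ⟨hz.2, fun _ => ?_⟩, fun hz => ⟨?_, hz.1⟩⟩
    · have := hball z hz.2
      exact this.1.2.1 ((hmem z this.2).1 hz.1)
    · have := hball z hz.1
      exact (hmem z this.2).2 (this.1.2.2 (hz.2 0))

theorem exists_defining_function {U : Set (CN N)} (hH : IsRealSubvariety N U H) {p : CN N}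
    (hp : p ∈ U) : ∃ ρ > 0, ball p ρ ⊆ U ∧ ∃ r : CN N → ℝ, AnalyticOnNhd ℝ r (ball p ρ) ∧
      H ∩ ball p ρ = {z ∈ ball p ρ | r z = 0} := by
  obtain ⟨V, hV, hpV, hVU, k, f, hf, hHV⟩ := hH.2.2 p hp
  obtain ⟨ρ, hρ, hball⟩ := Metric.isOpen_iff.1 hV p hpV
  refine ⟨ρ, hρ, hball.trans hVU, fun z => ∑ i, f i z ^ 2, ?_, ?_⟩
  · have h1 : ∀ i, AnalyticOnNhd ℝ (f i) V := fun i => hV.analyticOn_iff_analyticOnNhd.1 (hf i)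
    exact fun z hz => Finset.analyticAt_fun_sum _ fun i _ => (h1 i z (hball hz)).pow 2
  · ext z
    have h1 : ∑ i, f i z ^ 2 = 0 ↔ ∀ i, f i z = 0 := by
      rw [Finset.sum_eq_zero_iff_of_nonneg fun i _ => sq_nonneg _]
      simp
    have h2 := Set.ext_iff.1 hHV z
    simp only [mem_inter_iff, mem_ofPred_eq, h1] at h2 ⊢
    exact ⟨fun h => ⟨h.2, (h2.1 ⟨h.1, hball h.2⟩).2⟩, fun h => ⟨(h2.2 ⟨hball h.1, h.2⟩).1, h.1⟩⟩

theorem pos_of_hypStar_nonempty (h : ∀ p ∈ hypStar N H, IsLeviFlatHypAt N H p)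
    (hne : (hypStar N H).Nonempty) : 0 < N := by
  obtain ⟨a, ha⟩ := hne
  obtain ⟨W, f, hW, haW, -, hd, -⟩ := h a ha
  refine Nat.pos_of_ne_zero fun h0 => hd a haW ?_
  subst h0
  ext v
  rw [Subsingleton.elim v 0, map_zero, map_zero]

end Hypersurfaces

theorem exists_polynomial_in_closure_hypStar {n : ℕ} {U H : Set (CN (n + 1))}
    (hH : IsRealSubvariety (n + 1) U H)
    (hlf : ∀ a ∈ hypStar (n + 1) H, IsLeviFlatHypAt (n + 1) H a) {p : CN (n + 1)}
    (hp : p ∈ closure (hypStar (n + 1) H) ∩ U) :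
    ∃ (L : CN (n + 1) ≃L[ℂ] (Fin n → ℂ) × ℂ) (δ : ℝ), 0 < δ ∧
      (∀ a ∈ bid (Fin n → ℂ) δ, p + L.symm a ∈ U) ∧
      ∃ Q : (HolRing (ball (0 : Fin n → ℂ) δ))[X], Q.Monic ∧
        (∀ y ∈ ball (0 : Fin n → ℂ) δ, ∀ x, pe Q (y, x) = 0 →
          p + L.symm (y, x) ∈ closure (hypStar (n + 1) H) ∩ U ∧ ‖x‖ < 1) ∧
        pe Q (0, 0) = 0 := by
  obtain ⟨ρ₁, hρ₁, hU, r, hr, hHr⟩ := exists_defining_function hH hp.2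
  obtain ⟨ρ₂, M, R, hρ₂, hR, hM, hRr⟩ := exists_complexification_CN (hr p (mem_ball_self hρ₁))
  have hρ : 0 < min ρ₁ ρ₂ := lt_min hρ₁ hρ₂
  have h1 : ball p (min ρ₁ ρ₂) ⊆ ball p ρ₁ := ball_subset_ball (min_le_left _ _)
  have h2 : ball p (min ρ₁ ρ₂) ⊆ ball p ρ₂ := ball_subset_ball (min_le_right _ _)
  have h3 : ball p (min ρ₁ ρ₂) ×ˢ ball (star p) (min ρ₁ ρ₂) ⊆ ball p ρ₂ ×ˢ ball (star p) ρ₂ :=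
    prod_mono h2 (ball_subset_ball (min_le_right _ _))
  obtain ⟨L, δ, hδ, hLρ, Q, hQ, hroot, hQ0⟩ := exists_polynomial_in_closure hρ (hR.mono h3)
    (fun z hz => hM z (h3 hz)) (hr.mono h1) (fun z hz => hRr z (h2 hz)) (by
      refine closure_mono ?_ (isOpen_ball.inter_closure ⟨mem_ball_self hρ₁, hp.1⟩)
      exact fun a ha => goodPt_of_isLeviFlatHypAt isOpen_ball hHr ha.1 ha.2.1 (hlf a ha.2))
  refine ⟨L, δ, hδ, fun a ha => hU (h1 (hLρ a ha)), Q, hQ, fun y hy x hx => ?_, hQ0⟩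
  obtain ⟨hcl, hx1⟩ := hroot y hy x hx
  have hmem : (y, x) ∈ bid (Fin n → ℂ) δ := ⟨hy, mem_ball_zero_iff.2 hx1⟩
  refine ⟨⟨?_, hU (h1 (hLρ _ hmem))⟩, hx1⟩
  have hcont : Continuous fun a : (Fin n → ℂ) × ℂ => p + L.symm a := by fun_prop
  refine closure_mono ?_ (image_closure_subset_closure_image hcont
    ⟨_, (isOpen_bid δ).inter_closure ⟨hmem, hcl⟩, rfl⟩)
  rintro _ ⟨a, ⟨ha, hg⟩, rfl⟩
  exact mem_hypStar_of_goodPt (Nat.succ_pos n) isOpen_ball hHr (h1 (hLρ a ha))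
    ((goodPt_comp_affine L.symm p a).1 hg)

section Interpolation

theorem sum_coeff_geom (P : ℂ[X]) {x₀ x : ℂ} (h₀ : P.eval x₀ = 0) (h : P.eval x = 0) :
    ∑ j ∈ Finset.range (P.natDegree + 1), P.coeff j * ∑ i ∈ Finset.range j, x₀ ^ i * x ^ (j - 1 - i)
      = if x = x₀ then P.derivative.eval x₀ else 0 := by
  split_ifs with hx
  · subst hx
    rw [derivative_eval, Polynomial.sum_over_range _ (by simp)]
    refine Finset.sum_congr rfl fun j _ => ?_
    rw [geom_sum₂_self, mul_assoc]
  · have h1 : (∑ j ∈ Finset.range (P.natDegree + 1), P.coeff j *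
        ∑ i ∈ Finset.range j, x₀ ^ i * x ^ (j - 1 - i)) * (x₀ - x) = 0 := by
      rw [Finset.sum_mul]
      simp_rw [mul_assoc, geom_sum₂_mul, mul_sub, Finset.sum_sub_distrib, ← eval_eq_sum_range]
      rw [h₀, h, sub_zero]
    exact (mul_eq_zero.1 h1).resolve_right (sub_ne_zero.2 (Ne.symm hx))

/-- Interpolation at the roots of a polynomial by weighted power sums. -/
theorem sum_power_sums (P : ℂ[X]) {F : Finset ℂ} (hF : ∀ x ∈ F, P.eval x = 0) (w : ℂ → ℂ) {x₀ : ℂ}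
    (h₀ : x₀ ∈ F) :
    ∑ i ∈ Finset.range P.natDegree, (∑ j ∈ Finset.range (P.natDegree + 1),
      if i < j then P.coeff j * ∑ x ∈ F, w x * x ^ (j - 1 - i) else 0) * x₀ ^ i =
      w x₀ * P.derivative.eval x₀ := by
  have h1 : ∀ j ∈ Finset.range (P.natDegree + 1), (∑ i ∈ Finset.range P.natDegree,
      (if i < j then P.coeff j * ∑ x ∈ F, w x * x ^ (j - 1 - i) else 0) * x₀ ^ i) =
      ∑ x ∈ F, w x * (P.coeff j * ∑ i ∈ Finset.range j, x₀ ^ i * x ^ (j - 1 - i)) := by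
    intro j hj
    have hjd : Finset.range j ⊆ Finset.range P.natDegree :=
      Finset.range_subset_range.2 (Nat.lt_succ_iff.1 (Finset.mem_range.1 hj))
    rw [← Finset.sum_subset hjd fun i _ hi => by
      rw [if_neg fun h => hi (Finset.mem_range.2 h), zero_mul]]
    simp_rw [Finset.mul_sum]
    rw [Finset.sum_comm]
    refine Finset.sum_congr rfl fun i hi => ?_
    rw [if_pos (Finset.mem_range.1 hi), Finset.sum_mul]
    exact Finset.sum_congr rfl fun x _ => by ring
  simp_rw [Finset.sum_mul]
  rw [Finset.sum_comm, Finset.sum_congr rfl h1, Finset.sum_comm]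
  simp_rw [← Finset.mul_sum]
  rw [Finset.sum_eq_single_of_mem x₀ h₀ fun x hx hne => by
    rw [sum_coeff_geom P (hF x₀ h₀) (hF x hx), if_neg hne, mul_zero]]
  rw [sum_coeff_geom P (hF x₀ h₀) (hF x₀ h₀), if_pos rfl]

end Interpolation

section Irreducibility

variable {V : Type*} [NormedAddCommGroup V] [NormedSpace ℂ V] [FiniteDimensional ℂ V] {Ω : Set V}

/-- The zero set of a polynomial with holomorphic coefficients. -/
def zeroSet (q : (HolRing Ω)[X]) : Set (V × ℂ) := {p | p.1 ∈ Ω ∧ pe q p = 0}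

theorem exists_branch (hΩ : IsOpen Ω) {q : (HolRing Ω)[X]} {p₀ : V × ℂ} (hp₀ : p₀ ∈ zeroSet q)
    (hd : pe (derivative q) p₀ ≠ 0) {O : Set (V × ℂ)} (hO : IsOpen O) (hpO : p₀ ∈ O) :
    ∃ (δ : ℝ) (ξ : V → ℂ), 0 < δ ∧ DifferentiableOn ℂ ξ (ball p₀.1 δ) ∧ ξ p₀.1 = p₀.2 ∧
      (∀ y ∈ ball p₀.1 δ, (y, ξ y) ∈ zeroSet q ∧ (y, ξ y) ∈ O) ∧
      ∀ᶠ p in 𝓝 p₀, p ∈ zeroSet q → p.2 = ξ p.1 := by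
  have hmem : p₀ ∈ (Ω ×ˢ univ) ∩ O := ⟨⟨hp₀.1, mem_univ _⟩, hpO⟩
  obtain ⟨δ, ε, ξ, hδ, hε, hξ, hsub, hξm, hiff⟩ := exists_implicit
    ((hΩ.prod isOpen_univ).inter hO) (v₀ := p₀.1) (x₀ := p₀.2)
    ((differentiableOn_pe q).mono inter_subset_left) hmem hp₀.2
    (by rw [fderiv_pe_snd hΩ q hp₀.1]; exact hd)
  refine ⟨δ, ξ, hδ, hξ, ?_, fun y hy => ?_, ?_⟩
  · exact ((hiff _ (mem_ball_self hδ) _ (mem_ball_self hε)).1 hp₀.2).symm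
  · have h1 := hsub (show (y, ξ y) ∈ _ from ⟨hy, hξm y hy⟩)
    exact ⟨⟨h1.1.1, (hiff y hy _ (hξm y hy)).2 rfl⟩, h1.2⟩
  · filter_upwards [(isOpen_ball.prod isOpen_ball).mem_nhds
      (show p₀ ∈ ball p₀.1 δ ×ˢ ball p₀.2 ε from ⟨mem_ball_self hδ, mem_ball_self hε⟩)]
      with p hp hpz
    exact (hiff p.1 hp.1 p.2 hp.2).1 hpz.2

theorem eventually_subset_of_eventually_subset (hΩ : IsOpen Ω) {q : (HolRing Ω)[X]} {p₀ : V × ℂ}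
    (hp₀ : p₀ ∈ zeroSet q) (hd : pe (derivative q) p₀ ≠ 0) {Z O : Set (V × ℂ)} (hO : IsOpen O)
    (hpO : p₀ ∈ O) {ι : Type*} {g : ι → V × ℂ → ℂ} (hg : ∀ i, DifferentiableOn ℂ (g i) O)
    (hZ : Z ∩ O = {z ∈ O | ∀ i, g i z = 0}) :
    ∀ᶠ p in 𝓝 p₀, p ∈ zeroSet q → (∀ᶠ z in 𝓝 p, z ∈ zeroSet q → z ∈ Z) →
      ∀ᶠ z in 𝓝 p₀, z ∈ zeroSet q → z ∈ Z := by
  obtain ⟨δ, ξ, hδ, hξ, hξ0, hξz, hξu⟩ := exists_branch hΩ hp₀ hd hO hpO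
  have hball : ∀ᶠ p : V × ℂ in 𝓝 p₀, p.1 ∈ ball p₀.1 δ :=
    continuous_fst.continuousAt.eventually (isOpen_ball.eventually_mem (mem_ball_self hδ))
  filter_upwards [hξu, hball] with p hp1 hp2 hpz hpev
  have hgr : p = (p.1, ξ p.1) := Prod.ext rfl (hp1 hpz)
  have hc : Tendsto (fun y => (y, ξ y)) (𝓝 p.1) (𝓝 p) := by
    have : ContinuousAt (fun y => (y, ξ y)) p.1 :=
      continuousAt_id.prodMk (hξ.differentiableAt (isOpen_ball.mem_nhds hp2)).continuousAt
    rw [ContinuousAt, ← hgr] at this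
    exact this
  have hzero : ∀ i, EqOn (fun y => g i (y, ξ y)) 0 (ball p₀.1 δ) := by
    intro i
    refine eqOn_zero_of_eventuallyEq isOpen_ball (convex_ball _ _).isPreconnected ?_ hp2 ?_
    · exact (hg i).comp (f := fun y => (y, ξ y)) (differentiableOn_id.prodMk hξ)
        fun y hy => (hξz y hy).2
    · filter_upwards [hc.eventually hpev, isOpen_ball.mem_nhds hp2] with y hy1 hy2
      exact ((Set.ext_iff.1 hZ _).1 ⟨hy1 (hξz y hy2).1, (hξz y hy2).2⟩).2 i
  filter_upwards [hξu, hball] with z hz1 hz2 hzz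
  have hzgr : z = (z.1, ξ z.1) := Prod.ext rfl (hz1 hzz)
  rw [hzgr]
  exact ((Set.ext_iff.1 hZ _).2 ⟨(hξz _ hz2).2, fun i => hzero i hz2⟩).1

/-- The finite set of roots of the polynomial over a point. -/
def rootsAt (q : (HolRing Ω)[X]) (y : V) : Finset ℂ := by
  classical
  exact if h : y ∈ Ω then (q.map (HolRing.ev ⟨y, h⟩)).roots.toFinset else ∅

theorem mem_rootsAt {q : (HolRing Ω)[X]} (hq : q.Monic) {y : V} (hy : y ∈ Ω) {x : ℂ} :
    x ∈ rootsAt q y ↔ pe q (y, x) = 0 := by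
  classical
  rw [rootsAt, dif_pos hy, Multiset.mem_toFinset, mem_roots (hq.map _).ne_zero, IsRoot.def,
    pe_eq q hy]

theorem card_rootsAt_le {q : (HolRing Ω)[X]} {y : V} (hy : y ∈ Ω) :
    (rootsAt q y).card ≤ q.natDegree := by
  classical
  rw [rootsAt, dif_pos hy]
  exact (Multiset.toFinset_card_le _).trans ((card_roots' _).trans natDegree_map_le)

theorem card_rootsAt {q : (HolRing Ω)[X]} (hq : q.Monic) {y : V} (hy : y ∈ Ω)
    (h : ∀ x, pe q (y, x) = 0 → pe (derivative q) (y, x) ≠ 0) :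
    (rootsAt q y).card = q.natDegree := by
  classical
  rw [rootsAt, dif_pos hy, Multiset.toFinset_card_of_nodup, IsAlgClosed.card_roots_eq_natDegree,
    hq.natDegree_map]
  rw [Multiset.nodup_iff_count_le_one]
  intro x
  rw [count_roots]
  by_contra! hlt
  obtain ⟨h1, h2⟩ := (one_lt_rootMultiplicity_iff_isRoot (hq.map _).ne_zero).1 hlt
  rw [derivative_map] at h2
  exact h x (by rw [pe_eq q hy]; exact h1) (by rw [pe_eq _ hy]; exact h2)

/-- Near a point with simple roots the roots are given by holomorphic branches. -/
theorem eventually_rootsAt_eq (hΩ : IsOpen Ω) {q : (HolRing Ω)[X]} (hq : q.Monic) {y₀ : V}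
    (hy₀ : y₀ ∈ Ω) (h : ∀ x, pe q (y₀, x) = 0 → pe (derivative q) (y₀, x) ≠ 0) :
    ∃ ξ : ℂ → V → ℂ, (∀ x ∈ rootsAt q y₀, ξ x y₀ = x ∧
        ∀ᶠ y in 𝓝 y₀, DifferentiableAt ℂ (ξ x) y) ∧
      ∀ᶠ y in 𝓝 y₀, rootsAt q y = (rootsAt q y₀).image (fun x => ξ x y) ∧
        Set.InjOn (fun x => ξ x y) (rootsAt q y₀) := by
  have hbr : ∀ x, ∃ ξ : V → ℂ, x ∈ rootsAt q y₀ → ξ y₀ = x ∧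
      (∀ᶠ y in 𝓝 y₀, DifferentiableAt ℂ ξ y) ∧ ∀ᶠ y in 𝓝 y₀, pe q (y, ξ y) = 0 := by
    intro x
    by_cases hx : x ∈ rootsAt q y₀
    · have hx' := (mem_rootsAt hq hy₀).1 hx
      obtain ⟨δ, ξ, hδ, hξ, hξ0, hξz, -⟩ := exists_branch hΩ (p₀ := (y₀, x)) ⟨hy₀, hx'⟩ (h x hx')
        isOpen_univ (mem_univ _)
      refine ⟨ξ, fun _ => ⟨hξ0, ?_, ?_⟩⟩
      · filter_upwards [isOpen_ball.mem_nhds (mem_ball_self hδ)] with y hy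
        exact hξ.differentiableAt (isOpen_ball.mem_nhds hy)
      · filter_upwards [isOpen_ball.mem_nhds (mem_ball_self hδ)] with y hy using (hξz y hy).1.2
    · exact ⟨0, fun h => absurd h hx⟩
  choose ξ hξ using hbr
  refine ⟨ξ, fun x hx => ⟨(hξ x hx).1, (hξ x hx).2.1⟩, ?_⟩
  have h1 : ∀ᶠ y in 𝓝 y₀, ∀ x ∈ rootsAt q y₀, pe q (y, ξ x y) = 0 :=
    (Finset.eventually_all _).2 fun x hx => (hξ x hx).2.2
  have h2 : ∀ᶠ y in 𝓝 y₀, ∀ x ∈ rootsAt q y₀, ∀ x' ∈ rootsAt q y₀, x ≠ x' → ξ x y ≠ ξ x' y := by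
    refine (Finset.eventually_all _).2 fun x hx => (Finset.eventually_all _).2 fun x' hx' => ?_
    by_cases hne : x = x'
    · exact Eventually.of_forall fun y h => absurd hne h
    have hc : ∀ x ∈ rootsAt q y₀, ContinuousAt (ξ x) y₀ := fun x hx =>
      (hξ x hx).2.1.self_of_nhds.continuousAt
    have h0 : ξ x y₀ - ξ x' y₀ ≠ 0 := by
      rw [(hξ x hx).1, (hξ x' hx').1]
      exact sub_ne_zero.2 hne
    exact (((hc x hx).sub (hc x' hx')).eventually_ne h0).mono fun y hy _ => sub_ne_zero.1 hy
  filter_upwards [h1, h2, hΩ.mem_nhds hy₀] with y hy1 hy2 hyΩ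
  have hinj : Set.InjOn (fun x => ξ x y) (rootsAt q y₀) := fun x hx x' hx' he => by
    by_contra hne
    exact hy2 x hx x' hx' hne he
  refine ⟨(Finset.eq_of_subset_of_card_le (fun z hz => ?_) ?_).symm, hinj⟩
  · obtain ⟨x, hx, rfl⟩ := Finset.mem_image.1 hz
    exact (mem_rootsAt hq hyΩ).2 (hy1 x hx)
  · rw [Finset.card_image_of_injOn hinj, card_rootsAt hq hy₀ h]
    exact card_rootsAt_le hyΩ

end Irreducibility

section Irreducibility

variable {V : Type*} [NormedAddCommGroup V] [NormedSpace ℂ V] [FiniteDimensional ℂ V] {Ω : Set V}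

theorem eventually_fn_ne_zero (hΩ : IsOpen Ω) {γ : HolRing Ω} {p : V × ℂ} (hp : p.1 ∈ Ω)
    (h : γ.fn p.1 ≠ 0) : ∀ᶠ z in 𝓝 p, γ.fn z.1 ≠ 0 :=
  continuous_fst.continuousAt.eventually
    (((γ.differentiableOn_fn.differentiableAt (hΩ.mem_nhds hp)).continuousAt).eventually_ne h)

/-- A subset of the zero set of an irreducible polynomial which is locally constant off the
discriminant is empty or everything off the discriminant. -/
theorem mem_of_locally_constant (hΩ : IsOpen Ω) (hc : IsConnected Ω) {q : (HolRing Ω)[X]}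
    (hq : q.Monic) (hirr : Irreducible q) (hb : ∀ y ∈ Ω, ∀ x, pe q (y, x) = 0 → ‖x‖ < 1)
    {γ : HolRing Ω} (hγ0 : γ ≠ 0)
    (hγ : ∀ z ∈ Ω, ∀ x, pe q (z, x) = 0 → pe (derivative q) (z, x) = 0 → γ.fn z = 0)
    {A : Set (V × ℂ)} (hA : ∀ p ∈ zeroSet q, γ.fn p.1 ≠ 0 →
      ∀ᶠ p' in 𝓝 p, p' ∈ zeroSet q → (p' ∈ A ↔ p ∈ A)) {p₁ : V × ℂ} (hp₁ : p₁ ∈ zeroSet q)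
    (hγ₁ : γ.fn p₁.1 ≠ 0) (hA₁ : p₁ ∈ A) {p₀ : V × ℂ} (hp₀ : p₀ ∈ zeroSet q)
    (hγ₀ : γ.fn p₀.1 ≠ 0) : p₀ ∈ A := by
  classical
  by_contra hn
  have := HolRing.isDomain hΩ hc
  let w : V → ℂ → ℂ := fun y x => if (y, x) ∈ A then 1 else 0
  have hw : ∀ y x, ‖w y x‖ ≤ 1 := fun y x => by
    simp only [w]
    split_ifs <;> simp
  have hext : ∀ k : ℕ, ∃ S : HolRing Ω, ∀ y ∈ Ω, γ.fn y ≠ 0 →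
      S.fn y = ∑ x ∈ rootsAt q y, w y x * x ^ k := by
    intro k
    let g : V → ℂ := fun y => ∑ x ∈ rootsAt q y, w y x * x ^ k
    have hg : DifferentiableOn ℂ g (Ω ∩ {z | γ.fn z ≠ 0}) := by
      rintro y₀ ⟨hy₀, hγy₀⟩
      obtain ⟨ξ, hξ, hev⟩ := eventually_rootsAt_eq hΩ hq hy₀
        fun x h1 h2 => hγy₀ (hγ y₀ hy₀ x h1 h2)
      have hloc : ∀ᶠ y in 𝓝 y₀, ∀ x ∈ rootsAt q y₀,
          (y, ξ x y) ∈ zeroSet q → ((y, ξ x y) ∈ A ↔ (y₀, x) ∈ A) := by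
        refine (Finset.eventually_all _).2 fun x hx => ?_
        have hcx : ContinuousAt (fun y => (y, ξ x y)) y₀ :=
          continuousAt_id.prodMk (hξ x hx).2.self_of_nhds.continuousAt
        have := hA (y₀, x) ⟨hy₀, (mem_rootsAt hq hy₀).1 hx⟩ hγy₀
        rw [ContinuousAt, (hξ x hx).1] at hcx
        exact hcx.eventually this
      have heq : ∀ᶠ y in 𝓝 y₀, ∑ x ∈ rootsAt q y, w y x * x ^ k =
          ∑ x ∈ rootsAt q y₀, w y₀ x * ξ x y ^ k := by
        filter_upwards [hev, hloc, hΩ.mem_nhds hy₀] with y hy1 hy2 hyΩ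
        rw [hy1.1, Finset.sum_image hy1.2]
        refine Finset.sum_congr rfl fun x hx => ?_
        have hz : (y, ξ x y) ∈ zeroSet q := ⟨hyΩ, (mem_rootsAt hq hyΩ).1 (by
          rw [hy1.1]
          exact Finset.mem_image_of_mem _ hx)⟩
        simp only [w, hy2 x hx hz]
      refine DifferentiableAt.differentiableWithinAt (DifferentiableAt.congr_of_eventuallyEq ?_ heq)
      exact DifferentiableAt.fun_sum fun x hx =>
        ((hξ x hx).2.self_of_nhds.pow k).const_mul _
    have hbd : ∀ y₀ ∈ Ω, ∃ M : ℝ, ∀ᶠ y in 𝓝 y₀, γ.fn y ≠ 0 → ‖g y‖ ≤ M := by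
      refine fun y₀ hy₀ => ⟨q.natDegree, ?_⟩
      filter_upwards [hΩ.mem_nhds hy₀] with y hy _
      calc _ ≤ ∑ x ∈ rootsAt q y, (1 : ℝ) := by
            refine norm_sum_le_of_le _ fun x hx => ?_
            rw [norm_mul, norm_pow]
            exact mul_le_one₀ (hw y x) (by positivity)
              (pow_le_one₀ (norm_nonneg _) (hb y hy x ((mem_rootsAt hq hy).1 hx)).le)
        _ ≤ q.natDegree := by
            rw [Finset.sum_const, nsmul_eq_mul, mul_one]
            exact_mod_cast card_rootsAt_le hy
    obtain ⟨G, hG, hGs⟩ := exists_extension hΩ γ.differentiableOn_fn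
      (fun z hz => HolRing.frequently_fn_ne_zero hΩ hc.isPreconnected hγ0 hz) hg hbd
    exact ⟨HolRing.mk G hG, fun y hy hy0 => by rw [HolRing.fn_mk hy, hGs y hy hy0]⟩
  choose S hS using hext
  let a : ℕ → HolRing Ω := fun i => ∑ j ∈ Finset.range (q.natDegree + 1),
    if i < j then q.coeff j * S (j - 1 - i) else 0
  have hval : ∀ p ∈ zeroSet q, γ.fn p.1 ≠ 0 →
      pe (polyOf q.natDegree a) p = w p.1 p.2 * pe (derivative q) p := by
    rintro ⟨y, x⟩ ⟨hy, hx⟩ h0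
    rw [pe_polyOf _ _ hy, pe_eq (derivative q) hy, ← derivative_map]
    have h1 := sum_power_sums (q.map (HolRing.ev ⟨y, hy⟩)) (F := rootsAt q y)
      (fun x hx => by rw [← pe_eq q hy]; exact (mem_rootsAt hq hy).1 hx) (w y)
      ((mem_rootsAt hq hy).2 hx)
    rw [hq.natDegree_map] at h1
    rw [← h1]
    refine Finset.sum_congr rfl fun i _ => ?_
    congr 1
    rw [← HolRing.ev_eq ⟨y, hy⟩, map_sum]
    refine Finset.sum_congr rfl fun j _ => ?_
    split_ifs with hij
    · rw [map_mul, coeff_map, HolRing.ev_eq _ (S _), hS _ y hy h0]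
    · rw [map_zero]
  have hd : ∀ p ∈ zeroSet q, γ.fn p.1 ≠ 0 → pe (derivative q) p ≠ 0 := fun p hp h0 h1 =>
    h0 (hγ p.1 hp.1 p.2 hp.2 h1)
  have hdvd : q ∣ polyOf q.natDegree a := by
    obtain ⟨t, ht, hto, hpt⟩ := _root_.mem_nhds_iff.1
      ((hA p₀ hp₀ hγ₀).and (eventually_fn_ne_zero hΩ hp₀.1 hγ₀))
    obtain ⟨δ, ξ, hδ, hξ, hξ0, hξz, -⟩ := exists_branch hΩ hp₀ (hd p₀ hp₀ hγ₀) hto hpt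
    refine dvd_of_vanish hΩ hc hq hirr (O := ball p₀.1 δ) (x := ξ) isOpen_ball
      ⟨p₀.1, mem_ball_self hδ⟩ (fun y hy => (hξz y hy).1.1) (fun y hy => (hξz y hy).1.2)
      fun y hy => ?_
    have h1 := hξz y hy
    have h2 := ht h1.2
    rw [hval _ h1.1 h2.2]
    simp only [w]
    rw [if_neg fun h => hn ((h2.1 h1.1).1 h), zero_mul]
  have hg0 : polyOf q.natDegree a = 0 := by
    by_contra hg0
    exact not_dvd_of_natDegree_lt hg0
      ((natDegree_lt_iff_degree_lt hg0).2 (degree_polyOf_lt _ _)) hdvd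
  have h1 := hval p₁ hp₁ hγ₁
  rw [hg0, pe_eq (0 : (HolRing Ω)[X]) hp₁.1, Polynomial.map_zero, eval_zero] at h1
  simp only [w] at h1
  rw [if_pos hA₁, one_mul] at h1
  exact hd p₁ hp₁ hγ₁ h1.symm

theorem mem_closure_zeroSet_ne (hΩ : IsOpen Ω) (hc : IsConnected Ω) {q : (HolRing Ω)[X]}
    (hq : q.Monic) {γ : HolRing Ω} (hγ0 : γ ≠ 0) {p₀ : V × ℂ} (hp₀ : p₀ ∈ zeroSet q) :
    p₀ ∈ closure {p ∈ zeroSet q | γ.fn p.1 ≠ 0} := by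
  have hd := natDegree_pos_of_root hq hp₀.1 hp₀.2
  rw [Metric.mem_closure_iff]
  intro ε hε
  have hcont : ContinuousAt (fun y => pe q (y, p₀.2)) p₀.1 :=
    (((differentiableOn_pe q).differentiableAt ((hΩ.prod isOpen_univ).mem_nhds
      (show p₀ ∈ Ω ×ˢ univ from ⟨hp₀.1, mem_univ _⟩))).continuousAt).comp
      (f := fun y => (y, p₀.2)) (by fun_prop)
  have hsmall : ∀ᶠ y in 𝓝 p₀.1, ‖pe q (y, p₀.2)‖ < ε ^ q.natDegree := by
    refine hcont.norm.eventually_lt_const ?_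
    change ‖pe q p₀‖ < _
    rw [hp₀.2, norm_zero]
    positivity
  obtain ⟨y, hy0, ⟨hy1, hy2⟩, hyΩ⟩ := ((HolRing.frequently_fn_ne_zero hΩ hc.isPreconnected hγ0
    hp₀.1).and_eventually ((hsmall.and (isOpen_ball.eventually_mem (mem_ball_self hε))).and
      (hΩ.eventually_mem hp₀.1))).exists
  obtain ⟨x, hx, hx2⟩ := exists_pe_root_near hq hd hyΩ p₀.2
  refine ⟨(y, x), ⟨⟨hyΩ, hx⟩, hy0⟩, ?_⟩
  rw [Prod.dist_eq, max_lt_iff, dist_comm p₀.1, dist_eq_norm p₀.2]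
  exact ⟨hy2, lt_of_pow_lt_pow_left₀ _ hε.le (hx2.trans_lt hy1)⟩

/-- The zero set of an irreducible polynomial is an irreducible analytic set. -/
theorem zeroSet_eq_or_eq (hΩ : IsOpen Ω) (hc : IsConnected Ω) {q : (HolRing Ω)[X]}
    (hq : q.Monic) (hirr : Irreducible q) (hb : ∀ y ∈ Ω, ∀ x, pe q (y, x) = 0 → ‖x‖ < 1)
    (hne : (zeroSet q).Nonempty) {Z₁ Z₂ : Set (V × ℂ)} (hZ : zeroSet q = Z₁ ∪ Z₂)
    (hcl : ∀ Z ∈ ({Z₁, Z₂} : Set (Set (V × ℂ))), ∀ p ∈ zeroSet q, p ∈ closure Z → p ∈ Z)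
    (han : ∀ Z ∈ ({Z₁, Z₂} : Set (Set (V × ℂ))), ∀ p ∈ zeroSet q, ∃ O, IsOpen O ∧ p ∈ O ∧
      ∃ (k : ℕ) (g : Fin k → V × ℂ → ℂ), (∀ i, DifferentiableOn ℂ (g i) O) ∧
        Z ∩ O = {z ∈ O | ∀ i, g i z = 0}) :
    zeroSet q = Z₁ ∨ zeroSet q = Z₂ := by
  have := HolRing.isDomain hΩ hc
  have := HolRing.charZero hc.nonempty
  obtain ⟨-, -, γ, hγ0, -, hγ⟩ := exists_bezout_pe hΩ hc hq hirr (not_dvd_derivative hq hirr)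
  have key : ∀ Z ∈ ({Z₁, Z₂} : Set (Set (V × ℂ))), ∀ p₁ ∈ zeroSet q, γ.fn p₁.1 ≠ 0 →
      (∀ᶠ z in 𝓝 p₁, z ∈ zeroSet q → z ∈ Z) → zeroSet q ⊆ Z := by
    intro Z hZmem p₁ hp₁ hγ₁ hev p hp
    refine hcl Z hZmem p hp (closure_mono ?_ (mem_closure_zeroSet_ne hΩ hc hq hγ0 hp))
    rintro p₀ ⟨hp₀, hγ₀⟩
    have hmem : p₀ ∈ {p | ∀ᶠ z in 𝓝 p, z ∈ zeroSet q → z ∈ Z} := by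
      refine mem_of_locally_constant hΩ hc hq hirr hb hγ0 hγ (fun p' hp' hγp' => ?_)
        hp₁ hγ₁ hev hp₀ hγ₀
      obtain ⟨O, hO, hpO, k, g, hg, hZO⟩ := han Z hZmem p' hp'
      have h1 := eventually_subset_of_eventually_subset hΩ hp'
        (fun h => hγp' (hγ p'.1 hp'.1 p'.2 hp'.2 h)) hO hpO hg hZO
      by_cases hA : ∀ᶠ z in 𝓝 p', z ∈ zeroSet q → z ∈ Z
      · filter_upwards [hA.eventually_nhds] with p'' h'' _
        exact ⟨fun _ => hA, fun _ => h''⟩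
      · filter_upwards [h1] with p'' h'' hz
        exact ⟨fun h => absurd (h'' hz h) hA, fun h => absurd h hA⟩
    exact hmem.self_of_nhds hp₀
  have hsub : zeroSet q ⊆ Z₁ ∨ zeroSet q ⊆ Z₂ := by
    obtain ⟨p, hp⟩ := hne
    obtain ⟨p₀, hp₀, hγ₀⟩ := closure_nonempty_iff.1
      ⟨p, mem_closure_zeroSet_ne hΩ hc hq hγ0 hp⟩
    by_cases hA : ∀ᶠ z in 𝓝 p₀, z ∈ zeroSet q → z ∈ Z₁
    · exact Or.inl (key Z₁ (by simp) p₀ hp₀ hγ₀ hA)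
    · obtain ⟨z, hz1, hz2⟩ := ((not_eventually.1 hA).and_eventually
        (eventually_fn_ne_zero hΩ hp₀.1 hγ₀)).exists
      rw [Classical.not_imp] at hz1
      refine Or.inr (key Z₂ (by simp) z hz1.1 hz2 ?_)
      have h1 : z ∈ (closure Z₁)ᶜ := fun h => hz1.2 (hcl Z₁ (by simp) z hz1.1 h)
      filter_upwards [isClosed_closure.isOpen_compl.mem_nhds h1] with z' hz' hq'
      rw [hZ] at hq'
      exact hq'.resolve_left fun h => hz' (subset_closure h)
  exact hsub.imp (fun h => h.antisymm (hZ ▸ subset_union_left))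
    fun h => h.antisymm (hZ ▸ subset_union_right)

end Irreducibility

section Dimension

variable {V : Type*} [NormedAddCommGroup V] [NormedSpace ℂ V] [FiniteDimensional ℂ V] {Ω : Set V}

theorem exists_mem_zeroSet_iterate_derivative {q : (HolRing Ω)[X]} (hq : q.Monic) {p : V × ℂ}
    (hp : p ∈ zeroSet q) :
    ∃ j : ℕ, p ∈ zeroSet (derivative^[j] q) ∧ pe (derivative (derivative^[j] q)) p ≠ 0 := by
  by_contra! h
  have h0 : ∀ j : ℕ, p ∈ zeroSet (derivative^[j] q) := by
    intro j
    induction j with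
    | zero => exact hp
    | succ j ih =>
      rw [Function.iterate_succ_apply']
      exact ⟨hp.1, h j ih⟩
  refine lt_irrefl ((q.map (HolRing.ev ⟨p.1, hp.1⟩)).rootMultiplicity p.2)
    ((lt_rootMultiplicity_iff_isRoot_iterate_derivative (hq.map _).ne_zero).2 fun m _ => ?_)
  rw [iterate_derivative_map, IsRoot.def, ← pe_eq]
  exact (h0 m).2

theorem dimH_simple_zeros_le (hΩ : IsOpen Ω) (q : (HolRing Ω)[X]) :
    dimH {p ∈ zeroSet q | pe (derivative q) p ≠ 0} ≤ dimH Ω := by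
  have : SecondCountableTopology (V × ℂ) := by
    have : ProperSpace (V × ℂ) := FiniteDimensional.proper ℂ _
    infer_instance
  by_contra! hlt
  obtain ⟨p, ⟨hp, hd⟩, ht⟩ := exists_mem_nhdsWithin_lt_dimH_of_lt_dimH hlt
  obtain ⟨δ, ξ, hδ, hξ, -, hξz, hξu⟩ := exists_branch hΩ hp hd isOpen_univ (mem_univ _)
  have hcd : ContDiffAt ℂ 1 ξ p.1 :=
    (analyticOnNhd_of_differentiableOn isOpen_ball hξ p.1 (mem_ball_self hδ)).contDiffAt
  obtain ⟨K, t, htn, hK⟩ := hcd.exists_lipschitzOnWith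
  let T : Set (V × ℂ) := (fun y => (y, ξ y)) '' (t ∩ ball p.1 δ)
  have hT : T ∈ 𝓝[{p ∈ zeroSet q | pe (derivative q) p ≠ 0}] p := by
    filter_upwards [nhdsWithin_le_nhds hξu, nhdsWithin_le_nhds
      (continuous_fst.continuousAt.preimage_mem_nhds (inter_mem htn (ball_mem_nhds p.1 hδ))),
      self_mem_nhdsWithin] with z hz1 hz2 hz3
    exact ⟨z.1, hz2, Prod.ext rfl (hz1 hz3.1).symm⟩
  refine (ht T hT).not_ge ?_
  have hL := (LipschitzWith.id.lipschitzOnWith (s := t ∩ ball p.1 δ)).prodMk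
    (hK.mono (inter_subset_left (t := ball p.1 δ)))
  exact hL.dimH_image_le.trans (dimH_mono fun y hy => (hξz y hy.2).1.1)

/-- The zero set of a monic polynomial of positive degree is of codimension one. -/
theorem dimH_zeroSet (hΩ : IsOpen Ω) {q : (HolRing Ω)[X]} (hq : q.Monic) (hd : 0 < q.natDegree) :
    dimH (zeroSet q) = dimH Ω := by
  refine le_antisymm ?_ ?_
  · have hsub : zeroSet q ⊆ ⋃ j : ℕ, {p ∈ zeroSet (derivative^[j] q) |
        pe (derivative (derivative^[j] q)) p ≠ 0} := fun p hp =>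
      mem_iUnion.2 (exists_mem_zeroSet_iterate_derivative hq hp)
    refine (dimH_mono hsub).trans ?_
    rw [dimH_iUnion]
    exact iSup_le fun j => dimH_simple_zeros_le hΩ _
  · have hsub : Ω ⊆ Prod.fst '' zeroSet q := fun y hy => by
      obtain ⟨x, hx, -⟩ := exists_pe_root_near hq hd hy 0
      exact ⟨(y, x), ⟨hy, hx⟩, rfl⟩
    exact (dimH_mono hsub).trans (LipschitzWith.prod_fst.dimH_image_le _)

end Dimension

section Transfer

variable {n : ℕ} {δ : ℝ} (L : CN (n + 1) ≃L[ℂ] (Fin n → ℂ) × ℂ) (p : CN (n + 1))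

theorem dimH_preimage_chart (S : Set ((Fin n → ℂ) × ℂ)) :
    dimH ((fun z => L (z - p)) ⁻¹' S) = dimH S := by
  have h : (fun z => L (z - p)) ⁻¹' S = (fun z => p + z) '' (L.symm '' S) := by
    ext z
    constructor
    · intro hz
      exact ⟨z - p, ⟨L (z - p), hz, L.symm_apply_apply _⟩, add_sub_cancel _ _⟩
    · rintro ⟨-, ⟨a, ha, rfl⟩, rfl⟩
      simpa using ha
  rw [h, (isometry_add_left p).dimH_image, L.symm.dimH_image]

theorem dimH_ball_complex {V : Type*} [NormedAddCommGroup V] [NormedSpace ℂ V]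
    [NormedSpace ℝ V] [FiniteDimensional ℝ V] (hδ : 0 < δ) :
    dimH (ball (0 : V) δ) = (Module.finrank ℝ V : ℝ≥0∞) :=
  Real.dimH_of_mem_nhds (ball_mem_nhds _ hδ)

variable {q : (HolRing (ball (0 : Fin n → ℂ) δ))[X]}

theorem continuous_chart : Continuous fun z => L (z - p) :=
  L.continuous.comp (continuous_id.sub continuous_const)

theorem continuous_chart_symm : Continuous fun a => p + L.symm a :=
  continuous_const.add L.symm.continuous

theorem differentiable_chart : Differentiable ℂ fun z => L (z - p) :=
  L.differentiable.comp (differentiable_id.sub_const p)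

theorem differentiable_chart_symm : Differentiable ℂ fun a => p + L.symm a :=
  L.symm.differentiable.const_add p

theorem chart_chart_symm (a : (Fin n → ℂ) × ℂ) : L (p + L.symm a - p) = a := by simp

theorem chart_symm_chart (z : CN (n + 1)) : p + L.symm (L (z - p)) = z := by simp

theorem isComplexSubvariety_preimage_zeroSet
    (hb : ∀ y ∈ ball (0 : Fin n → ℂ) δ, ∀ x, pe q (y, x) = 0 → ‖x‖ < 1) :
    IsComplexSubvariety (n + 1) ((fun z => L (z - p)) ⁻¹' bid (Fin n → ℂ) δ)
      ((fun z => L (z - p)) ⁻¹' zeroSet q) := by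
  have hsub : zeroSet q ⊆ bid (Fin n → ℂ) δ := fun a ha =>
    ⟨ha.1, mem_ball_zero_iff.2 (hb a.1 ha.1 a.2 ha.2)⟩
  have hO : IsOpen ((fun z => L (z - p)) ⁻¹' bid (Fin n → ℂ) δ) :=
    (isOpen_bid δ).preimage (continuous_chart L p)
  have hd : DifferentiableOn ℂ (fun z => pe q (L (z - p)))
      ((fun z => L (z - p)) ⁻¹' bid (Fin n → ℂ) δ) :=
    (differentiableOn_pe q).comp (differentiable_chart L p).differentiableOn
      fun z hz => ⟨hz.1, mem_univ _⟩
  refine ⟨preimage_mono hsub, ?_, fun z hz => ⟨_, hO, hz, subset_rfl, 1,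
    fun _ z => pe q (L (z - p)), fun _ => ?_, ?_⟩⟩
  · rintro z ⟨hz, hzU⟩
    refine ⟨hzU.1, ?_⟩
    have hcl : z ∈ closure {w | pe q (L (w - p)) = 0} := closure_mono (fun w hw => hw.2) hz
    have hc : ContinuousAt (fun z => pe q (L (z - p))) z :=
      (hd.differentiableAt (hO.mem_nhds hzU)).continuousAt
    by_contra hne
    obtain ⟨w, hw1, hw2⟩ := (mem_closure_iff_frequently.1 hcl).and_eventually
      (hc.eventually_ne hne) |>.exists
    exact hw2 hw1
  · exact (analyticOnNhd_of_differentiableOn hO hd).analyticOn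
  · ext z
    constructor
    · exact fun h => ⟨h.2, fun _ => h.1.2⟩
    · exact fun h => ⟨⟨h.1.1, h.2 0⟩, h.1⟩

/-- The zero set of an irreducible polynomial is an irreducible hypersurface. -/
theorem isIrreducibleCxSubvariety_preimage_zeroSet (hδ : 0 < δ) (hq : q.Monic)
    (hirr : Irreducible q) (hb : ∀ y ∈ ball (0 : Fin n → ℂ) δ, ∀ x, pe q (y, x) = 0 → ‖x‖ < 1)
    (h0 : pe q (0, 0) = 0) :
    IsIrreducibleCxSubvariety (n + 1) ((fun z => L (z - p)) ⁻¹' bid (Fin n → ℂ) δ)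
      ((fun z => L (z - p)) ⁻¹' zeroSet q) := by
  have hsub : zeroSet q ⊆ bid (Fin n → ℂ) δ := fun a ha =>
    ⟨ha.1, mem_ball_zero_iff.2 (hb a.1 ha.1 a.2 ha.2)⟩
  have hz0 : ((0, 0) : (Fin n → ℂ) × ℂ) ∈ zeroSet q := ⟨mem_ball_self hδ, h0⟩
  refine ⟨isComplexSubvariety_preimage_zeroSet L p hb, ⟨p, ?_⟩, fun W₁ W₂ hW₁ hW₂ hW => ?_⟩
  · change L (p - p) ∈ zeroSet q
    rw [sub_self, map_zero]
    exact hz0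
  have hback : ∀ W : Set (CN (n + 1)), zeroSet q = (fun a => p + L.symm a) ⁻¹' W →
      (fun z => L (z - p)) ⁻¹' zeroSet q = W := fun W h => by
    rw [h, ← preimage_comp]
    ext z
    simp
  have hlocal : ∀ W, IsComplexSubvariety (n + 1) ((fun z => L (z - p)) ⁻¹' bid (Fin n → ℂ) δ) W →
      ∀ a ∈ zeroSet q, (a ∈ closure ((fun a => p + L.symm a) ⁻¹' W) →
        a ∈ (fun a => p + L.symm a) ⁻¹' W) ∧ ∃ O, IsOpen O ∧ a ∈ O ∧
      ∃ (k : ℕ) (g : Fin k → (Fin n → ℂ) × ℂ → ℂ), (∀ i, DifferentiableOn ℂ (g i) O) ∧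
        (fun a => p + L.symm a) ⁻¹' W ∩ O = {z ∈ O | ∀ i, g i z = 0} := by
    rintro W ⟨-, hcl, hloc⟩ a ha
    have haU : p + L.symm a ∈ (fun z => L (z - p)) ⁻¹' bid (Fin n → ℂ) δ := by
      change L (p + L.symm a - p) ∈ bid (Fin n → ℂ) δ
      rw [chart_chart_symm]
      exact hsub ha
    refine ⟨fun h => hcl ⟨(continuous_chart_symm L p).closure_preimage_subset W h, haU⟩, ?_⟩
    obtain ⟨V, hV, haV, -, k, f, hf, hfW⟩ := hloc _ haU
    refine ⟨_, hV.preimage (continuous_chart_symm L p), haV, k,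
      fun i a => f i (p + L.symm a), fun i => ?_, ?_⟩
    · exact (hf i).differentiableOn.comp (differentiable_chart_symm L p).differentiableOn
        fun a ha => ha
    · ext a
      exact Set.ext_iff.1 hfW (p + L.symm a)
  have hall : ∀ Z ∈ ({(fun a => p + L.symm a) ⁻¹' W₁, (fun a => p + L.symm a) ⁻¹' W₂} :
      Set (Set ((Fin n → ℂ) × ℂ))), ∃ W, Z = (fun a => p + L.symm a) ⁻¹' W ∧
      IsComplexSubvariety (n + 1) ((fun z => L (z - p)) ⁻¹' bid (Fin n → ℂ) δ) W := by
    rintro Z (rfl | rfl)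
    exacts [⟨W₁, rfl, hW₁⟩, ⟨W₂, rfl, hW₂⟩]
  refine (zeroSet_eq_or_eq isOpen_ball ⟨⟨0, mem_ball_self hδ⟩, (convex_ball _ _).isPreconnected⟩
    hq hirr hb ⟨_, hz0⟩ ?_ (fun Z hZ a ha => ?_) fun Z hZ a ha => ?_).imp (hback W₁) (hback W₂)
  · rw [← preimage_union, ← hW, ← preimage_comp]
    ext a
    simp
  · obtain ⟨W, rfl, hW⟩ := hall Z hZ
    exact (hlocal W hW a ha).1
  · obtain ⟨W, rfl, hW⟩ := hall Z hZ
    exact (hlocal W hW a ha).2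

end Transfer

/-- Through every point of the closure of the hypersurface part of a Levi-flat real subvariety
there passes an irreducible hypersurface contained in that closure. -/
theorem exists_irreducible_hypersurface {N : ℕ} {U H : Set (CN N)} (hH : IsLeviFlatHypervariety N U H)
    {p : CN N} (hp : p ∈ closure (hypStar N H) ∩ U) :
    ∃ U' W : Set (CN N), IsOpen U' ∧ p ∈ U' ∧ U' ⊆ U ∧
      IsIrreducibleCxSubvariety N U' W ∧ dimH W = ((2 * N - 2 : ℕ) : ℝ≥0∞) ∧
      W ⊆ closure (hypStar N H) ∩ U ∧ p ∈ W := by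
  obtain ⟨-, hsub, -, hlf⟩ := hH
  obtain ⟨n, rfl⟩ : ∃ n, N = n + 1 := Nat.exists_eq_add_of_lt
    (pos_of_hypStar_nonempty hlf (closure_nonempty_iff.1 ⟨p, hp.1⟩)) |>.imp fun n h => by
      rw [h, zero_add]
  obtain ⟨L, δ, hδ, hU, Q, hQ, hroot, hQ0⟩ := exists_polynomial_in_closure_hypStar hsub hlf hp
  have h0 : (0 : Fin n → ℂ) ∈ ball (0 : Fin n → ℂ) δ := mem_ball_self hδ
  have hconn : IsConnected (ball (0 : Fin n → ℂ) δ) := ⟨⟨0, h0⟩, (convex_ball _ _).isPreconnected⟩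
  have := HolRing.isDomain isOpen_ball hconn
  obtain ⟨q, hq, hirr, ⟨R, rfl⟩, hq0⟩ := exists_irreducible_factor hQ
    (fun A => pe A ((0 : Fin n → ℂ), (0 : ℂ)) = 0) (by rw [pe_one h0]; exact one_ne_zero)
    (fun A B h => by rwa [pe_mul A B h0, mul_eq_zero] at h) hQ0
  have hqroot : ∀ y ∈ ball (0 : Fin n → ℂ) δ, ∀ x, pe q (y, x) = 0 →
      p + L.symm (y, x) ∈ closure (hypStar (n + 1) H) ∩ U ∧ ‖x‖ < 1 := fun y hy x hx =>
    hroot y hy x (by rw [pe_mul _ _ hy, hx, zero_mul])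
  have hpz : L (p - p) ∈ zeroSet q := by
    rw [sub_self, map_zero]
    exact ⟨h0, hq0⟩
  refine ⟨(fun z => L (z - p)) ⁻¹' bid (Fin n → ℂ) δ, (fun z => L (z - p)) ⁻¹' zeroSet q,
    (isOpen_bid δ).preimage (continuous_chart L p), ?_, fun z hz => ?_,
    isIrreducibleCxSubvariety_preimage_zeroSet L p hδ hq hirr (fun y hy x hx =>
      (hqroot y hy x hx).2) hq0, ?_, fun z hz => ?_, hpz⟩
  · exact ⟨hpz.1, mem_ball_zero_iff.2 (hqroot _ hpz.1 _ hpz.2).2⟩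
  · have := hU _ hz
    rwa [chart_symm_chart] at this
  · rw [dimH_preimage_chart, dimH_zeroSet isOpen_ball hq (natDegree_pos_of_root hq h0 hq0),
      dimH_ball_complex hδ]
    congr 1
    rw [finrank_real_of_complex, Module.finrank_fin_fun]
    omega
  · have h1 : p + L.symm (L (z - p)) ∈ closure (hypStar (n + 1) H) ∩ U :=
      (hqroot (L (z - p)).1 hz.1 (L (z - p)).2 hz.2).1
    rwa [chart_symm_chart] at h1

end LeviFlat

/-- through every point `p ∈ closure H* ∩ U` of a Levi-flat
real-hypervariety `H ⊆ U` there passes an irreducible complex subvariety `W` of a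
neighborhood `U' ⊆ U` of `p`, of complex dimension `N - 1`, with `W ⊆ closure H* ∩ U`. -/
theorem stmt10 (N : ℕ) (U H : Set (CN N)) (hH : IsLeviFlatHypervariety N U H)
    (p : CN N) (hp : p ∈ closure (hypStar N H) ∩ U) :
    ∃ U' W : Set (CN N), IsOpen U' ∧ p ∈ U' ∧ U' ⊆ U ∧
      IsIrreducibleCxSubvariety N U' W ∧ dimH W = ((2 * N - 2 : ℕ) : ℝ≥0∞) ∧
      W ⊆ closure (hypStar N H) ∩ U ∧ p ∈ W := by
  exact LeviFlat.exists_irreducible_hypersurface hH hp
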